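/- Let q be a prime power and suppose the triple (a, b, c) ∈ F_q³ satisfies a ≠ 0 and b² − 4ac ≠ 0. Let e be a divisor of q − 1, let P = p₁⋯p_s (s ≥ 1) be a product of distinct primes dividing q − 1 and L = l₁⋯l_r (r ≥ 1) a product of distinct primes dividing q − 1, such that Rad(q − 1) = Rad(e)·P·L with Rad(e), P and L pairwise coprime. Set δ = 1 − 2·Σ_{i=1}^{s} 1/p_i, ε = Σ_{j=1}^{r} 1/l_j, m = θ(e), and W = W(e). Assume m²·δ > 2ε and √q > [ m²·(2s − 1 + 2δ)·( 2W(W − 3/2) + 3W/(2√q) ) + δ + r − ε + (1/√q)·( (3·m²·δ·W)/2 + 2r − ε ) ] / ( m²·δ − 2ε ). Then there exists a primitive root g of F_q such that a·g² + b·g + c is also a primitive root of F_q. -/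

import Mathlib

/-- `W(m) = 2^{ω(m)}`, where `ω(m)` is the number of distinct prime divisors of `m`. -/
def W (m : ℕ) : ℕ := 2 ^ m.primeFactors.card

/-- `θ(m) = ∏_{p ∣ m, p prime} (1 − 1/p)`. -/
noncomputable def θ (m : ℕ) : ℝ := ∏ p ∈ m.primeFactors, (1 - 1 / (p : ℝ))

/-- `Rad(m)`: the product of the distinct primes dividing `m`. -/
def Rad (m : ℕ) : ℕ := ∏ p ∈ m.primeFactors, p

open Polynomial in
theorem exists_hasseDeriv_pow_eq {E : Type*} [Field E] (G : E[X]) (hG : G ≠ 0) :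
    ∃ P : ℕ → ℕ → E[X], ∀ N a, a ≤ N →
      hasseDeriv a (G ^ N) = G ^ (N - a) * P N a ∧ (P N a).natDegree ≤ a * G.natDegree := by
  have hdvd : ∀ N a, a ≤ N → G ^ (N - a) ∣ hasseDeriv a (G ^ N) := by
    intro N
    induction N with
    | zero => intro a ha; obtain rfl : a = 0 := by omega
              simp
    | succ N ih =>
      intro a ha
      rw [pow_succ', hasseDeriv_mul]
      refine Finset.dvd_sum fun x hx => ?_
      rw [Finset.HasAntidiagonal.mem_antidiagonal] at hx
      rcases Nat.eq_zero_or_pos x.1 with h | h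
      · rw [h, hasseDeriv_zero']
        have hx2 : x.2 = a := by omega
        rw [hx2]
        rcases Nat.lt_or_ge N a with h3 | h3
        · have : N + 1 - a = 0 := by omega
          simp [this]
        · have : N + 1 - a = N - a + 1 := by omega
          rw [this, pow_succ']
          exact mul_dvd_mul_left _ (ih a h3)
      · refine Dvd.dvd.mul_left ?_ _
        exact (pow_dvd_pow G (by omega)).trans (ih x.2 (by omega))
  refine ⟨fun N a => hasseDeriv a (G ^ N) / G ^ (N - a), fun N a ha => ?_⟩
  have heq : hasseDeriv a (G ^ N) = G ^ (N - a) * (hasseDeriv a (G ^ N) / G ^ (N - a)) :=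
    (EuclideanDomain.mul_div_cancel' (pow_ne_zero _ hG) (hdvd N a ha)).symm
  refine ⟨heq, ?_⟩
  by_cases h0 : hasseDeriv a (G ^ N) / G ^ (N - a) = 0
  · simp [h0]
  have h1 := congrArg natDegree heq
  rw [natDegree_mul (pow_ne_zero _ hG) h0, natDegree_pow] at h1
  have h2 := natDegree_hasseDeriv_le (G ^ N) a
  rw [natDegree_pow] at h2
  have h3 : N * G.natDegree = (N - a) * G.natDegree + a * G.natDegree := by
    rw [← add_mul]; congr 1; omega
  change (hasseDeriv a (G ^ N) / G ^ (N - a)).natDegree ≤ _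
  omega

open Polynomial in
theorem coeff_X_pow_add_C_pow_mul {E : Type*} [Field E] (Q j l : ℕ) (c : E) (H : E[X]) (hl : l <
    Q) :
    ((X ^ Q + C c) ^ j * H).coeff l = c ^ j * H.coeff l := by
  have h1 : (X : E[X]) ^ Q ∣ (X ^ Q + C c) ^ j - C c ^ j := by
    have := sub_dvd_pow_sub_pow (X ^ Q + C c) (C c) j
    simpa using this
  obtain ⟨u, hu⟩ := h1
  have h2 : (X ^ Q + C c) ^ j * H = C (c ^ j) * H + X ^ Q * (u * H) := by
    rw [C_pow]; linear_combination H * hu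
  rw [h2, coeff_add, coeff_C_mul, coeff_X_pow_mul', if_neg (by omega), add_zero]

open Polynomial in
theorem eq_zero_of_sum_eq_zero_of_rootMultiplicity {E ι : Type*} [Field E] (α : E) (s : Finset ι)
    (t : ι → E[X]) (hinj : ∀ i ∈ s, ∀ j ∈ s, t i ≠ 0 → t j ≠ 0 →
      (t i).rootMultiplicity α = (t j).rootMultiplicity α → i = j)
    (hsum : ∑ i ∈ s, t i = 0) : ∀ i ∈ s, t i = 0 := by
  classical
  by_contra! hne
  obtain ⟨i₀, hi₀, hti₀⟩ := hne
  obtain ⟨i, hi, hmin⟩ := Finset.exists_min_image (s.filter fun i => t i ≠ 0)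
    (fun i => (t i).rootMultiplicity α) ⟨i₀, by simp [hi₀, hti₀]⟩
  rw [Finset.mem_filter] at hi
  rw [← Finset.add_sum_erase _ _ hi.1] at hsum
  have h1 : (X - C α) ^ ((t i).rootMultiplicity α + 1) ∣ ∑ j ∈ s.erase i, t j := by
    refine Finset.dvd_sum fun j hj => ?_
    rw [Finset.mem_erase] at hj
    by_cases h0 : t j = 0
    · simp [h0]
    rw [← le_rootMultiplicity_iff h0]
    have h2 := hmin j (by simp [hj.2, h0])
    have h3 : (t i).rootMultiplicity α ≠ (t j).rootMultiplicity α := fun h =>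
      hj.1 (hinj i hi.1 j hj.2 hi.2 h0 h).symm
    omega
  have h2 : (X - C α) ^ ((t i).rootMultiplicity α + 1) ∣ t i := by
    exact (dvd_add_left h1).1 (by rw [hsum]; exact dvd_zero _)
  rw [← le_rootMultiplicity_iff hi.2] at h2
  omega

open Polynomial in
theorem card_mul_le_natDegree_of_taylor_coeff {E : Type*} [Field E] (Z : Finset E) (M : ℕ) (R :
    E[X])
    (hR : R ≠ 0) (h : ∀ x ∈ Z, ∀ l < M, (taylor x R).coeff l = 0) : M * Z.card ≤ R.natDegree := by
  have h1 : ∏ x ∈ Z, (X - C x) ^ M ∣ R := by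
    refine Finset.prod_dvd_of_coprime ?_ ?_
    · intro x _ y _ hxy
      exact (pairwise_coprime_X_sub_C Function.injective_id hxy).pow
    · intro x hx
      rw [X_sub_C_pow_dvd_iff, ← taylor_apply, X_pow_dvd_iff]
      exact h x hx
  have h2 := natDegree_le_of_dvd h1 hR
  rw [natDegree_prod _ _ (fun x _ => pow_ne_zero _ (X_sub_C_ne_zero x))] at h2
  simpa [mul_comm] using h2

open Polynomial in
theorem stepanov_aux {E : Type*} [Field E] {p r : ℕ} [ExpChar E p] (Q n m M J D : ℕ) (hQ : Q = p
    ^ r)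
    (hnm : n * m + 1 = Q) (G : E[X]) (hD : G.natDegree ≤ D)
    (α : E) (hα : G.rootMultiplicity α = 1) (hMQ : M ≤ Q) (hm : 0 < m)
    (hdim : M * (m + M * D + J) < n * J * m) (ζ : E) (Z : Finset E)
    (hZ : ∀ x ∈ Z, x ^ Q = x ∧ G.eval x ^ m = ζ) :
    M * Z.card ≤ M * D + m + n * m * D + J * Q := by
  classical
  have hG : G ≠ 0 := by rintro rfl; simp at hα
  obtain ⟨P, hP⟩ := exists_hasseDeriv_pow_eq G hG
  set B := m + M * D + J with hB
  let κ : Fin n → Fin J → ((Fin n × Fin J × Fin m) → E) →ₗ[E] E[X] := fun i j =>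
    ∑ a : Fin m, (monomial (a : ℕ)) ∘ₗ LinearMap.proj (R := E) (φ := fun _ => E) (i, j, a)
  let Λ : ℕ → ℕ → E[X] →ₗ[E] E[X] := fun N l =>
    ∑ x ∈ Finset.HasAntidiagonal.antidiagonal l, LinearMap.mulLeft E (P N x.1 * G ^ x.2) ∘ₗ
        hasseDeriv x.2
  let T : ℕ → ((Fin n × Fin J × Fin m) → E) →ₗ[E] E[X] := fun l =>
    ∑ i : Fin n, ∑ j : Fin J, LinearMap.mulLeft E (C (ζ ^ (i : ℕ)) * (X - C (α ^ Q)) ^ (j : ℕ)) ∘ₗ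
      Λ (M + i * m) l ∘ₗ κ i j
  let Φ : ((Fin n × Fin J × Fin m) → E) →ₗ[E] (Fin M × Fin B → E) :=
    LinearMap.pi fun lt => lcoeff E (lt.2 : ℕ) ∘ₗ T lt.1
  have hker : LinearMap.ker Φ ≠ ⊥ := by
    apply LinearMap.ker_ne_bot_of_finrank_lt
    simp only [Module.finrank_pi, Fintype.card_prod, Fintype.card_fin]
    rw [← mul_assoc]; exact hdim
  obtain ⟨c, hc, hc0⟩ := (Submodule.ne_bot_iff _).1 hker
  have hκdeg : ∀ i j, κ i j c ≠ 0 → (κ i j c).natDegree < m := by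
    intro i j h0
    rw [natDegree_lt_iff_degree_lt h0]
    simp only [κ, LinearMap.sum_apply, LinearMap.comp_apply, LinearMap.proj_apply]
    refine (degree_sum_le _ _).trans_lt ?_
    rw [Finset.sup_lt_iff (by simp)]
    intro a _
    exact (degree_monomial_le _ _).trans_lt (by exact_mod_cast a.2)
  have hκdeg' : ∀ i j, (κ i j c).natDegree ≤ m - 1 := by
    intro i j
    by_cases h0 : κ i j c = 0
    · simp [h0]
    · have := hκdeg i j h0; omega
  have hΛdeg : ∀ N l k, l ≤ N → k.natDegree ≤ m - 1 → (Λ N l k).natDegree ≤ l * D + (m - 1) := by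
    intro N l k hl hk
    simp only [Λ, LinearMap.sum_apply, LinearMap.comp_apply, LinearMap.mulLeft_apply]
    refine natDegree_sum_le_of_forall_le _ _ fun x hx => ?_
    rw [Finset.HasAntidiagonal.mem_antidiagonal] at hx
    have h1 := (hP N x.1 (by omega)).2
    have h2 := natDegree_hasseDeriv_le k x.2
    refine natDegree_mul_le.trans ?_
    have h3 := natDegree_mul_le (p := P N x.1) (q := G ^ x.2)
    rw [natDegree_pow] at h3
    have h4 : x.1 * G.natDegree + x.2 * G.natDegree ≤ l * D := by
      rw [← add_mul, hx]; exact Nat.mul_le_mul_left _ hD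
    omega
  have hT0 : ∀ l < M, T l c = 0 := by
    intro l hl
    ext t
    rw [coeff_zero]
    rcases Nat.lt_or_ge t B with ht | ht
    · exact congrFun (LinearMap.mem_ker.1 hc) (⟨l, hl⟩, ⟨t, ht⟩)
    · apply coeff_eq_zero_of_natDegree_lt
      refine lt_of_lt_of_le (b := B) ?_ ht
      have hJ : 0 < J := by
        rcases Nat.eq_zero_or_pos J with h | h
        · subst h; simp at hdim
        · exact h
      suffices (T l c).natDegree ≤ l * D + (m - 1) + J by
        have h5 : l * D ≤ M * D := Nat.mul_le_mul_right _ hl.le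
        omega
      simp only [T, LinearMap.sum_apply, LinearMap.comp_apply, LinearMap.mulLeft_apply]
      refine natDegree_sum_le_of_forall_le _ _ fun i _ => natDegree_sum_le_of_forall_le _ _ fun j
          _ => ?_
      refine natDegree_mul_le.trans ?_
      have h6 := hΛdeg (M + i * m) l (κ i j c) (by omega) (hκdeg' i j)
      have h7 : (C (ζ ^ (i : ℕ)) * (X - C (α ^ Q)) ^ (j : ℕ)).natDegree ≤ J := by
        refine (natDegree_C_mul_le _ _).trans ?_
        rw [natDegree_pow, natDegree_X_sub_C, mul_one]
        exact j.2.le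
      omega
  let t : Fin n × Fin J → E[X] := fun ij =>
    ((X - C α) ^ Q) ^ (ij.2 : ℕ) * (G ^ (M + ij.1 * m) * κ ij.1 ij.2 c)
  have hmult : ∀ ij, t ij ≠ 0 → κ ij.1 ij.2 c ≠ 0 ∧ (t ij).rootMultiplicity α =
      Q * ij.2 + (M + ij.1 * m + (κ ij.1 ij.2 c).rootMultiplicity α) := by
    intro ij h0
    have h1 : G ^ (M + ij.1 * m) * κ ij.1 ij.2 c ≠ 0 := right_ne_zero_of_mul h0
    refine ⟨right_ne_zero_of_mul h1, ?_⟩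
    have hpow : ∀ k, (G ^ k).rootMultiplicity α = k := by
      intro k
      induction k with
      | zero => simp
      | succ k ih =>
        rw [pow_succ, rootMultiplicity_mul (by rw [← pow_succ]; exact pow_ne_zero _ hG), ih, hα]
    simp only [t]
    rw [rootMultiplicity_mul h0, rootMultiplicity_mul h1, hpow, ← pow_mul,
      rootMultiplicity_X_sub_C_pow]
  have hord : ∀ k : E[X], k ≠ 0 → k.rootMultiplicity α ≤ k.natDegree := fun k hk => by
    have := natDegree_le_of_dvd (pow_rootMultiplicity_dvd k α) hk
    rwa [natDegree_pow, natDegree_X_sub_C, mul_one] at this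
  have hR : ∑ ij, t ij ≠ 0 := by
    intro h0
    have hall := eq_zero_of_sum_eq_zero_of_rootMultiplicity α Finset.univ t ?_ h0
    · apply hc0
      ext ⟨i, j, a⟩
      have h1 := hall (i, j) (Finset.mem_univ _)
      have h2 : κ i j c = 0 := by
        simp only [t] at h1
        rcases mul_eq_zero.1 h1 with h | h
        · exact absurd h (pow_ne_zero _ (pow_ne_zero _ (X_sub_C_ne_zero α)))
        · rcases mul_eq_zero.1 h with h | h
          · exact absurd h (pow_ne_zero _ hG)
          · exact h
      have h3 := congrArg (fun f => coeff f (a : ℕ)) h2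
      simp only [κ, LinearMap.sum_apply, LinearMap.comp_apply, LinearMap.proj_apply,
          finsetSum_coeff,
        coeff_monomial, coeff_zero] at h3
      rw [Finset.sum_eq_single a (by
        intro b _ hb
        rw [if_neg]
        exact fun h => hb (Fin.ext h)) (by simp)] at h3
      simpa using h3
    · intro x _ y _ hx hy hxy
      obtain ⟨hx1, hx2⟩ := hmult x hx
      obtain ⟨hy1, hy2⟩ := hmult y hy
      have hx3 := hord _ hx1
      have hy3 := hord _ hy1
      have hx4 := hκdeg _ _ hx1
      have hy4 := hκdeg _ _ hy1
      rw [hx2, hy2] at hxy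
      set ox := (κ x.1 x.2 c).rootMultiplicity α
      set oy := (κ y.1 y.2 c).rootMultiplicity α
      have hxl : x.1 * m + ox < Q := by
        have : ((x.1 : ℕ) + 1) * m ≤ n * m := Nat.mul_le_mul_right _ x.1.2
        rw [add_mul, one_mul] at this
        omega
      have hyl : y.1 * m + oy < Q := by
        have : ((y.1 : ℕ) + 1) * m ≤ n * m := Nat.mul_le_mul_right _ y.1.2
        rw [add_mul, one_mul] at this
        omega
      have e1 : Q * x.2 + (x.1 * m + ox) = Q * y.2 + (y.1 * m + oy) := by omega
      have e2 : (x.2 : ℕ) = y.2 := by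
        have := congrArg (· / Q) e1
        simpa [Nat.mul_add_div (by omega : 0 < Q), Nat.div_eq_of_lt hxl, Nat.div_eq_of_lt hyl]
            using this
      rw [e2] at e1
      have e3 : m * x.1 + ox = m * y.1 + oy := by
        rw [mul_comm m, mul_comm m]; omega
      have e4 : (x.1 : ℕ) = y.1 := by
        have := congrArg (· / m) e3
        simpa [Nat.mul_add_div hm, Nat.div_eq_of_lt (by omega : ox < m),
          Nat.div_eq_of_lt (by omega : oy < m)] using this
      exact Prod.ext (Fin.ext e4) (Fin.ext e2)
  have hvan : ∀ x ∈ Z, ∀ l < M, (taylor x (∑ ij, t ij)).coeff l = 0 := by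
    intro x hx l hl
    obtain ⟨hxQ, hxζ⟩ := hZ x hx
    have hterm : ∀ i j, (taylor x (t (i, j))).coeff l =
        G.eval x ^ (M - l) * ((C (ζ ^ (i : ℕ)) * (X - C (α ^ Q)) ^ (j : ℕ)) *
          Λ (M + i * m) l (κ i j c)).eval x := by
      intro i j
      have h1 : taylor x (t (i, j)) = (X ^ Q + C (x - α ^ Q)) ^ (j : ℕ) *
          taylor x (G ^ (M + i * m) * κ i j c) := by
        simp only [t]
        rw [taylor_mul, taylor_pow, taylor_pow]
        congr 2
        rw [map_sub, taylor_X, taylor_C, add_sub_assoc, ← C_sub, hQ, add_pow_expChar_pow, ← C_pow,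
          sub_pow_expChar_pow, ← hQ, hxQ]
      rw [h1, coeff_X_pow_add_C_pow_mul _ _ _ _ _ (by omega), taylor_coeff, hasseDeriv_mul]
      have h2 : ∑ ij ∈ Finset.HasAntidiagonal.antidiagonal l, (hasseDeriv ij.1) (G ^ (M + i * m)) *
          (hasseDeriv ij.2) (κ i j c) = G ^ (M + i * m - l) * Λ (M + i * m) l (κ i j c) := by
        simp only [Λ, LinearMap.sum_apply, LinearMap.comp_apply, LinearMap.mulLeft_apply]
        rw [Finset.mul_sum]
        refine Finset.sum_congr rfl fun y hy => ?_
        rw [Finset.HasAntidiagonal.mem_antidiagonal] at hy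
        rw [(hP (M + i * m) y.1 (by omega)).1]
        have : M + i * m - y.1 = (M + i * m - l) + y.2 := by omega
        rw [this, pow_add]
        ring
      rw [h2]
      have h3 : M + i * m - l = (M - l) + m * i := by rw [mul_comm m]; omega
      simp only [eval_mul, eval_pow, eval_sub, eval_X, eval_C]
      rw [h3, pow_add, pow_mul, hxζ]
      ring
    rw [map_sum, finsetSum_coeff, Fintype.sum_prod_type]
    simp only [hterm]
    simp only [← Finset.mul_sum, ← eval_finsetSum]
    have := hT0 l hl
    simp only [T, LinearMap.sum_apply, LinearMap.comp_apply, LinearMap.mulLeft_apply] at this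
    rw [this]
    simp
  refine (card_mul_le_natDegree_of_taylor_coeff Z M _ hR hvan).trans ?_
  refine natDegree_sum_le_of_forall_le _ _ fun ij _ => ?_
  have h1 : (((X - C α) ^ Q) ^ (ij.2 : ℕ)).natDegree ≤ J * Q := by
    rw [natDegree_pow, natDegree_pow, natDegree_X_sub_C, mul_one]
    exact Nat.mul_le_mul_right _ ij.2.2.le
  have h2 : (G ^ (M + ij.1 * m)).natDegree ≤ M * D + n * m * D := by
    rw [natDegree_pow, ← add_mul]
    refine Nat.mul_le_mul ?_ hD
    have := Nat.mul_le_mul_right m ij.1.2.le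
    omega
  have h3 := hκdeg' ij.1 ij.2
  have h4 := natDegree_mul_le (p := G ^ (M + ij.1 * m)) (q := κ ij.1 ij.2 c)
  have h5 := natDegree_mul_le (p := ((X - C α) ^ Q) ^ (ij.2 : ℕ))
    (q := G ^ (M + ij.1 * m) * κ ij.1 ij.2 c)
  simp only [t]
  omega

open Polynomial in
theorem stepanov_card_le {E : Type*} [Field E] {p r : ℕ} [ExpChar E p] (Q n m s D : ℕ)
    (hQ : Q = p ^ r) (hs : Q = s ^ 2) (hnm : n * m + 1 = Q) (hn : 0 < n) (hs4 : 4 ≤ s)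
    (hsn : 2 * n ≤ s) (G : E[X]) (hD : G.natDegree ≤ D)
    (α : E) (hα : G.rootMultiplicity α = 1) (ζ : E) (Z : Finset E)
    (hZ : ∀ x ∈ Z, x ^ Q = x ∧ G.eval x ^ m = ζ) :
    n * Z.card ≤ Q + 2 * n * (4 * D + 3) * s := by
  obtain ⟨μ, hμ⟩ : ∃ μ, s / n = μ := ⟨_, rfl⟩
  have h1 : n * μ ≤ s := by rw [← hμ]; exact Nat.mul_div_le s n
  have h2 : s < n * μ + n := by rw [← hμ]; exact Nat.lt_mul_div_succ s hn
  have hm : 0 < m := by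
    rcases Nat.eq_zero_or_pos m with h | h
    · subst h; nlinarith
    · exact h
  have hμpos : 0 < μ := by
    rcases Nat.eq_zero_or_pos μ with h | h
    · subst h; omega
    · exact h
  have hss : s ≤ Q := by nlinarith
  have hdim : n * μ * (m + n * μ * D + (μ + (2 * D + 2))) < n * (μ + (2 * D + 2)) * m := by
    have e1 : n * μ * (n * μ * D) ≤ s * s * D := by
      calc n * μ * (n * μ * D) = (n * μ) * (n * μ) * D := by ring
        _ ≤ s * s * D := by gcongr
    have e2 : n * μ * μ ≤ s * s := by
      exact Nat.mul_le_mul h1 ((Nat.le_mul_of_pos_left μ hn).trans h1)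
    have e3 : n * μ * (2 * D + 2) ≤ s * (2 * D + 2) := Nat.mul_le_mul_right _ h1
    have e4 : s * s * D + s * s + s * (2 * D + 2) < (2 * D + 2) * (n * m) := by
      have : n * m + 1 = s * s := by rw [hnm, hs, sq]
      zify at this ⊢
      have h4 : (4 : ℤ) ≤ s := by exact_mod_cast hs4
      have : (n * m : ℤ) = s * s - 1 := by linarith
      rw [this]
      nlinarith [mul_nonneg (by positivity : (0 : ℤ) ≤ D) (by nlinarith : (0 : ℤ) ≤ s * s - 2 * s
          - 2)]
    calc n * μ * (m + n * μ * D + (μ + (2 * D + 2)))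
        = n * μ * m + (n * μ * (n * μ * D) + n * μ * μ + n * μ * (2 * D + 2)) := by ring
      _ < n * μ * m + (2 * D + 2) * (n * m) := by omega
      _ = _ := by ring
  have key := stepanov_aux Q n m (n * μ) (μ + (2 * D + 2)) D hQ hnm G hD α hα (h1.trans hss) hm
      hdim ζ Z hZ
  have hmQ : m ≤ Q := by nlinarith
  have e5 : n * μ * D + m + n * m * D + (2 * D + 2) * Q ≤ (4 * D + 3) * Q := by
    have a1 : n * μ * D ≤ Q * D := Nat.mul_le_mul_right _ (h1.trans hss)
    have a2 : n * m * D ≤ Q * D := Nat.mul_le_mul_right _ (by omega)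
    nlinarith
  have e6 : (4 * D + 3) * Q ≤ μ * (2 * n * (4 * D + 3) * s) := by
    have : s ≤ 2 * (n * μ) := by nlinarith
    calc (4 * D + 3) * Q = (4 * D + 3) * s * s := by rw [hs]; ring
      _ ≤ (4 * D + 3) * s * (2 * (n * μ)) := by gcongr
      _ = _ := by ring
  refine Nat.le_of_mul_le_mul_left (c := μ) ?_ hμpos
  calc μ * (n * Z.card) = n * μ * Z.card := by ring
    _ ≤ _ := key
    _ = μ * Q + (n * μ * D + m + n * m * D + (2 * D + 2) * Q) := by ring
    _ ≤ μ * Q + μ * (2 * n * (4 * D + 3) * s) := by omega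
    _ = _ := by ring

theorem exists_ne_zero_quadratic_root {E : Type*} [Field E] [IsAlgClosed E] (a b c : E) (ha : a ≠ 0)
    (hd : b ^ 2 - 4 * a * c ≠ 0) : ∃ ρ : E, ρ ≠ 0 ∧ a * ρ ^ 2 + b * ρ + c = 0 := by
  obtain ⟨ρ, hρ⟩ := IsAlgClosed.exists_root
    (Polynomial.C a * Polynomial.X ^ 2 + Polynomial.C b * Polynomial.X + Polynomial.C c)
    (by rw [Polynomial.degree_quadratic ha]; decide)
  simp only [Polynomial.IsRoot, Polynomial.eval_add, Polynomial.eval_mul, Polynomial.eval_C,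
    Polynomial.eval_pow, Polynomial.eval_X] at hρ
  by_cases h0 : ρ = 0
  · subst h0
    have hc : c = 0 := by simpa using hρ
    subst hc
    have hb : b ≠ 0 := by rintro rfl; simp at hd
    refine ⟨-b / a, div_ne_zero (neg_ne_zero.2 hb) ha, ?_⟩
    field_simp
    ring
  · exact ⟨ρ, h0, hρ⟩

open Polynomial in
theorem exists_rootMultiplicity_eq_one {E : Type*} [Field E] [IsAlgClosed E] (a b c ξ : E)
    (ha : a ≠ 0) (hd : b ^ 2 - 4 * a * c ≠ 0) (hξ : ξ ≠ 0) (n : ℕ) (hn : (n : E) ≠ 0) :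
    ∃ α : E, (C a * (C ξ * X ^ n) ^ 2 + C b * (C ξ * X ^ n) + C c).rootMultiplicity α = 1 := by
  have hn0 : n ≠ 0 := by rintro rfl; simp at hn
  obtain ⟨ρ, hρ0, hρ⟩ := exists_ne_zero_quadratic_root a b c ha hd
  obtain ⟨α, hα⟩ := IsAlgClosed.exists_pow_nat_eq (ρ / ξ) (Nat.pos_of_ne_zero hn0)
  have hα' : ξ * α ^ n = ρ := by rw [hα]; field_simp
  have hα0 : α ≠ 0 := by
    rintro rfl
    rw [zero_pow hn0, mul_zero] at hα'
    exact hρ0 hα'.symm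
  set G := C a * (C ξ * X ^ n) ^ 2 + C b * (C ξ * X ^ n) + C c with hG
  have hder : (derivative G).eval α ≠ 0 := by
    have h1 : (derivative G).eval α = (2 * a * ρ + b) * (ξ * (n * α ^ (n - 1))) := by
      rw [hG]
      simp only [derivative_add, derivative_mul, derivative_C, derivative_pow, derivative_X,
        eval_add, eval_mul, eval_C, eval_pow, eval_X, eval_zero, ← hα', map_natCast, eval_natCast,
        eval_one, Nat.cast_ofNat]
      simp
      ring
    rw [h1]
    refine mul_ne_zero ?_ (mul_ne_zero hξ (mul_ne_zero hn (pow_ne_zero _ hα0)))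
    intro h2
    apply hd
    have h3 : (2 * a * ρ + b) ^ 2 = b ^ 2 - 4 * a * c := by linear_combination 4 * a * hρ
    rw [← h3, h2]; simp
  have hG0 : G ≠ 0 := by
    intro h; rw [h] at hder; simp at hder
  have hroot : G.IsRoot α := by
    simp only [hG, IsRoot, eval_add, eval_mul, eval_C, eval_pow, eval_X, hα']
    exact hρ
  refine ⟨α, ?_⟩
  have h1 := (rootMultiplicity_pos hG0).2 hroot
  have h2 : ¬ 1 < G.rootMultiplicity α := by
    rw [one_lt_rootMultiplicity_iff_isRoot hG0]
    exact fun h => hder h.2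
  omega

open Polynomial in
theorem card_norm_quadratic_eq_le {F K : Type*} [Field F] [Fintype F] [Field K] [Fintype K]
    [DecidableEq F] [Algebra F K] (a b c : F) (ha : a ≠ 0) (hd : b ^ 2 - 4 * a * c ≠ 0) (n s : ℕ)
    (hn : Fintype.card F = n + 1) (hs : Fintype.card K = s ^ 2) (hs4 : 4 ≤ s) (hsn : 2 * n ≤ s)
    (ξ : K) (hξ : ξ ≠ 0) (ζ : F) :
    n * (Finset.univ.filter fun t : K => Algebra.norm F (algebraMap F K a * (ξ * t ^ n) ^ 2 +
      algebraMap F K b * (ξ * t ^ n) + algebraMap F K c) = ζ).card ≤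
      s ^ 2 + 2 * n * (8 * n + 3) * s := by
  classical
  let E := AlgebraicClosure K
  let φ := algebraMap K E
  have hq : 1 < Fintype.card F := Fintype.one_lt_card
  obtain ⟨p, hp⟩ := CharP.exists F
  have hpp := CharP.char_is_prime F p
  have := Fact.mk hpp
  have : CharP K p := charP_of_injective_algebraMap (algebraMap F K).injective p
  have : CharP E p := charP_of_injective_algebraMap (algebraMap K E).injective p
  have : ExpChar E p := ExpChar.prime hpp
  obtain ⟨r, -, hr⟩ := FiniteField.card K p
  have hcard : Fintype.card F ^ Module.finrank F K = Fintype.card K :=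
      (Module.card_eq_pow_finrank).symm
  have hm : n * ((Nat.card K - 1) / (Nat.card F - 1)) + 1 = Fintype.card K := by
    rw [Nat.card_eq_fintype_card, Nat.card_eq_fintype_card, hn, Nat.add_sub_cancel,
      Nat.mul_div_cancel']
    · have : 0 < Fintype.card K := Fintype.card_pos
      omega
    · rw [← hcard, hn]
      simpa using Nat.sub_dvd_pow_sub_pow (n + 1) 1 (Module.finrank F K)
  set m := (Nat.card K - 1) / (Nat.card F - 1) with hmdef
  have hnF : (n : F) ≠ 0 := by
    have h1 : ((n + 1 : ℕ) : F) = 0 := by rw [← hn]; exact FiniteField.cast_card_eq_zero F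
    intro h2
    push_cast at h1
    rw [h2] at h1
    simp at h1
  have hnE : (n : E) ≠ 0 := by
    have h := (map_ne_zero (φ.comp (algebraMap F K))).2 hnF
    rwa [map_natCast] at h
  let ψ : F →+* E := φ.comp (algebraMap F K)
  obtain ⟨α, hα⟩ := exists_rootMultiplicity_eq_one (ψ a) (ψ b) (ψ c) (φ ξ)
    ((map_ne_zero ψ).2 ha) (by
      have := (map_ne_zero ψ).2 hd
      simpa only [map_sub, map_mul, map_pow, map_ofNat] using this) ((map_ne_zero φ).2 hξ) n hnE
  have hdeg : (C (ψ a) * (C (φ ξ) * X ^ n) ^ 2 + C (ψ b) * (C (φ ξ) * X ^ n) + C (ψ c)).natDegree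
      ≤ 2 * n := by compute_degree; omega
  have key := stepanov_card_le (p := p) (r := r) (Fintype.card K) n m s (2 * n) hr hs hm (by
      omega) hs4 hsn
    _ hdeg α hα (ψ ζ) ((Finset.univ.filter fun t : K => Algebra.norm F (algebraMap F K a *
      (ξ * t ^ n) ^ 2 + algebraMap F K b * (ξ * t ^ n) + algebraMap F K c) = ζ).map
        ⟨φ, φ.injective⟩) ?_
  · rw [Finset.card_map] at key
    calc _ ≤ _ := key
      _ = _ := by rw [hs]; ring
  · intro x hx
    rw [Finset.mem_map] at hx
    obtain ⟨t, ht, rfl⟩ := hx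
    simp only [Finset.mem_filter, Finset.mem_univ, true_and] at ht
    refine ⟨?_, ?_⟩
    · change φ t ^ _ = φ t
      rw [← map_pow, FiniteField.pow_card]
    · have h1 := FiniteField.algebraMap_norm_eq_pow (K := F) (x := algebraMap F K a *
        (ξ * t ^ n) ^ 2 + algebraMap F K b * (ξ * t ^ n) + algebraMap F K c)
      rw [ht, ← hmdef] at h1
      change _ = φ (algebraMap F K ζ)
      rw [h1]
      simp [ψ]

theorem Fintype.sum_eq_apply_zero_add_sum_units {K A : Type*} [GroupWithZero K] [Fintype K]
    [DecidableEq K]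
    [AddCommMonoid A] (f : K → A) : ∑ x, f x = f 0 + ∑ u : Kˣ, f u := by
  rw [← Finset.add_sum_erase _ _ (Finset.mem_univ (0 : K))]
  congr 1
  symm
  refine Finset.sum_bij (fun u _ => (u : K)) ?_ ?_ ?_ ?_
  · intro u _; simp
  · intro u _ v _ h; exact Units.ext h
  · intro x hx
    exact ⟨Units.mk0 x (by simpa using hx), Finset.mem_univ _, rfl⟩
  · intros; rfl

theorem monoidHom_norm_le_one {F : Type*} [Field F] [Fintype F] (ψ : F →* ℂ) (x : F) : ‖ψ x‖ ≤ 1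
    := by
  by_contra! h
  have h1 : ψ x ^ Fintype.card F = ψ x := by rw [← map_pow, FiniteField.pow_card]
  have h2 := congrArg norm h1
  rw [norm_pow] at h2
  have h3 := lt_self_pow₀ h (Fintype.one_lt_card (α := F))
  linarith

open Polynomial in
theorem card_quadratic_eq_zero_le {F K : Type*} [Field F] [Field K] [Fintype K] [DecidableEq F]
    [Algebra F K] (a b c : F) (ha : a ≠ 0) (n : ℕ) (hn : 0 < n) (ξ : K) (hξ : ξ ≠ 0) :
    (Finset.univ.filter fun t : K => Algebra.norm F (algebraMap F K a * (ξ * t ^ n) ^ 2 +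
      algebraMap F K b * (ξ * t ^ n) + algebraMap F K c) = 0).card ≤ 2 * n := by
  classical
  have : FiniteDimensional F K := inferInstance
  set a' := algebraMap F K a with ha'
  set b' := algebraMap F K b
  set c' := algebraMap F K c
  have ha0 : a' ≠ 0 := by simpa [ha'] using ha
  set G : K[X] := C a' * (C ξ * X ^ n) ^ 2 + C b' * (C ξ * X ^ n) + C c' with hG
  have hcoeff : G.coeff (n * 2) = a' * ξ ^ 2 := by
    have h1 : G = C (a' * ξ ^ 2) * X ^ (n * 2) + C (b' * ξ) * X ^ n + C c' := by
      rw [hG]; simp only [C_mul, C_pow]; ring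
    rw [h1]
    simp only [coeff_add, coeff_C_mul, coeff_X_pow, coeff_C]
    rw [if_pos trivial, if_neg (by omega), if_neg (by omega)]
    ring
  have hG0 : G ≠ 0 := by
    intro h
    rw [h, coeff_zero] at hcoeff
    exact mul_ne_zero ha0 (pow_ne_zero 2 hξ) hcoeff.symm
  have hdeg : G.natDegree ≤ 2 * n := by rw [hG]; compute_degree; omega
  refine (Finset.card_le_card (t := G.roots.toFinset) ?_).trans
    ((Multiset.toFinset_card_le _).trans ((card_roots' G).trans hdeg))
  intro t ht
  simp only [Finset.mem_filter, Finset.mem_univ, true_and] at ht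
  rw [Multiset.mem_toFinset, mem_roots hG0, IsRoot, hG]
  simpa using Algebra.norm_eq_zero_iff.1 ht

theorem norm_sum_char_quadratic_pow_le {F K : Type*} [Field F] [Fintype F] [Field K] [Fintype K]
    [Algebra F K] (a b c : F) (ha : a ≠ 0) (hd : b ^ 2 - 4 * a * c ≠ 0) (n s : ℕ)
    (hn : Fintype.card F = n + 1) (hs : Fintype.card K = s ^ 2) (hs4 : 4 ≤ s) (hsn : 2 * n ≤ s)
    (ξ : K) (hξ : ξ ≠ 0) (ψ : F →* ℂ) (h0 : ψ 0 = 0) (hsum : ∑ ζ, ψ ζ = 0) :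
    ‖∑ t : K, ψ (Algebra.norm F (algebraMap F K a * (ξ * t ^ n) ^ 2 +
      algebraMap F K b * (ξ * t ^ n) + algebraMap F K c))‖ ≤ (2 * n * (8 * n + 3) + 1) * s := by
  classical
  have hq : 1 < Fintype.card F := Fintype.one_lt_card
  have hn0 : 0 < n := by omega
  set N : F → ℕ := fun ζ => (Finset.univ.filter fun t : K => Algebra.norm F (algebraMap F K a *
    (ξ * t ^ n) ^ 2 + algebraMap F K b * (ξ * t ^ n) + algebraMap F K c) = ζ).card with hN
  have h1 : ∀ ζ, (n : ℝ) * N ζ ≤ s ^ 2 + 2 * n * (8 * n + 3) * s := fun ζ => by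
    exact_mod_cast card_norm_quadratic_eq_le a b c ha hd n s hn hs hs4 hsn ξ hξ ζ
  have h2 : (N 0 : ℝ) ≤ 2 * n := by
    exact_mod_cast card_quadratic_eq_zero_le a b c ha n hn0 ξ hξ
  have h3 : ∑ t : K, ψ (Algebra.norm F (algebraMap F K a * (ξ * t ^ n) ^ 2 +
      algebraMap F K b * (ξ * t ^ n) + algebraMap F K c)) = ∑ ζ, ψ ζ * N ζ := by
    rw [← Finset.sum_fiberwise (g := fun t : K => Algebra.norm F (algebraMap F K a * (ξ * t ^ n)
        ^ 2 +
      algebraMap F K b * (ξ * t ^ n) + algebraMap F K c))]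
    refine Finset.sum_congr rfl fun ζ _ => ?_
    rw [Finset.sum_congr rfl (g := fun _ => ψ ζ) (fun t ht => by rw [(Finset.mem_filter.1 ht).2]),
      Finset.sum_const, nsmul_eq_mul, mul_comm]
  have h4 : ∑ ζ, (N ζ : ℝ) = s ^ 2 := by
    have : ∑ ζ, N ζ = Fintype.card K :=
      (Finset.card_eq_sum_card_fiberwise (s := Finset.univ) (t := Finset.univ) (fun _ _ =>
          Finset.mem_univ _)).symm
    rw [hs] at this
    exact_mod_cast this
  set B : ℝ := s ^ 2 + 2 * n * (8 * n + 3) * s with hB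
  have h5 : (n : ℂ) * ∑ ζ, ψ ζ * N ζ = - ∑ ζ, ψ ζ * ((B - n * N ζ : ℝ) : ℂ) := by
    push_cast
    simp only [mul_sub, Finset.sum_sub_distrib]
    rw [← Finset.sum_mul, hsum, Finset.mul_sum]
    simp only [zero_mul, zero_sub, neg_neg]
    exact Finset.sum_congr rfl fun _ _ => by ring
  have h6 : (n : ℝ) * ‖∑ ζ, ψ ζ * N ζ‖ ≤ n * ((2 * n * (8 * n + 3) + 1) * s) := by
    calc (n : ℝ) * ‖∑ ζ, ψ ζ * N ζ‖ = ‖(n : ℂ) * ∑ ζ, ψ ζ * N ζ‖ := by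
          rw [norm_mul, Complex.norm_natCast]
      _ = ‖∑ ζ, ψ ζ * ((B - n * N ζ : ℝ) : ℂ)‖ := by rw [h5, norm_neg]
      _ ≤ ∑ ζ ∈ Finset.univ.erase 0, (B - n * N ζ) := by
          rw [← Finset.add_sum_erase _ _ (Finset.mem_univ 0), h0, zero_mul, zero_add]
          refine norm_sum_le_of_le _ fun ζ _ => ?_
          rw [norm_mul, Complex.norm_real, Real.norm_eq_abs, abs_of_nonneg (by linarith [h1 ζ])]
          exact mul_le_of_le_one_left (by linarith [h1 ζ]) (monoidHom_norm_le_one ψ ζ)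
      _ = n * B - n * (s ^ 2 - N 0) := by
          rw [Finset.sum_sub_distrib, Finset.sum_const, Finset.card_erase_of_mem (Finset.mem_univ
              _),
            Finset.card_univ, hn, Nat.add_sub_cancel, nsmul_eq_mul, ← Finset.mul_sum,
            ← h4, ← Finset.add_sum_erase _ _ (Finset.mem_univ 0)]
          ring
      _ ≤ _ := by
          have h7 : (2 * n : ℝ) ≤ s := by exact_mod_cast hsn
          have h8 : (0 : ℝ) < n := by exact_mod_cast hn0
          have : (n : ℝ) * B - n * (s ^ 2 - N 0) = n * (2 * n * (8 * n + 3) * s + N 0) := by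
            rw [hB]; ring
          rw [this]
          gcongr
          linarith
  rw [h3]
  exact le_of_mul_le_mul_left h6 (by exact_mod_cast hn0)

theorem norm_sum_char_norm_le {F K : Type*} [Field F] [Fintype F] [Field K] [Fintype K]
    [Algebra F K] (a b c : F) (ha : a ≠ 0) (hd : b ^ 2 - 4 * a * c ≠ 0) (n s : ℕ)
    (hn : Fintype.card F = n + 1) (hs : Fintype.card K = s ^ 2) (hs4 : 4 ≤ s) (hsn : 2 * n ≤ s)
    (ψ₁ ψ₂ : F →* ℂ) (h0 : ψ₂ 0 = 0) (hsum : ∑ ζ, ψ₂ ζ = 0) :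
    ‖∑ x : K, ψ₁ (Algebra.norm F x) * ψ₂ (Algebra.norm F (algebraMap F K a * x ^ 2 +
      algebraMap F K b * x + algebraMap F K c))‖ ≤ (2 * n * (8 * n + 3) + 2) * s := by
  classical
  have hq : 1 < Fintype.card F := Fintype.one_lt_card
  have hn0 : n ≠ 0 := by omega
  set f : K → K := fun x => algebraMap F K a * x ^ 2 + algebraMap F K b * x + algebraMap F K c
      with hf
  set h : K → ℂ := fun x => ψ₁ (Algebra.norm F x) * ψ₂ (Algebra.norm F (f x)) with hh
  change ‖∑ x, h x‖ ≤ _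
  have hle : ∀ x, ‖h x‖ ≤ 1 := fun x => by
    rw [hh]; simp only [norm_mul]
    exact mul_le_one₀ (monoidHom_norm_le_one _ _) (norm_nonneg _) (monoidHom_norm_le_one _ _)
  have hs4' : (4 : ℝ) ≤ s := by exact_mod_cast hs4
  have hξ : ∀ ξ : Kˣ, ‖∑ t : Kˣ, h (ξ * t ^ n)‖ ≤ (2 * n * (8 * n + 3) + 1) * s + 1 := by
    intro ξ
    have e1 : ∑ t : Kˣ, h (ξ * t ^ n) = ψ₁ (Algebra.norm F (ξ : K)) *
        (∑ t : K, ψ₂ (Algebra.norm F (f (ξ * t ^ n))) - ψ₂ (Algebra.norm F (f 0))) := by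
      rw [Fintype.sum_eq_apply_zero_add_sum_units (K := K)]
      simp only [zero_pow hn0, mul_zero, add_sub_cancel_left]
      rw [Finset.mul_sum]
      refine Finset.sum_congr rfl fun t _ => ?_
      simp only [hh]
      congr 2
      rw [map_mul, map_pow]
      have h1 : Algebra.norm F (t : K) ≠ 0 := by
        rw [Ne, Algebra.norm_eq_zero_iff]; exact t.ne_zero
      have h2 := FiniteField.pow_card_sub_one_eq_one _ h1
      rw [hn, Nat.add_sub_cancel] at h2
      rw [h2, mul_one]
    rw [e1, norm_mul]
    refine (mul_le_of_le_one_left (norm_nonneg _) (monoidHom_norm_le_one _ _)).trans ?_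
    refine (norm_sub_le _ _).trans (add_le_add ?_ (monoidHom_norm_le_one _ _))
    exact norm_sum_char_quadratic_pow_le a b c ha hd n s hn hs hs4 hsn ξ ξ.ne_zero ψ₂ h0 hsum
  have hcard : 0 < Fintype.card Kˣ := Fintype.card_pos
  have e2 : (Fintype.card Kˣ : ℂ) * ∑ x : Kˣ, h x = ∑ ξ : Kˣ, ∑ t : Kˣ, h (ξ * t ^ n) := by
    rw [Finset.sum_comm]
    have : ∀ t : Kˣ, ∑ ξ : Kˣ, h (ξ * t ^ n) = ∑ x : Kˣ, h x := fun t =>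
      Fintype.sum_equiv (Equiv.mulRight (t ^ n)) _ _ (fun ξ => by simp)
    simp only [this, Finset.sum_const, Finset.card_univ, nsmul_eq_mul]
  have h3 : (Fintype.card Kˣ : ℝ) * ‖∑ x : Kˣ, h x‖ ≤
      Fintype.card Kˣ * ((2 * n * (8 * n + 3) + 1) * s + 1) := by
    rw [← Complex.norm_natCast, ← norm_mul, e2]
    refine (norm_sum_le_of_le _ fun ξ _ => hξ ξ).trans ?_
    rw [Finset.sum_const, Finset.card_univ, nsmul_eq_mul, Complex.norm_natCast]
  have h4 := le_of_mul_le_mul_left h3 (by exact_mod_cast hcard)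
  rw [Fintype.sum_eq_apply_zero_add_sum_units]
  refine (norm_add_le _ _).trans ?_
  have := hle 0
  linarith

open Polynomial

theorem finite_setOf_monic_natDegree_eq (F : Type*) [Field F] [Finite F] (n : ℕ) :
    {h : F[X] | h.Monic ∧ h.natDegree = n}.Finite := by
  refine (Set.finite_range fun v : Fin n → F => X ^ n + ∑ i : Fin n, C (v i) * X ^ (i :
      ℕ)).subset ?_
  rintro h ⟨hm, rfl⟩
  refine ⟨fun i => h.coeff i, ?_⟩
  conv_rhs => rw [hm.as_sum]
  exact congrArg _ (Fin.sum_univ_eq_sum_range (fun i => C (h.coeff i) * X ^ i) _)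

/-- The monic polynomials of degree `n` over a finite field. -/
noncomputable def monicsOf (F : Type*) [Field F] [Finite F] (n : ℕ) : Finset F[X] :=
  (finite_setOf_monic_natDegree_eq F n).toFinset

section
variable {F : Type*} [Field F] [Finite F]

@[simp] theorem mem_monicsOf {n : ℕ} {h : F[X]} :
    h ∈ monicsOf F n ↔ h.Monic ∧ h.natDegree = n := by
  simp [monicsOf]

theorem monicsOf_zero : monicsOf F 0 = {1} := by
  ext h
  simp only [mem_monicsOf, Finset.mem_singleton]
  constructor
  · rintro ⟨h1, h2⟩; exact eq_one_of_monic_natDegree_zero h1 h2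
  · rintro rfl; simp

open Classical in
/-- The monic irreducible polynomials of degree `d` over a finite field. -/
noncomputable def irreduciblesOf (F : Type*) [Field F] [Finite F] (d : ℕ) : Finset F[X] :=
  (monicsOf F d).filter Irreducible

theorem mem_irreduciblesOf {d : ℕ} {h : F[X]} :
    h ∈ irreduciblesOf F d ↔ h.Monic ∧ h.natDegree = d ∧ Irreducible h := by
  simp [irreduciblesOf, and_assoc]

open Classical UniqueFactorizationMonoid in
theorem natDegree_eq_sum_irreducible_pow_dvd {h : F[X]} (hm : h.Monic) {n : ℕ}
    (hn : h.natDegree = n) :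
    n = ∑ k ∈ Finset.Icc 1 n, ∑ d ∈ k.divisors, ∑ P ∈ irreduciblesOf F d,
      if P ^ (k / d) ∣ h then d else 0 := by
  have h0 : h ≠ 0 := hm.ne_zero
  have hmono : ∀ P ∈ normalizedFactors h, P.Monic := fun P hP =>
    ((Polynomial.mem_normalizedFactors_iff h0).mp hP).2.1
  have e1 : n = ∑ P ∈ (normalizedFactors h).toFinset,
      (normalizedFactors h).count P * P.natDegree := by
    rw [← hn]
    conv_lhs => rw [← hm.normalize_eq_self, ← prod_normalizedFactors_eq h0,
      natDegree_multiset_prod_of_monic _ hmono]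
    rw [Finset.sum_multiset_map_count]
    simp
  have hle : ∀ P j, P ∈ (normalizedFactors h) → P ^ j ∣ h → j * P.natDegree ≤ n := by
    intro P j hP hj
    rw [← hn, ← natDegree_pow]
    exact natDegree_le_of_dvd hj h0
  have hcount : ∀ P j, P ∈ (normalizedFactors h) →
      (P ^ j ∣ h ↔ j ≤ (normalizedFactors h).count P) := by
    intro P j hP
    have hP' := (Polynomial.mem_normalizedFactors_iff h0).mp hP
    rw [pow_dvd_iff_le_emultiplicity, emultiplicity_eq_count_normalizedFactors hP'.1 h0,
      hP'.2.1.normalize_eq_self, Nat.cast_le]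
  have e2 : ∀ k ∈ Finset.Icc 1 n, ∀ d ∈ k.divisors,
      (∑ P ∈ irreduciblesOf F d, if P ^ (k / d) ∣ h then d else 0) =
      ∑ P ∈ (normalizedFactors h).toFinset,
        if P.natDegree = d ∧ k / d ≤ (normalizedFactors h).count P then d else 0 := by
    intro k hk d hd
    rw [← Finset.sum_filter, ← Finset.sum_filter]
    refine Finset.sum_congr ?_ fun _ _ => rfl
    have hkd : k / d ≠ 0 := by
      rw [Finset.mem_Icc] at hk
      exact (Nat.div_pos (Nat.divisor_le hd) (Nat.pos_of_mem_divisors hd)).ne'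
    ext P
    simp only [Finset.mem_filter, mem_irreduciblesOf, Multiset.mem_toFinset]
    constructor
    · rintro ⟨⟨h1, h2, h3⟩, h4⟩
      have h5 : P ∈ normalizedFactors h :=
        (Polynomial.mem_normalizedFactors_iff h0).mpr ⟨h3, h1, (dvd_pow_self P hkd).trans h4⟩
      exact ⟨h5, h2, (hcount P _ h5).mp h4⟩
    · rintro ⟨h1, h2, h3⟩
      have h5 := (Polynomial.mem_normalizedFactors_iff h0).mp h1
      exact ⟨⟨h5.2.1, h2, h5.1⟩, (hcount P _ h1).mpr h3⟩
  rw [Finset.sum_congr rfl fun k hk => Finset.sum_congr rfl (e2 k hk)]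
  conv_lhs => rw [e1]
  rw [Finset.sum_congr rfl fun k _ => Finset.sum_comm, Finset.sum_comm]
  refine Finset.sum_congr rfl fun P hP => ?_
  rw [Multiset.mem_toFinset] at hP
  have hirr := ((Polynomial.mem_normalizedFactors_iff h0).mp hP).1
  have hd0 : 0 < P.natDegree := hirr.natDegree_pos
  have e3 : ∀ k ∈ Finset.Icc 1 n, (∑ d ∈ k.divisors,
      if P.natDegree = d ∧ k / d ≤ (normalizedFactors h).count P then d else 0) =
      if P.natDegree ∣ k ∧ k / P.natDegree ≤ (normalizedFactors h).count P
        then P.natDegree else 0 := by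
    intro k hk
    rw [Finset.mem_Icc] at hk
    by_cases hdk : P.natDegree ∣ k
    · rw [Finset.sum_eq_single P.natDegree]
      · simp [hdk]
      · intro d _ hd; rw [if_neg]; exact fun h => hd h.1.symm
      · intro h; exact absurd (Nat.mem_divisors.mpr ⟨hdk, by omega⟩) h
    · rw [if_neg (fun h => hdk h.1)]
      refine Finset.sum_eq_zero fun d hd => if_neg fun h => hdk ?_
      rw [h.1]; exact Nat.dvd_of_mem_divisors hd
  rw [Finset.sum_congr rfl e3, ← Finset.sum_filter, Finset.sum_const, smul_eq_mul]
  congr 1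
  have : (Finset.Icc 1 n).filter (fun k => P.natDegree ∣ k ∧
      k / P.natDegree ≤ (normalizedFactors h).count P) =
      (Finset.Icc 1 ((normalizedFactors h).count P)).image (· * P.natDegree) := by
    ext k
    simp only [Finset.mem_filter, Finset.mem_Icc, Finset.mem_image]
    constructor
    · rintro ⟨⟨h1, h2⟩, ⟨j, rfl⟩, h4⟩
      rw [Nat.mul_div_cancel_left _ hd0] at h4
      refine ⟨j, ⟨?_, h4⟩, mul_comm _ _⟩
      rcases Nat.eq_zero_or_pos j with rfl | h
      · simp at h1
      · exact h
    · rintro ⟨j, ⟨h1, h2⟩, rfl⟩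
      refine ⟨⟨Nat.mul_pos h1 hd0, ?_⟩, dvd_mul_left _ _, ?_⟩
      · exact hle P j hP ((hcount P j hP).mpr h2)
      · rwa [Nat.mul_div_cancel _ hd0]
  rw [this, Finset.card_image_of_injective _ (mul_left_injective₀ hd0.ne')]
  simp

theorem sum_monicsOf_pow_dvd (lam : F[X] →* ℂ) {n d j : ℕ} {P : F[X]} (hP : P.Monic)
    (hd : P.natDegree = d) (hj : j * d ≤ n) [DecidablePred fun h : F[X] => P ^ j ∣ h] :
    ∑ h ∈ (monicsOf F n).filter (fun h => P ^ j ∣ h), lam h =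
      lam P ^ j * ∑ h ∈ monicsOf F (n - j * d), lam h := by
  rw [Finset.mul_sum]
  symm
  refine Finset.sum_bij (fun g _ => P ^ j * g) ?_ ?_ ?_ ?_
  · intro g hg
    rw [mem_monicsOf] at hg
    rw [Finset.mem_filter, mem_monicsOf]
    refine ⟨⟨(hP.pow j).mul hg.1, ?_⟩, dvd_mul_right _ _⟩
    rw [(hP.pow j).natDegree_mul hg.1, hP.natDegree_pow, hd, hg.2]
    omega
  · intro g _ g' _ h
    exact mul_left_cancel₀ (hP.pow j).ne_zero h
  · intro h hh
    rw [Finset.mem_filter, mem_monicsOf] at hh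
    obtain ⟨⟨h1, h2⟩, g, rfl⟩ := hh
    have hg : g.Monic := (hP.pow j).of_mul_monic_left h1
    refine ⟨g, ?_, rfl⟩
    rw [mem_monicsOf]
    refine ⟨hg, ?_⟩
    rw [(hP.pow j).natDegree_mul hg, hP.natDegree_pow, hd] at h2
    omega
  · intro g _
    rw [map_mul, map_pow]

/-- Newton's identities for the `L`-function of a completely multiplicative function. -/
theorem natCast_mul_sum_monicsOf (lam : F[X] →* ℂ) (n : ℕ) :
    (n : ℂ) * ∑ h ∈ monicsOf F n, lam h = ∑ k ∈ Finset.Icc 1 n,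
      (∑ d ∈ k.divisors, ∑ P ∈ irreduciblesOf F d, (d : ℂ) * lam P ^ (k / d)) *
        ∑ h ∈ monicsOf F (n - k), lam h := by
  classical
  have e1 : (n : ℂ) * ∑ h ∈ monicsOf F n, lam h = ∑ h ∈ monicsOf F n,
      ∑ k ∈ Finset.Icc 1 n, ∑ d ∈ k.divisors, ∑ P ∈ irreduciblesOf F d,
      if P ^ (k / d) ∣ h then (d : ℂ) * lam h else 0 := by
    rw [Finset.mul_sum]
    refine Finset.sum_congr rfl fun h hh => ?_
    rw [mem_monicsOf] at hh
    conv_lhs => rw [natDegree_eq_sum_irreducible_pow_dvd hh.1 hh.2]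
    push_cast
    simp only [Finset.sum_mul, ite_mul, zero_mul]
  rw [e1, Finset.sum_comm]
  refine Finset.sum_congr rfl fun k hk => ?_
  rw [Finset.sum_comm, Finset.sum_mul]
  refine Finset.sum_congr rfl fun d hd => ?_
  rw [Finset.sum_comm, Finset.sum_mul]
  refine Finset.sum_congr rfl fun P hP => ?_
  rw [mem_irreduciblesOf] at hP
  have hkd : k / d * d = k := Nat.div_mul_cancel (Nat.dvd_of_mem_divisors hd)
  rw [← Finset.sum_filter, ← Finset.mul_sum,
    sum_monicsOf_pow_dvd lam hP.1 hP.2.1 (by rw [hkd]; exact (Finset.mem_Icc.mp hk).2), hkd,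
    mul_assoc]
end

open Polynomial

section
variable {F : Type*} [Field F] [Fintype F] {K : Type*} [Field K] [Fintype K] [Algebra F K]

omit [Fintype K] in
theorem aeval_pow_card_pow (g : F[X]) (x : K) (i : ℕ) :
    aeval (x ^ Fintype.card F ^ i) g = aeval x g ^ Fintype.card F ^ i := by
  induction i with
  | zero => simp
  | succ i ih =>
    rw [pow_succ, pow_mul, pow_mul, ← ih, ← expand_aeval, FiniteField.expand_card, map_pow]

theorem injOn_pow_card_pow (x : K) :
    Set.InjOn (fun i => x ^ Fintype.card F ^ i) (Set.Iio (minpoly F x).natDegree) := by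
  have hxint : IsIntegral F x := Algebra.IsIntegral.isIntegral x
  have hirr := minpoly.irreducible hxint
  have key : ∀ i j, i < j → j < (minpoly F x).natDegree →
      x ^ Fintype.card F ^ i ≠ x ^ Fintype.card F ^ j := by
    intro i j hij hj h
    have hinj := (FiniteField.frobeniusAlgHom F K ^ i : K →ₐ[F] K).toRingHom.injective
    have hpow : ∀ y : K, (FiniteField.frobeniusAlgHom F K ^ i) y = y ^ Fintype.card F ^ i := by
      intro y
      rw [AlgHom.coe_pow, FiniteField.coe_frobeniusAlgHom, pow_iterate]
    have h1 : x = x ^ Fintype.card F ^ (j - i) := by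
      apply hinj
      change (FiniteField.frobeniusAlgHom F K ^ i) _ = (FiniteField.frobeniusAlgHom F K ^ i) _
      rw [hpow, hpow, h, ← pow_mul, ← pow_add, Nat.sub_add_cancel hij.le]
    have h2 : minpoly F x ∣ X ^ Nat.card F ^ (j - i) - X := by
      apply minpoly.dvd
      rw [map_sub, map_pow, aeval_X, Nat.card_eq_fintype_card, ← h1, sub_self]
    rw [← hirr.natDegree_dvd_iff_dvd_X_pow_card_pow_sub_X] at h2
    have := Nat.le_of_dvd (by omega) h2
    omega
  intro i hi j hj h
  rcases lt_trichotomy i j with hl | hl | hl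
  · exact absurd h (key i j hl hj)
  · exact hl
  · exact absurd h.symm (key j i hl hi)

theorem minpoly_map_eq_prod_range (x : K) :
    (minpoly F x).map (algebraMap F K) =
      ∏ i ∈ Finset.range (minpoly F x).natDegree, (X - C (x ^ Fintype.card F ^ i)) := by
  classical
  have hxint : IsIntegral F x := Algebra.IsIntegral.isIntegral x
  have hmon := (minpoly.monic hxint).map (algebraMap F K)
  refine eq_of_monic_of_dvd_of_natDegree_le (monic_prod_of_monic _ _ fun i _ => monic_X_sub_C _)
      hmon ?_ ?_
  · have e : ∏ i ∈ Finset.range (minpoly F x).natDegree, (X - C (x ^ Fintype.card F ^ i)) =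
        ((((Finset.range (minpoly F x).natDegree).val.map
          fun i => x ^ Fintype.card F ^ i)).map (fun a => X - C a)).prod := by
      rw [Multiset.map_map]; rfl
    rw [e, Multiset.prod_X_sub_C_dvd_iff_le_roots hmon.ne_zero, Multiset.le_iff_subset]
    · intro y hy
      rw [Multiset.mem_map] at hy
      obtain ⟨i, -, rfl⟩ := hy
      rw [mem_roots hmon.ne_zero, IsRoot, eval_map_algebraMap, aeval_pow_card_pow,
        minpoly.aeval, zero_pow (by positivity)]
    · refine Multiset.Nodup.map_on (fun i hi j hj h => injOn_pow_card_pow (F := F) x ?_ ?_ h)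
        (Finset.range _).nodup
      · simpa using hi
      · simpa using hj
  · rw [natDegree_prod_of_monic _ _ fun i _ => monic_X_sub_C _]
    simp only [natDegree_X_sub_C]
    simp

theorem prod_range_finrank_eq_pow {M : Type*} [CommMonoid M] (x : K) (g : K → M) :
    ∏ i ∈ Finset.range (Module.finrank F K), g (x ^ Fintype.card F ^ i) =
      (∏ i ∈ Finset.range (minpoly F x).natDegree, g (x ^ Fintype.card F ^ i)) ^
        (Module.finrank F K / (minpoly F x).natDegree) := by
  have hxint : IsIntegral F x := Algebra.IsIntegral.isIntegral x
  have hirr := minpoly.irreducible hxint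
  have hper : x ^ Fintype.card F ^ (minpoly F x).natDegree = x := by
    have h := hirr.natDegree_dvd_iff_dvd_X_pow_card_pow_sub_X.mp (dvd_refl _)
    have h1 := Polynomial.aeval_eq_zero_of_dvd_aeval_eq_zero h (minpoly.aeval F x)
    rw [map_sub, map_pow, aeval_X, Nat.card_eq_fintype_card, sub_eq_zero] at h1
    exact h1
  have hdvd : (minpoly F x).natDegree ∣ Module.finrank F K := minpoly.degree_dvd hxint
  have key : ∀ m, ∏ i ∈ Finset.range ((minpoly F x).natDegree * m), g (x ^ Fintype.card F ^ i) =
      (∏ i ∈ Finset.range (minpoly F x).natDegree, g (x ^ Fintype.card F ^ i)) ^ m := by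
    intro m
    induction m with
    | zero => simp
    | succ m ih =>
      rw [mul_add, mul_one, add_comm, Finset.prod_range_add, pow_succ', ← ih]
      congr 1
      refine Finset.prod_congr rfl fun i _ => ?_
      rw [pow_add, pow_mul, hper]
  rw [← key, Nat.mul_div_cancel' hdvd]

theorem sum_minpoly_eq {A : Type*} [CommSemiring A] (G : F[X] → A) :
    ∑ x : K, G (minpoly F x) = ∑ d ∈ (Module.finrank F K).divisors,
      ∑ P ∈ irreduciblesOf F d, (d : A) * G P := by
  classical
  have hk : Module.finrank F K ≠ 0 := Module.finrank_pos.ne'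
  have hdeg : ∀ x : K, (minpoly F x).natDegree ∈ (Module.finrank F K).divisors := fun x =>
    Nat.mem_divisors.mpr ⟨minpoly.degree_dvd (Algebra.IsIntegral.isIntegral x), hk⟩
  rw [← Finset.sum_fiberwise_of_maps_to (s := Finset.univ) (fun x _ => hdeg x)]
  refine Finset.sum_congr rfl fun d hd => ?_
  have hmem : ∀ x ∈ Finset.univ.filter (fun x : K => (minpoly F x).natDegree = d),
      minpoly F x ∈ irreduciblesOf F d := by
    intro x hx
    have hxint : IsIntegral F x := Algebra.IsIntegral.isIntegral x
    rw [mem_irreduciblesOf]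
    exact ⟨minpoly.monic hxint, (Finset.mem_filter.mp hx).2, minpoly.irreducible hxint⟩
  rw [← Finset.sum_fiberwise_of_maps_to hmem]
  refine Finset.sum_congr rfl fun P hP => ?_
  rw [mem_irreduciblesOf] at hP
  have hdvd : P ∣ X ^ Nat.card F ^ Module.finrank F K - X := by
    rw [← hP.2.2.natDegree_dvd_iff_dvd_X_pow_card_pow_sub_X, hP.2.1]
    exact Nat.dvd_of_mem_divisors hd
  obtain ⟨x, hx⟩ : ∃ x : K, minpoly F x = P := by
    have h1 : (P.map (algebraMap F K)).Splits := by
      have h2 := (FiniteField.isSplittingField_sub K F).splits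
      refine h2.of_dvd ?_ ?_
      · exact map_ne_zero (FiniteField.X_pow_card_sub_X_ne_zero F Fintype.one_lt_card)
      · rw [Module.card_eq_pow_finrank (K := F) (V := K), ← Nat.card_eq_fintype_card]
        exact Polynomial.map_dvd _ hdvd
    obtain ⟨x, hx⟩ := h1.exists_eval_eq_zero (by
      rw [degree_map]; exact (degree_pos_of_irreducible hP.2.2).ne')
    rw [eval_map_algebraMap] at hx
    exact ⟨x, (minpoly.eq_of_irreducible_of_monic hP.2.2 hx hP.1).symm⟩
  have hset : (Finset.univ.filter fun x : K => (minpoly F x).natDegree = d).filter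
      (fun x => minpoly F x = P) =
      (Finset.range d).image fun i => x ^ Fintype.card F ^ i := by
    ext y
    simp only [Finset.mem_filter, Finset.mem_univ, true_and, Finset.mem_image, Finset.mem_range]
    have e := minpoly_map_eq_prod_range (F := F) x
    rw [hx, hP.2.1] at e
    constructor
    · rintro ⟨-, hy⟩
      have h1 : aeval y P = 0 := by rw [← hy]; exact minpoly.aeval F y
      rw [← eval_map_algebraMap, e, eval_prod, Finset.prod_eq_zero_iff] at h1
      obtain ⟨i, hi, h⟩ := h1
      refine ⟨i, Finset.mem_range.mp hi, ?_⟩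
      simp only [eval_sub, eval_X, eval_C] at h
      exact (sub_eq_zero.mp h).symm
    · rintro ⟨i, hi, rfl⟩
      have h1 : minpoly F (x ^ Fintype.card F ^ i) = P := by
        refine (minpoly.eq_of_irreducible_of_monic hP.2.2 ?_ hP.1).symm
        rw [aeval_pow_card_pow, ← hx, minpoly.aeval, zero_pow (by positivity)]
      exact ⟨by rw [h1, hP.2.1], h1⟩
  rw [Finset.sum_congr rfl (g := fun _ => G P)
    (fun y hy => by rw [(Finset.mem_filter.mp hy).2]), hset, Finset.sum_const,
    Finset.card_image_of_injOn, Finset.card_range, nsmul_eq_mul]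
  have := injOn_pow_card_pow (F := F) x
  rw [hx, hP.2.1] at this
  simpa using this

end

open Polynomial

section
variable {R : Type*} [CommRing R]

/-- The companion matrix of `X² + bX + c`. -/
def quadraticCompanion (b c : R) : Matrix (Fin 2) (Fin 2) R := !![0, -c; 1, -b]

theorem aeval_quadraticCompanion (b c : R) :
    aeval (quadraticCompanion b c) (X ^ 2 + C b * X + C c) = 0 := by
  simp only [map_add, map_mul, aeval_X, aeval_C, quadraticCompanion, pow_two]
  ext i j
  fin_cases i <;> fin_cases j <;>
    simp [Matrix.mul_apply, Matrix.algebraMap_matrix_apply]; ring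

theorem det_aeval_quadraticCompanion_X_sub_C (b c y : R) :
    (aeval (quadraticCompanion b c) (X - C y)).det = y ^ 2 + b * y + c := by
  rw [map_sub, aeval_X, aeval_C, Matrix.det_fin_two]
  simp [quadraticCompanion, Matrix.algebraMap_matrix_apply]
  ring

theorem map_det_aeval_quadraticCompanion {S : Type*} [CommRing S] (φ : R →+* S) (b c : R)
    (h : R[X]) : φ (aeval (quadraticCompanion b c) h).det =
      (aeval (quadraticCompanion (φ b) (φ c)) (h.map φ)).det := by
  rw [RingHom.map_det]
  congr 1
  have e : φ.mapMatrix (quadraticCompanion b c) = quadraticCompanion (φ b) (φ c) := by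
    ext i j
    fin_cases i <;> fin_cases j <;> simp [quadraticCompanion]
  rw [aeval_def, aeval_def, hom_eval₂, eval₂_map, e]
  congr 1
  ext r i j
  simp only [RingHom.comp_apply, RingHom.mapMatrix_apply, Matrix.map_apply,
    Matrix.algebraMap_matrix_apply]
  split_ifs <;> simp

/-- The completely multiplicative function on polynomials whose `L`-function governs the sum of
`ψ₁(x) ψ₂(x² + bx + c)`. -/
noncomputable def charLambda (ψ₁ ψ₂ : R →* ℂ) (b c : R) : R[X] →* ℂ :=
  (ψ₁.comp (evalRingHom 0).toMonoidHom) *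
    (ψ₂.comp (Matrix.detMonoidHom.comp
      (aeval (R := R) (quadraticCompanion b c)).toRingHom.toMonoidHom))

theorem charLambda_apply (ψ₁ ψ₂ : R →* ℂ) (b c : R) (h : R[X]) :
    charLambda ψ₁ ψ₂ b c h = ψ₁ (h.eval 0) * ψ₂ (aeval (quadraticCompanion b c) h).det := rfl

end

section
variable {F : Type*} [Field F] [Fintype F] {K : Type*} [Field K] [Fintype K] [Algebra F K]

theorem charLambda_minpoly_pow (ψ₁ ψ₂ : F →* ℂ) (b c : F) (x : K) :
    charLambda ψ₁ ψ₂ b c (minpoly F x) ^ (Module.finrank F K / (minpoly F x).natDegree) =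
      ψ₁ (Algebra.norm F (-x)) *
        ψ₂ (Algebra.norm F (x ^ 2 + algebraMap F K b * x + algebraMap F K c)) := by
  have hinj := (algebraMap F K).injective
  have e0 : ∀ g : F[X], algebraMap F K (Algebra.norm F (aeval x g)) =
      (∏ i ∈ Finset.range (minpoly F x).natDegree, aeval (x ^ Fintype.card F ^ i) g) ^
        (Module.finrank F K / (minpoly F x).natDegree) := by
    intro g
    rw [FiniteField.algebraMap_norm_eq_prod_pow, ← prod_range_finrank_eq_pow x (fun y => aeval y g)]
    refine Finset.prod_congr rfl fun i _ => ?_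
    rw [aeval_pow_card_pow, Nat.card_eq_fintype_card]
  have e1 : Algebra.norm F (-x) = (minpoly F x).eval 0 ^
      (Module.finrank F K / (minpoly F x).natDegree) := by
    apply hinj
    have h := e0 (-X)
    simp only [map_neg, aeval_X] at h
    rw [h, map_pow]
    congr 1
    rw [← coeff_zero_eq_eval_zero, ← coeff_map, minpoly_map_eq_prod_range,
      coeff_zero_eq_eval_zero, eval_prod]
    simp
  have e2 : Algebra.norm F (x ^ 2 + algebraMap F K b * x + algebraMap F K c) =
      (aeval (quadraticCompanion b c) (minpoly F x)).det ^
      (Module.finrank F K / (minpoly F x).natDegree) := by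
    apply hinj
    have h := e0 (X ^ 2 + C b * X + C c)
    simp only [map_add, map_mul, map_pow, aeval_X, aeval_C] at h
    rw [h, map_pow]
    congr 1
    rw [map_det_aeval_quadraticCompanion, minpoly_map_eq_prod_range]
    symm
    have hD := map_prod (Matrix.detMonoidHom.comp (aeval (R := K) (quadraticCompanion
      (algebraMap F K b) (algebraMap F K c))).toRingHom.toMonoidHom)
      (fun i => X - C (x ^ Fintype.card F ^ i)) (Finset.range (minpoly F x).natDegree)
    refine hD.trans (Finset.prod_congr rfl fun i _ => ?_)
    exact det_aeval_quadraticCompanion_X_sub_C _ _ _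
  rw [e1, e2, map_pow, map_pow, charLambda_apply, mul_pow]

theorem sum_norm_eq_sum_irreduciblesOf (ψ₁ ψ₂ : F →* ℂ) (b c : F) :
    ∑ x : K, ψ₁ (Algebra.norm F (-x)) *
        ψ₂ (Algebra.norm F (x ^ 2 + algebraMap F K b * x + algebraMap F K c)) =
      ∑ d ∈ (Module.finrank F K).divisors, ∑ P ∈ irreduciblesOf F d,
        (d : ℂ) * charLambda ψ₁ ψ₂ b c P ^ (Module.finrank F K / d) := by
  simp only [← charLambda_minpoly_pow]
  rw [sum_minpoly_eq (K := K) fun P => charLambda ψ₁ ψ₂ b c P ^ (Module.finrank F K / P.natDegree)]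
  refine Finset.sum_congr rfl fun d _ => Finset.sum_congr rfl fun P hP => ?_
  rw [(mem_irreduciblesOf.mp hP).2.1]

end

section
variable {F : Type*} [Field F] [Finite F]

theorem sum_monicsOf_eq_zero (lam : F[X] →* ℂ) (M : F[X]) (hM : M.Monic)
    (hper : ∀ g h, M ∣ g - h → lam g = lam h) (u : F[X]) (hu : IsCoprime u M) (hu1 : lam u ≠ 1)
    {n : ℕ} (hn : M.natDegree ≤ n) : ∑ h ∈ monicsOf F n, lam h = 0 := by
  obtain ⟨v, w, hvw⟩ := hu
  rcases eq_or_ne M 1 with hM1 | hM1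
  · exact absurd ((hper u 1 (by rw [hM1]; exact one_dvd _)).trans (map_one lam)) hu1
  have hdeg : ∀ g h : F[X], h ∈ monicsOf F n → h + (g %ₘ M - h %ₘ M) ∈ monicsOf F n := by
    intro g h hh
    rw [mem_monicsOf] at hh ⊢
    have h1 : (g %ₘ M - h %ₘ M).degree < h.degree := by
      have hM' : M.degree ≤ h.degree := by
        rw [degree_eq_natDegree hM.ne_zero, degree_eq_natDegree hh.1.ne_zero, hh.2]
        exact_mod_cast hn
      exact ((degree_sub_le _ _).trans_lt
        (max_lt (degree_modByMonic_lt _ hM) (degree_modByMonic_lt _ hM))).trans_le hM'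
    exact ⟨hh.1.add_of_left h1, by rw [natDegree_add_eq_left_of_degree_lt h1, hh.2]⟩
  have hmod : ∀ g h : F[X], M ∣ h + (g %ₘ M - h %ₘ M) - g := by
    intro g h
    have h1 := modByMonic_add_div g M
    have h2 := modByMonic_add_div h M
    refine ⟨h /ₘ M - g /ₘ M, ?_⟩
    linear_combination h1 - h2
  have hmod' : ∀ g h : F[X], M ∣ g - h → g %ₘ M = h %ₘ M := by
    intro g h hgh
    rw [← sub_eq_zero, ← sub_modByMonic, modByMonic_eq_zero_iff_dvd hM]
    exact hgh
  have key : ∑ h ∈ monicsOf F n, lam h = lam u * ∑ h ∈ monicsOf F n, lam h := by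
    rw [Finset.mul_sum]
    symm
    refine Finset.sum_bij' (fun h _ => h + ((u * h) %ₘ M - h %ₘ M))
      (fun h _ => h + ((v * h) %ₘ M - h %ₘ M)) (fun h hh => hdeg _ h hh)
      (fun h hh => hdeg _ h hh) ?_ ?_ ?_
    · intro h hh
      have e1 := hmod' _ _ (hmod (u * h) h)
      have e2 : (v * (h + ((u * h) %ₘ M - h %ₘ M))) %ₘ M = h %ₘ M := by
        apply hmod'
        obtain ⟨t, ht⟩ := hmod (u * h) h
        refine ⟨v * t - w * h, ?_⟩
        linear_combination v * ht + h * hvw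
      simp only [e1, e2]
      ring
    · intro h hh
      have e1 := hmod' _ _ (hmod (v * h) h)
      have e2 : (u * (h + ((v * h) %ₘ M - h %ₘ M))) %ₘ M = h %ₘ M := by
        apply hmod'
        obtain ⟨t, ht⟩ := hmod (v * h) h
        refine ⟨u * t - w * h, ?_⟩
        linear_combination u * ht + h * hvw
      simp only [e1, e2]
      ring
    · intro h _
      rw [← map_mul]
      exact (hper _ _ (hmod _ _)).symm
  have : (lam u - 1) * ∑ h ∈ monicsOf F n, lam h = 0 := by linear_combination -key
  rcases mul_eq_zero.mp this with h | h
  · exact absurd (sub_eq_zero.mp h) hu1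
  · exact h

end

open Polynomial

theorem norm_le_one_of_norm_pow_add_pow_le {u v : ℂ} {C : ℝ} {J : ℕ}
    (h : ∀ j, J ≤ j → ‖u ^ j + v ^ j‖ ≤ C) : ‖u‖ ≤ 1 := by
  have hC : 0 ≤ C := (norm_nonneg _).trans (h J le_rfl)
  have hunb : ∀ (x B : ℝ), (∀ j, J ≤ j → x ^ j ≤ B) → x ≤ 1 := by
    intro x B hx
    by_contra! h1
    obtain ⟨n, hn⟩ := pow_unbounded_of_one_lt B h1
    have := hx (n + J) (Nat.le_add_left _ _)
    have h2 : x ^ n ≤ x ^ (n + J) := pow_le_pow_right₀ h1.le (Nat.le_add_right _ _)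
    linarith
  by_contra! hu
  have huv : ‖u * v‖ ≤ 1 := by
    refine hunb _ ((C ^ 2 + C) / 2) fun j hj => ?_
    have e : 2 * (u * v) ^ j = (u ^ j + v ^ j) ^ 2 - (u ^ (2 * j) + v ^ (2 * j)) := by ring
    have h1 : ‖2 * (u * v) ^ j‖ ≤ C ^ 2 + C := by
      rw [e]
      refine (norm_sub_le _ _).trans (add_le_add ?_ (h _ (by omega)))
      rw [norm_pow]
      exact pow_le_pow_left₀ (norm_nonneg _) (h j hj) 2
    rw [norm_mul, norm_pow, Complex.norm_ofNat] at h1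
    linarith
  have hv : ‖v‖ ≤ 1 := by
    rw [norm_mul] at huv
    nlinarith [norm_nonneg v]
  have : ‖u‖ ≤ 1 := by
    refine hunb _ (C + 1) fun j hj => ?_
    have h1 : ‖u ^ j‖ ≤ ‖u ^ j + v ^ j‖ + ‖v ^ j‖ := by
      have := norm_sub_le (u ^ j + v ^ j) (v ^ j)
      rwa [add_sub_cancel_right] at this
    rw [norm_pow u, norm_pow v] at h1
    have h2 : ‖v‖ ^ j ≤ 1 := pow_le_one₀ (norm_nonneg _) hv
    linarith [h j hj]
  linarith

theorem norm_le_sqrt_of_norm_pow_add_pow_le {u v : ℂ} {q : ℝ} (hq : 0 < q) {C : ℝ} {J : ℕ}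
    (h : ∀ j, J ≤ j → ‖u ^ (2 * j) + v ^ (2 * j)‖ ≤ C * q ^ j) : ‖u‖ ≤ √q := by
  have key : ‖u ^ 2 / (q : ℂ)‖ ≤ 1 := by
    refine norm_le_one_of_norm_pow_add_pow_le (v := v ^ 2 / (q : ℂ)) (C := C) (J := J) ?_
    intro j hj
    rw [div_pow, div_pow, ← add_div, ← pow_mul, ← pow_mul, norm_div, norm_pow (q : ℂ),
      Complex.norm_real, Real.norm_of_nonneg hq.le, div_le_iff₀ (by positivity)]
    exact h j hj
  rw [norm_div, norm_pow, Complex.norm_real, Real.norm_of_nonneg hq.le, div_le_one hq] at key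
  exact Real.le_sqrt_of_sq_le key

theorem exists_root_sum_prod (a b : ℂ) : ∃ u v : ℂ, u + v = a ∧ u * v = b := by
  obtain ⟨d, hd⟩ := IsAlgClosed.exists_pow_nat_eq (a ^ 2 - 4 * b) (n := 2) (by norm_num)
  exact ⟨(a + d) / 2, (a - d) / 2, by ring, by linear_combination -hd / 4⟩

/-- Newton's identities for two variables. -/
theorem eq_neg_pow_add_pow_of_newton {S c : ℕ → ℂ} {u v : ℂ} (h0 : c 0 = 1)
    (hc : ∀ n, 3 ≤ n → c n = 0)
    (hN : ∀ n : ℕ, (n : ℂ) * c n = ∑ k ∈ Finset.Icc 1 n, S k * c (n - k))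
    (hu : u + v = -c 1) (huv : u * v = c 2) {n : ℕ} (hn : 1 ≤ n) : S n = -(u ^ n + v ^ n) := by
  have h1 : S 1 = c 1 := by simpa [h0] using (hN 1).symm
  have h2 : S 1 * c 1 + S 2 = 2 * c 2 := by
    have h := hN 2
    rw [show Finset.Icc 1 2 = {1, 2} from rfl, Finset.sum_pair (by norm_num)] at h
    norm_num [h0] at h
    exact h.symm
  have hrec : ∀ n, 3 ≤ n → S n + S (n - 1) * c 1 + S (n - 2) * c 2 = 0 := by
    intro n hn
    have h := hN n
    rw [hc n hn, mul_zero] at h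
    rw [h, ← Finset.sum_subset (s₁ := {n, n - 1, n - 2})]
    · rw [Finset.sum_insert, Finset.sum_pair]
      · rw [Nat.sub_self, h0, show n - (n - 1) = 1 by omega, show n - (n - 2) = 2 by omega]; ring
      · omega
      · simp only [Finset.mem_insert, Finset.mem_singleton]; omega
    · intro k hk
      simp only [Finset.mem_insert, Finset.mem_singleton] at hk
      rw [Finset.mem_Icc]; omega
    · intro k hk hk'
      simp only [Finset.mem_insert, Finset.mem_singleton, not_or] at hk'
      rw [Finset.mem_Icc] at hk
      rw [hc (n - k) (by omega), mul_zero]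
  induction n using Nat.strong_induction_on with
  | _ n ih =>
    rcases Nat.lt_or_ge n 3 with h | h
    · interval_cases n
      · linear_combination h1 + hu
      · linear_combination h2 - c 1 * h1 + (u + v - c 1) * hu - 2 * huv
    · have e := hrec n h
      rw [ih (n - 1) (by omega) (by omega), ih (n - 2) (by omega) (by omega)] at e
      obtain ⟨m, rfl⟩ : ∃ m, n = m + 2 := ⟨n - 2, by omega⟩
      rw [show m + 2 - 1 = m + 1 by omega, show m + 2 - 2 = m by omega] at e
      linear_combination e + (u ^ (m + 1) + v ^ (m + 1)) * hu - (u ^ m + v ^ m) * huv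

section
variable {F : Type*} [Field F] [Fintype F]

theorem norm_sum_neg_norm_le {K : Type*} [Field K] [Fintype K] [Algebra F K]
    (b c : F) (hd : b ^ 2 - 4 * c ≠ 0) (j : ℕ) (hj : 2 ≤ j)
    (hs : Fintype.card K = Fintype.card F ^ (2 * j))
    (ψ₁ ψ₂ : F →* ℂ) (h0 : ψ₂ 0 = 0) (hsum : ∑ ζ, ψ₂ ζ = 0) :
    ‖∑ x : K, ψ₁ (Algebra.norm F (-x)) *
        ψ₂ (Algebra.norm F (x ^ 2 + algebraMap F K b * x + algebraMap F K c))‖ ≤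
      (2 * Fintype.card F * (8 * Fintype.card F + 3) + 2) * (Fintype.card F : ℝ) ^ j := by
  have hq : 2 ≤ Fintype.card F := Fintype.one_lt_card
  obtain ⟨n, hn⟩ : ∃ n, Fintype.card F = n + 1 := ⟨Fintype.card F - 1, by omega⟩
  have hpow : Fintype.card F ^ 2 ≤ Fintype.card F ^ j := Nat.pow_le_pow_right (by omega) hj
  have h := norm_sum_char_norm_le (K := K) 1 (-b) c one_ne_zero (by simpa using hd) n
    (Fintype.card F ^ j) hn (by rw [hs]; ring) (by nlinarith) (by nlinarith) ψ₁ ψ₂ h0 hsum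
  rw [← Equiv.sum_comp (Equiv.neg K)] at h
  simp only [Equiv.neg_apply, map_one, one_mul, map_neg, neg_mul_neg, neg_sq] at h
  refine h.trans ?_
  push_cast
  have : (n : ℝ) ≤ Fintype.card F := by rw [hn]; push_cast; linarith
  gcongr


theorem exists_isCoprime_charLambda_ne_one (b c : F) (hd : b ^ 2 - 4 * c ≠ 0)
    (ψ₁ ψ₂ : F →* ℂ) (h0 : ψ₂ 0 = 0) (hsum : ∑ ζ, ψ₂ ζ = 0) :
    ∃ u : F[X], IsCoprime u (X * (X ^ 2 + C b * X + C c)) ∧ charLambda ψ₁ ψ₂ b c u ≠ 1 := by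
  classical
  by_contra! hcon
  set M : F[X] := X * (X ^ 2 + C b * X + C c) with hM
  have hMdeg : M.natDegree ≤ 3 := by rw [hM]; compute_degree
  have hM0 : M.Monic := by rw [hM]; monicity!
  have hq : 2 ≤ Fintype.card F := Fintype.one_lt_card
  have hq' : (2 : ℝ) ≤ Fintype.card F := by exact_mod_cast hq
  set B : ℝ := 2 * Fintype.card F * (8 * Fintype.card F + 3) + 2 with hB
  obtain ⟨j, hj⟩ := pow_unbounded_of_one_lt (B + 6) (show (1 : ℝ) < Fintype.card F by linarith)
  obtain ⟨p, hp⟩ := CharP.exists F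
  have : Fact p.Prime := ⟨CharP.char_is_prime F p⟩
  have : NeZero (2 * (j + 2)) := ⟨by omega⟩
  let K := FiniteField.Extension F p (2 * (j + 2))
  let : Fintype K := Fintype.ofFinite K
  have hcard : Fintype.card K = Fintype.card F ^ (2 * (j + 2)) := by
    rw [← Nat.card_eq_fintype_card, FiniteField.natCard_extension, Nat.card_eq_fintype_card]
  have hS := norm_sum_neg_norm_le (K := K) b c hd (j + 2) (by omega) hcard ψ₁ ψ₂ h0 hsum
  rw [← hB] at hS
  set H : K → ℂ := fun x => ψ₁ (Algebra.norm F (-x)) *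
        ψ₂ (Algebra.norm F (x ^ 2 + algebraMap F K b * x + algebraMap F K c)) with hH
  have hroots : ((M.map (algebraMap F K)).roots.toFinset).card ≤ 3 := by
    refine (Multiset.toFinset_card_le _).trans ((card_roots' _).trans ?_)
    rw [natDegree_map]; exact hMdeg
  have hone : ∀ x, x ∉ (M.map (algebraMap F K)).roots.toFinset → H x - 1 = 0 := by
    intro x hx
    rw [Multiset.mem_toFinset, mem_roots (hM0.map _).ne_zero, IsRoot, eval_map_algebraMap] at hx
    have hxint : IsIntegral F x := Algebra.IsIntegral.isIntegral x
    have hcop : IsCoprime (minpoly F x) M := by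
      rw [(minpoly.irreducible hxint).coprime_iff_not_dvd]
      rwa [minpoly.dvd_iff]
    have := charLambda_minpoly_pow ψ₁ ψ₂ b c x
    rw [hcon _ hcop, one_pow] at this
    rw [hH]; simp only
    rw [← this, sub_self]
  have hsum1 : ‖∑ x : K, (H x - 1)‖ ≤ 6 := by
    rw [← Finset.sum_subset (Finset.subset_univ _) fun x _ hx => hone x hx]
    refine (norm_sum_le_of_le (f := fun x => H x - 1) (n := fun _ => (2 : ℝ)) _
      fun x _ => ?_).trans ?_
    · refine (norm_sub_le _ _).trans ?_
      have h1 : ‖H x‖ ≤ 1 := by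
        simp only [hH, norm_mul]
        exact mul_le_one₀ (monoidHom_norm_le_one _ _) (norm_nonneg _) (monoidHom_norm_le_one _ _)
      rw [norm_one]; linarith
    · rw [Finset.sum_const, nsmul_eq_mul]
      have : (((M.map (algebraMap F K)).roots.toFinset).card : ℝ) ≤ 3 := by exact_mod_cast hroots
      linarith
  rw [Finset.sum_sub_distrib, Finset.sum_const, Finset.card_univ, nsmul_eq_mul, mul_one] at hsum1
  have h1 : (Fintype.card K : ℝ) ≤ ‖∑ x : K, H x‖ + 6 := by
    have h2 := norm_sub_norm_le (Fintype.card K : ℂ) (∑ x : K, H x)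
    rw [Complex.norm_natCast, norm_sub_rev] at h2
    linarith
  rw [hcard, mul_comm 2, pow_mul] at h1
  push_cast at h1
  have hB0 : 0 ≤ B := by rw [hB]; positivity
  have hs : B + 6 < (Fintype.card F : ℝ) ^ (j + 2) :=
    hj.trans_le (pow_le_pow_right₀ (by linarith) (by omega))
  nlinarith [h1, hS, hs]

omit [Fintype F] in
theorem charLambda_eq_of_dvd_sub (ψ₁ ψ₂ : F →* ℂ) (b c : F) {g h : F[X]}
    (hgh : X ^ 2 + C b * X + C c ∣ g - h) (h0 : ψ₁ (g.eval 0) = ψ₁ (h.eval 0)) :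
    charLambda ψ₁ ψ₂ b c g = charLambda ψ₁ ψ₂ b c h := by
  obtain ⟨t, ht⟩ := hgh
  rw [charLambda_apply, charLambda_apply, h0]
  have := congrArg (aeval (quadraticCompanion b c)) ht
  rw [map_mul, aeval_quadraticCompanion, zero_mul, map_sub, sub_eq_zero] at this
  rw [this]

theorem sum_monicsOf_one {A : Type*} [AddCommMonoid A] (G : F[X] → A) :
    ∑ h ∈ monicsOf F 1, G h = ∑ t : F, G (X - C t) := by
  symm
  refine Finset.sum_bij (fun t _ => X - C t) ?_ ?_ ?_ ?_
  · intro t _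
    rw [mem_monicsOf]
    exact ⟨monic_X_sub_C t, natDegree_X_sub_C t⟩
  · intro t _ t' _ h
    exact C_injective (sub_right_injective h)
  · intro h hh
    rw [mem_monicsOf] at hh
    refine ⟨-h.coeff 0, Finset.mem_univ _, ?_⟩
    rw [hh.1.eq_X_add_C hh.2, map_neg, sub_neg_eq_add]
    simp
  · intro t _; rfl

/-- Weil's bound for the sum of `ψ₁(x) ψ₂(x² + bx + c)`; the bound is smaller when `ψ₁ = 1`. -/
theorem norm_sum_char_monic_quadratic_le (b c : F) (hd : b ^ 2 - 4 * c ≠ 0)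
    (ψ₁ ψ₂ : F →* ℂ) (h0 : ψ₂ 0 = 0) (hsum : ∑ ζ, ψ₂ ζ = 0) :
    ‖∑ x : F, ψ₁ (-x) * ψ₂ (x ^ 2 + b * x + c)‖ ≤ 2 * √(Fintype.card F) ∧
      (ψ₁ = 1 → ‖∑ x : F, ψ₁ (-x) * ψ₂ (x ^ 2 + b * x + c)‖ ≤ √(Fintype.card F)) := by
  classical
  set lam := charLambda ψ₁ ψ₂ b c with hlam
  set cc : ℕ → ℂ := fun n => ∑ h ∈ monicsOf F n, lam h with hcc
  set S : ℕ → ℂ := fun k => ∑ d ∈ k.divisors, ∑ P ∈ irreduciblesOf F d,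
    (d : ℂ) * lam P ^ (k / d) with hSdef
  obtain ⟨u, hu, hu1⟩ := exists_isCoprime_charLambda_ne_one b c hd ψ₁ ψ₂ h0 hsum
  have hc0 : cc 0 = 1 := by simp [hcc, monicsOf_zero]
  have hc1 : cc 1 = ∑ x : F, ψ₁ (-x) * ψ₂ (x ^ 2 + b * x + c) := by
    simp only [hcc]
    rw [sum_monicsOf_one]
    refine Finset.sum_congr rfl fun t _ => ?_
    rw [hlam, charLambda_apply, det_aeval_quadraticCompanion_X_sub_C]
    simp
  have hc3 : ∀ n, 3 ≤ n → cc n = 0 := by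
    intro n hn
    refine sum_monicsOf_eq_zero lam (X * (X ^ 2 + C b * X + C c)) (by monicity!) ?_ u hu hu1 ?_
    · intro g h hgh
      refine charLambda_eq_of_dvd_sub ψ₁ ψ₂ b c ((dvd_mul_left _ _).trans hgh) ?_
      obtain ⟨t, ht⟩ := hgh
      have := congrArg (eval 0) ht
      simp only [eval_sub, eval_mul, eval_X, zero_mul, sub_eq_zero] at this
      rw [this]
    · refine le_trans ?_ hn
      compute_degree
  have hc2 : ψ₁ = 1 → cc 2 = 0 := by
    rintro h1
    refine sum_monicsOf_eq_zero lam (X ^ 2 + C b * X + C c) (by monicity!) ?_ u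
      (hu.of_mul_right_right) hu1 (by compute_degree)
    intro g h hgh
    refine charLambda_eq_of_dvd_sub ψ₁ ψ₂ b c hgh ?_
    rw [h1]; rfl
  obtain ⟨ω₁, ω₂, hadd, hmul⟩ := exists_root_sum_prod (-cc 1) (cc 2)
  have hS : ∀ n, 1 ≤ n → S n = -(ω₁ ^ n + ω₂ ^ n) := fun n hn =>
    eq_neg_pow_add_pow_of_newton hc0 hc3 (fun n => natCast_mul_sum_monicsOf lam n) hadd hmul hn
  have hq : (0 : ℝ) < Fintype.card F := by exact_mod_cast Fintype.card_pos
  obtain ⟨p, hp⟩ := CharP.exists F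
  have : Fact p.Prime := ⟨CharP.char_is_prime F p⟩
  have hbound : ∀ j, 2 ≤ j → ‖ω₁ ^ (2 * j) + ω₂ ^ (2 * j)‖ ≤
      (2 * Fintype.card F * (8 * Fintype.card F + 3) + 2) * (Fintype.card F : ℝ) ^ j := by
    intro j hj
    have : NeZero (2 * j) := ⟨by omega⟩
    let K := FiniteField.Extension F p (2 * j)
    let : Fintype K := Fintype.ofFinite K
    have hcard : Fintype.card K = Fintype.card F ^ (2 * j) := by
      rw [← Nat.card_eq_fintype_card, FiniteField.natCard_extension, Nat.card_eq_fintype_card]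
    have h := norm_sum_neg_norm_le (K := K) b c hd j hj hcard ψ₁ ψ₂ h0 hsum
    rw [sum_norm_eq_sum_irreduciblesOf, FiniteField.finrank_extension] at h
    have e := hS (2 * j) (by omega)
    simp only [hSdef] at e
    rw [e, norm_neg] at h
    exact h
  have hω₁ := norm_le_sqrt_of_norm_pow_add_pow_le hq hbound
  have hω₂ := norm_le_sqrt_of_norm_pow_add_pow_le (u := ω₂) (v := ω₁) hq
    (fun j hj => by rw [add_comm]; exact hbound j hj)
  rw [← hc1, ← norm_neg, ← hadd]
  refine ⟨(norm_add_le _ _).trans (by linarith), fun h1 => ?_⟩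
  rw [hc2 h1] at hmul
  rcases mul_eq_zero.mp hmul with h | h <;> simpa [h]

/-- Weil's bound for the sum of `ψ₁(x) ψ₂(ax² + bx + c)`; the bound is smaller when `ψ₁ = 1`. -/
theorem norm_sum_char_quadratic_le (a b c : F) (ha : a ≠ 0) (hd : b ^ 2 - 4 * a * c ≠ 0)
    (ψ₁ ψ₂ : F →* ℂ) (h0 : ψ₂ 0 = 0) (hsum : ∑ ζ, ψ₂ ζ = 0) :
    ‖∑ x : F, ψ₁ x * ψ₂ (a * x ^ 2 + b * x + c)‖ ≤ 2 * √(Fintype.card F) ∧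
      (ψ₁ = 1 → ‖∑ x : F, ψ₁ x * ψ₂ (a * x ^ 2 + b * x + c)‖ ≤ √(Fintype.card F)) := by
  have h := norm_sum_char_monic_quadratic_le (-b / a) (c / a) (by
    intro h; apply hd; field_simp at h; linear_combination h) ψ₁ ψ₂ h0 hsum
  have e : ‖∑ x : F, ψ₁ x * ψ₂ (a * x ^ 2 + b * x + c)‖ ≤
      ‖∑ x : F, ψ₁ (-x) * ψ₂ (x ^ 2 + -b / a * x + c / a)‖ := by
    have e1 : ∑ x : F, ψ₁ x * ψ₂ (a * x ^ 2 + b * x + c) =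
        ψ₂ a * ∑ x : F, ψ₁ (-x) * ψ₂ (x ^ 2 + -b / a * x + c / a) := by
      rw [← Equiv.sum_comp (Equiv.neg F), Finset.mul_sum]
      refine Finset.sum_congr rfl fun x _ => ?_
      rw [Equiv.neg_apply, show a * (-x) ^ 2 + b * (-x) + c =
        a * (x ^ 2 + -b / a * x + c / a) by field_simp, map_mul]
      ring
    rw [e1, norm_mul]
    exact mul_le_of_le_one_left (norm_nonneg _) (monoidHom_norm_le_one _ _)
  exact ⟨e.trans h.1, fun h1 => e.trans (h.2 h1)⟩

end

section GroupAlgebra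

variable {G : Type*} [CommGroup G] [Fintype G]

/-- The `ℓ¹`-norm of the coefficients of an element of a group algebra. -/
noncomputable def l1 (u : MonoidAlgebra ℂ G) : ℝ := ∑ g, ‖u.coeff g‖

/-- `u` is supported on the elements killed by `k`. -/
def SuppTorsion (k : ℕ) (u : MonoidAlgebra ℂ G) : Prop := ∀ g, u.coeff g ≠ 0 → g ^ k = 1

omit [CommGroup G] in
theorem l1_nonneg (u : MonoidAlgebra ℂ G) : 0 ≤ l1 u :=
  Finset.sum_nonneg fun _ _ => norm_nonneg _

theorem l1_add_le (u v : MonoidAlgebra ℂ G) : l1 (u + v) ≤ l1 u + l1 v := by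
  simp only [l1, ← Finset.sum_add_distrib]
  exact Finset.sum_le_sum fun g _ => norm_add_le _ _

theorem l1_smul (r : ℂ) (u : MonoidAlgebra ℂ G) : l1 (r • u) = ‖r‖ * l1 u := by
  simp [l1, Finset.mul_sum]

omit [CommGroup G] in
theorem l1_single (g : G) (r : ℂ) : l1 (MonoidAlgebra.single g r) = ‖r‖ := by
  classical
  rw [l1, Finset.sum_eq_single g] <;> simp +contextual [eq_comm]

theorem l1_sum_le {ι : Type*} (s : Finset ι) (u : ι → MonoidAlgebra ℂ G) :
    l1 (∑ i ∈ s, u i) ≤ ∑ i ∈ s, l1 (u i) := by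
  classical
  induction s using Finset.induction_on with
  | empty => simp [l1]
  | insert i s hi ih =>
    rw [Finset.sum_insert hi, Finset.sum_insert hi]
    exact (l1_add_le _ _).trans (by gcongr)

theorem coeff_mul_eq_sum (u v : MonoidAlgebra ℂ G) (g : G) :
    (u * v).coeff g = ∑ x, u.coeff x * v.coeff (x⁻¹ * g) := by
  classical
  rw [MonoidAlgebra.coeff_mul, Finsupp.sum_fintype _ _ (by simp)]
  refine Finset.sum_congr rfl fun x _ => ?_
  rw [Finsupp.sum_fintype _ _ (by simp), Finset.sum_eq_single (x⁻¹ * g)]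
  · simp
  · intro y _ hy
    rw [if_neg]
    rintro rfl
    simp at hy
  · simp

theorem l1_mul_le (u v : MonoidAlgebra ℂ G) : l1 (u * v) ≤ l1 u * l1 v := by
  simp only [l1, coeff_mul_eq_sum]
  calc ∑ g, ‖∑ x, u.coeff x * v.coeff (x⁻¹ * g)‖
      ≤ ∑ g, ∑ x, ‖u.coeff x‖ * ‖v.coeff (x⁻¹ * g)‖ := by
        gcongr with g _
        exact (norm_sum_le _ _).trans (by simp)
    _ = ∑ x, ‖u.coeff x‖ * ∑ g, ‖v.coeff (x⁻¹ * g)‖ := by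
        rw [Finset.sum_comm]; simp [Finset.mul_sum]
    _ = _ := by
        rw [Finset.sum_mul]
        refine Finset.sum_congr rfl fun x _ => ?_
        congr 1
        exact Fintype.sum_equiv (Equiv.mulLeft x⁻¹) _ _ (by simp)

theorem l1_prod_le {ι : Type*} (s : Finset ι) (u : ι → MonoidAlgebra ℂ G) :
    l1 (∏ i ∈ s, u i) ≤ ∏ i ∈ s, l1 (u i) := by
  classical
  induction s using Finset.induction_on with
  | empty => simp [MonoidAlgebra.one_def, l1_single]
  | insert i s hi ih =>
    rw [Finset.prod_insert hi, Finset.prod_insert hi]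
    exact (l1_mul_le _ _).trans (by gcongr; exact l1_nonneg _)

omit [Fintype G] in
theorem SuppTorsion.add {k : ℕ} {u v : MonoidAlgebra ℂ G} (hu : SuppTorsion k u)
    (hv : SuppTorsion k v) : SuppTorsion k (u + v) := by
  intro g hg
  by_cases h : u.coeff g = 0
  · exact hv g fun h' => hg (by simp [h, h'])
  · exact hu g h

omit [Fintype G] in
theorem SuppTorsion.smul {k : ℕ} {u : MonoidAlgebra ℂ G} (hu : SuppTorsion k u) (r : ℂ) :
    SuppTorsion k (r • u) := fun g hg => hu g fun h => hg (by simp [h])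

omit [Fintype G] in
theorem SuppTorsion.single {k : ℕ} {g : G} (hg : g ^ k = 1) (r : ℂ) :
    SuppTorsion k (MonoidAlgebra.single g r) := by
  classical
  intro x hx
  rw [MonoidAlgebra.coeff_single, Finsupp.single_apply] at hx
  split_ifs at hx with h
  · rwa [← h]
  · exact absurd rfl hx

omit [Fintype G] in
theorem SuppTorsion.sum {k : ℕ} {ι : Type*} (s : Finset ι) (u : ι → MonoidAlgebra ℂ G)
    (h : ∀ i ∈ s, SuppTorsion k (u i)) : SuppTorsion k (∑ i ∈ s, u i) := by
  classical
  induction s using Finset.induction_on with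
  | empty => intro g hg; simp at hg
  | insert i s hi ih =>
    rw [Finset.sum_insert hi]
    exact (h i (by simp)).add (ih fun j hj => h j (by simp [hj]))

omit [Fintype G] in
theorem SuppTorsion.mono {k l : ℕ} {u : MonoidAlgebra ℂ G} (hu : SuppTorsion k u) (h : k ∣ l) :
    SuppTorsion l u := by
  obtain ⟨m, rfl⟩ := h
  intro g hg
  rw [pow_mul, hu g hg, one_pow]

theorem SuppTorsion.mul {k l : ℕ} {u v : MonoidAlgebra ℂ G} (hu : SuppTorsion k u)
    (hv : SuppTorsion l v) : SuppTorsion (k * l) (u * v) := by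
  intro g hg
  rw [coeff_mul_eq_sum] at hg
  obtain ⟨x, -, hx⟩ := Finset.exists_ne_zero_of_sum_ne_zero hg
  have h1 := hu x (left_ne_zero_of_mul hx)
  have h2 := hv _ (right_ne_zero_of_mul hx)
  have : g = x * (x⁻¹ * g) := by simp
  rw [this, mul_pow, pow_mul, h1, mul_comm k, pow_mul, h2, one_pow, one_pow, one_mul]

theorem SuppTorsion.prod {ι : Type*} (s : Finset ι) (k : ι → ℕ) (u : ι → MonoidAlgebra ℂ G)
    (h : ∀ i ∈ s, SuppTorsion (k i) (u i)) : SuppTorsion (∏ i ∈ s, k i) (∏ i ∈ s, u i) := by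
  classical
  induction s using Finset.induction_on with
  | empty => simpa [MonoidAlgebra.one_def] using SuppTorsion.single (one_pow 1) 1
  | insert i s hi ih =>
    rw [Finset.prod_insert hi, Finset.prod_insert hi]
    exact (h i (by simp)).mul (ih fun j hj => h j (by simp [hj]))

theorem coeff_mul_of_coprime {k l : ℕ} (hkl : k.Coprime l) {u v : MonoidAlgebra ℂ G}
    (hu : SuppTorsion k u) (hv : SuppTorsion l v) {g : G} (hg : g ^ k = 1) :
    (u * v).coeff g = u.coeff g * v.coeff 1 := by
  rw [coeff_mul_eq_sum, Finset.sum_eq_single g]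
  · simp
  · intro x _ hx
    by_contra h
    have h1 := hu x (left_ne_zero_of_mul h)
    have h2 := hv _ (right_ne_zero_of_mul h)
    have h3 : (x⁻¹ * g) ^ k = 1 := by rw [mul_pow, inv_pow, h1, hg]; simp
    have h4 := pow_gcd_eq_one.2 ⟨h3, h2⟩
    rw [hkl.gcd_eq_one, pow_one, inv_mul_eq_one] at h4
    exact hx h4
  · simp

theorem coeff_prod_one {ι : Type*} (s : Finset ι) (k : ι → ℕ) (u : ι → MonoidAlgebra ℂ G)
    (hk : (s : Set ι).Pairwise fun i j => (k i).Coprime (k j))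
    (h : ∀ i ∈ s, SuppTorsion (k i) (u i)) :
    (∏ i ∈ s, u i).coeff 1 = ∏ i ∈ s, (u i).coeff 1 := by
  classical
  induction s using Finset.induction_on with
  | empty => simp
  | insert i s hi ih =>
    rw [Finset.prod_insert hi, Finset.prod_insert hi,
      coeff_mul_of_coprime (Nat.Coprime.prod_right fun j hj => hk (by simp) (by simp [hj])
        (by rintro rfl; exact hi hj)) (h i (by simp))
        (SuppTorsion.prod s k u fun j hj => h j (by simp [hj])) (one_pow _),
      ih (hk.mono (by simp)) fun j hj => h j (by simp [hj])]

end GroupAlgebra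

section CyclicAverage

variable {G : Type*} [CommGroup G] [Fintype G]

/-- The average of the powers `g ^ i`, `i < p`, in the group algebra. -/
noncomputable def cyclicAvg (g : G) (p : ℕ) : MonoidAlgebra ℂ G :=
  (p : ℂ)⁻¹ • ∑ i ∈ Finset.range p, MonoidAlgebra.single (g ^ i) 1

omit [Fintype G] in
theorem suppTorsion_cyclicAvg {g : G} {p : ℕ} (hg : g ^ p = 1) :
    SuppTorsion p (cyclicAvg g p) := by
  refine (SuppTorsion.sum _ _ fun i _ => SuppTorsion.single ?_ 1).smul _
  rw [← pow_mul, mul_comm, pow_mul, hg, one_pow]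

omit [Fintype G] in
theorem coeff_cyclicAvg_one {g : G} {p : ℕ} (hp : 0 < p) (hg : orderOf g = p) :
    (cyclicAvg g p).coeff 1 = (p : ℂ)⁻¹ := by
  classical
  rw [cyclicAvg, MonoidAlgebra.coeff_smul_apply, MonoidAlgebra.coeff_sum, Finsupp.finsetSum_apply,
    Finset.sum_eq_single 0]
  · simp
  · intro i hi h0
    rw [MonoidAlgebra.coeff_single, Finsupp.single_apply, if_neg]
    exact pow_ne_one_of_lt_orderOf h0 (hg ▸ Finset.mem_range.1 hi)
  · simp [hp.ne']

theorem l1_inv_smul_sub_cyclicAvg_le {g : G} {p : ℕ} (hp : 0 < p) :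
    l1 ((p : ℂ)⁻¹ • 1 - cyclicAvg g p) ≤ 1 - 1 / p := by
  obtain ⟨n, rfl⟩ := Nat.exists_eq_succ_of_ne_zero hp.ne'
  have : ((n.succ : ℕ) : ℂ)⁻¹ • (1 : MonoidAlgebra ℂ G) - cyclicAvg g n.succ =
      (-((n.succ : ℕ) : ℂ)⁻¹) • ∑ i ∈ Finset.range n, MonoidAlgebra.single (g ^ (i + 1)) 1 := by
    rw [cyclicAvg, Finset.sum_range_succ', pow_zero, ← MonoidAlgebra.one_def, smul_add, neg_smul]
    abel
  rw [this, l1_smul, norm_neg, norm_inv, Complex.norm_natCast]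
  calc _ ≤ ((n.succ : ℕ) : ℝ)⁻¹ * ∑ i ∈ Finset.range n, (1 : ℝ) := by
        gcongr
        refine (l1_sum_le _ _).trans (Finset.sum_le_sum fun i _ => ?_)
        rw [l1_single, norm_one]
    _ = _ := by
        simp only [Finset.sum_const, Finset.card_range, nsmul_eq_mul, mul_one]
        push_cast
        field_simp
        ring

theorem l1_one_sub_cyclicAvg_le {g : G} {p : ℕ} (hp : 0 < p) :
    l1 (1 - cyclicAvg g p) ≤ 2 * (1 - 1 / p) := by
  have : 1 - cyclicAvg g p =
      (1 - (p : ℂ)⁻¹) • (1 : MonoidAlgebra ℂ G) + ((p : ℂ)⁻¹ • 1 - cyclicAvg g p) := by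
    rw [sub_smul, one_smul]; abel
  rw [this]
  refine (l1_add_le _ _).trans ?_
  have h1 : l1 ((1 - (p : ℂ)⁻¹) • (1 : MonoidAlgebra ℂ G)) = 1 - 1 / p := by
    rw [l1_smul, MonoidAlgebra.one_def, l1_single, norm_one, mul_one]
    have : (1 - (p : ℂ)⁻¹) = ((1 - 1 / p : ℝ) : ℂ) := by push_cast; ring
    rw [this, Complex.norm_real, Real.norm_of_nonneg]
    rw [sub_nonneg, div_le_one (by positivity)]
    exact_mod_cast hp
  linarith [l1_inv_smul_sub_cyclicAvg_le (g := g) hp]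

omit [Fintype G] in
theorem suppTorsion_one (k : ℕ) : SuppTorsion k (1 : MonoidAlgebra ℂ G) :=
  MonoidAlgebra.one_def (R := ℂ) (M := G) ▸ SuppTorsion.single (one_pow k) 1

omit [Fintype G] in
theorem SuppTorsion.sub {k : ℕ} {u v : MonoidAlgebra ℂ G} (hu : SuppTorsion k u)
    (hv : SuppTorsion k v) : SuppTorsion k (u - v) := by
  rw [sub_eq_add_neg, ← neg_one_smul ℂ v]
  exact hu.add (hv.smul _)

/-- Product over `p ∈ E` of `1 - cyclicAvg (χ p) p`. -/
noncomputable def freeElt (χ : ℕ → G) (E : Finset ℕ) : MonoidAlgebra ℂ G :=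
  ∏ p ∈ E, (1 - cyclicAvg (χ p) p)

variable {χ : ℕ → G} {E : Finset ℕ}

theorem suppTorsion_freeElt (hχ : ∀ p ∈ E, orderOf (χ p) = p) :
    SuppTorsion (∏ p ∈ E, p) (freeElt χ E) :=
  SuppTorsion.prod _ _ _ fun p hp =>
    (suppTorsion_one p).sub (suppTorsion_cyclicAvg (by
      have := pow_orderOf_eq_one (χ p); rwa [hχ p hp] at this))

theorem coeff_freeElt_one (hE : ∀ p ∈ E, p.Prime) (hχ : ∀ p ∈ E, orderOf (χ p) = p) :
    (freeElt χ E).coeff 1 = ((∏ p ∈ E, (1 - 1 / (p : ℝ)) : ℝ) : ℂ) := by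
  rw [freeElt, coeff_prod_one E (fun p => p)]
  · push_cast
    refine Finset.prod_congr rfl fun p hp => ?_
    rw [MonoidAlgebra.coeff_sub, Finsupp.sub_apply, coeff_cyclicAvg_one (hE p hp).pos (hχ p hp)]
    simp
  · intro p hp q hq hpq
    exact (Nat.coprime_primes (hE p hp) (hE q hq)).2 hpq
  · exact fun p hp => (suppTorsion_one p).sub (suppTorsion_cyclicAvg (by
      have := pow_orderOf_eq_one (χ p); rwa [hχ p hp] at this))

theorem l1_freeElt_le (hE : ∀ p ∈ E, p.Prime) :
    l1 (freeElt χ E) ≤ (∏ p ∈ E, (1 - 1 / (p : ℝ))) * 2 ^ E.card := by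
  refine (l1_prod_le _ _).trans ?_
  rw [← Finset.prod_const, ← Finset.prod_mul_distrib]
  refine Finset.prod_le_prod (fun _ _ => l1_nonneg _) fun p hp => ?_
  rw [mul_comm]
  exact l1_one_sub_cyclicAvg_le (hE p hp).pos

/-- The coefficient of `freeElt` at the element of order two. -/
theorem coeff_freeElt_two (hE : ∀ p ∈ E, p.Prime) (hχ : ∀ p ∈ E, orderOf (χ p) = p) (h2 : 2 ∈ E) :
    (freeElt χ E).coeff (χ 2) = -((∏ p ∈ E, (1 - 1 / (p : ℝ)) : ℝ) : ℂ) := by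
  classical
  have hχ2 : χ 2 ^ 2 = 1 := by
    have := pow_orderOf_eq_one (χ 2); rwa [hχ 2 h2] at this
  have hne : χ 2 ≠ 1 := by
    intro h
    have := hχ 2 h2
    rw [h, orderOf_one] at this
    omega
  have hsub : ∀ p ∈ E.erase 2, p ∈ E := fun p hp => Finset.mem_of_mem_erase hp
  have hprod : freeElt χ E = (1 - cyclicAvg (χ 2) 2) * freeElt χ (E.erase 2) :=
    (Finset.mul_prod_erase _ _ h2).symm
  rw [hprod, ← Finset.mul_prod_erase _ _ h2,
    coeff_mul_of_coprime (k := 2) (l := ∏ p ∈ E.erase 2, p) _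
      ((suppTorsion_one 2).sub (suppTorsion_cyclicAvg hχ2))
      (suppTorsion_freeElt (χ := χ) (E := E.erase 2) fun p hp => hχ p (hsub p hp)) hχ2]
  · have := coeff_freeElt_one (χ := χ) (E := E.erase 2) (fun p hp => hE p (hsub p hp))
      fun p hp => hχ p (hsub p hp)
    rw [this]
    have : (1 - cyclicAvg (χ 2) 2).coeff (χ 2) = -(1 / 2) := by
      rw [MonoidAlgebra.coeff_sub, Finsupp.sub_apply, MonoidAlgebra.one_def,
        MonoidAlgebra.coeff_single, Finsupp.single_apply, if_neg (Ne.symm hne), cyclicAvg,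
        MonoidAlgebra.coeff_smul_apply, Finset.sum_range_succ, Finset.sum_range_one]
      simp [Ne.symm hne]
    rw [this]
    push_cast
    ring
  · exact Nat.Coprime.prod_right fun p hp =>
      (Nat.coprime_primes Nat.prime_two (hE p (hsub p hp))).2 (Finset.ne_of_mem_erase hp).symm

theorem prime_notMem_coprime_prod (hE : ∀ p ∈ E, p.Prime) {p : ℕ} (hp : p.Prime) (hpE : p ∉ E) :
    (∏ l ∈ E, l).Coprime p :=
  Nat.Coprime.prod_left fun l hl =>
    (Nat.coprime_primes (hE l hl) hp).2 fun h => hpE (h ▸ hl)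

/-- The deviation of the `p`-th power indicator from its mean has no Fourier coefficient at
characters killed by the primes of `E`, even after multiplication by `freeElt`. -/
theorem coeff_freeElt_mul_eq_zero (hE : ∀ p ∈ E, p.Prime) (hχ : ∀ p ∈ E, orderOf (χ p) = p)
    {p : ℕ} (hp : p.Prime) (hpE : p ∉ E) (hχp : orderOf (χ p) = p) {g : G}
    (hg : g ^ (∏ l ∈ E, l) = 1) :
    (freeElt χ E * ((p : ℂ)⁻¹ • 1 - cyclicAvg (χ p) p)).coeff g = 0 := by
  have hχ' : χ p ^ p = 1 := by
    have := pow_orderOf_eq_one (χ p); rwa [hχp] at this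
  rw [coeff_mul_of_coprime (prime_notMem_coprime_prod hE hp hpE) (suppTorsion_freeElt hχ)
    (((suppTorsion_one p).smul _).sub (suppTorsion_cyclicAvg hχ')) hg,
    MonoidAlgebra.coeff_sub, Finsupp.sub_apply, coeff_cyclicAvg_one hp.pos hχp]
  simp

end CyclicAverage

section QuadraticCharacter

variable {F : Type*} [Field F] [Fintype F]

theorem isQuadratic_apply_nonsquare {η : MulChar F ℂ} (hη : orderOf η = 2) {t : F}
    (ht : ¬ IsSquare t) : η t = -1 := by
  classical
  have hF : ringChar F ≠ 2 := fun h => ht (FiniteField.isSquare_of_char_two h t)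
  have h2 : η ^ 2 = 1 := hη ▸ pow_orderOf_eq_one η
  have hne : η ≠ 1 := by
    rintro rfl
    simp at hη
  have hsq : ∀ x : F, x ≠ 0 → η x ^ 2 = 1 := fun x hx => by
    rw [← MulChar.pow_apply' η two_ne_zero, h2, MulChar.one_apply hx.isUnit]
  have ht0 : t ≠ 0 := by rintro rfl; exact ht (IsSquare.zero)
  refine (sq_eq_sq_iff_eq_or_eq_neg.1 ((hsq t ht0).trans (one_pow 2).symm)).resolve_left fun h1
      => hne ?_
  refine MulChar.eq_one_iff.2 fun x => ?_
  have hs : ∀ s : F, s ≠ 0 → η (s * s) = 1 := fun s h => by rw [map_mul, ← pow_two, hsq s h]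
  by_cases hx : IsSquare (x : F)
  · obtain ⟨s, hs'⟩ := hx
    rw [hs']
    exact hs s (by rintro rfl; simp at hs')
  · have : IsSquare ((x : F) * t) := by
      rw [← quadraticChar_one_iff_isSquare (mul_ne_zero x.ne_zero ht0), map_mul,
        quadraticChar_neg_one_iff_not_isSquare.2 hx, quadraticChar_neg_one_iff_not_isSquare.2 ht]
      norm_num
    obtain ⟨s, hs'⟩ := this
    have h3 := hs s (by rintro rfl; simp [ht0] at hs')
    rwa [← hs', map_mul, h1, mul_one] at h3

theorem sum_comp_sq {η : MulChar F ℂ} (hη : orderOf η = 2) (hF : ringChar F ≠ 2) (φ : F → ℂ) :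
    ∑ y, φ (y ^ 2) = ∑ t, φ t * (1 + η t) := by
  classical
  have h2 : η ^ 2 = 1 := hη ▸ pow_orderOf_eq_one η
  rw [← Finset.sum_fiberwise (s := Finset.univ) (g := fun y : F => y ^ 2)]
  refine Finset.sum_congr rfl fun t _ => ?_
  rw [Finset.sum_congr rfl (g := fun _ => φ t) (by
    intro y hy; rw [(Finset.mem_filter.1 hy).2]), Finset.sum_const, nsmul_eq_mul, mul_comm]
  congr 1
  by_cases ht0 : t = 0
  · subst ht0
    have : (Finset.univ.filter fun y : F => y ^ 2 = 0) = {0} := by ext; simp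
    rw [this]; simp [MulChar.map_zero η]
  by_cases ht : IsSquare t
  · obtain ⟨s, rfl⟩ := ht
    have hs : s ≠ 0 := by rintro rfl; simp at ht0
    have : (Finset.univ.filter fun y : F => y ^ 2 = s * s) = {s, -s} := by
      ext y; simp [← pow_two, sq_eq_sq_iff_eq_or_eq_neg]
    rw [this, Finset.card_pair (fun h => hs (by
      have h' : (2 : F) * s = 0 := by linear_combination h
      exact (mul_eq_zero.1 h').resolve_left (Ring.two_ne_zero hF))), map_mul, ← pow_two,
      ← MulChar.pow_apply' η two_ne_zero, h2, MulChar.one_apply hs.isUnit]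
    norm_num
  · have : (Finset.univ.filter fun y : F => y ^ 2 = t) = ∅ := by
      ext y; simp only [Finset.mem_filter, Finset.mem_univ, true_and, Finset.notMem_empty,
          iff_false]
      rintro rfl
      exact ht (IsSquare.sq y)
    rw [this, isQuadratic_apply_nonsquare hη ht]
    simp

theorem norm_sum_quadratic_char_le {η : MulChar F ℂ} (hη : orderOf η = 2) (hF : ringChar F ≠ 2)
    {a b c : F} (ha : a ≠ 0) (hd : b ^ 2 - 4 * a * c ≠ 0) :
    ‖∑ x, η (a * x ^ 2 + b * x + c)‖ ≤ 1 := by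
  classical
  have h2F : (2 : F) ≠ 0 := Ring.two_ne_zero hF
  have h2 : η ^ 2 = 1 := hη ▸ pow_orderOf_eq_one η
  have hinv : η⁻¹ = η := by
    rw [inv_eq_iff_mul_eq_one, ← pow_two, h2]
  have hne : η ≠ 1 := by rintro rfl; simp at hη
  set d : F := (b ^ 2 - 4 * a * c) / (4 * a ^ 2) with hd_def
  have h4 : (4 : F) ≠ 0 := by
    have : (4 : F) = 2 * 2 := by norm_num
    rw [this]; exact mul_ne_zero h2F h2F
  have hd0 : d ≠ 0 := div_ne_zero hd (mul_ne_zero h4 (pow_ne_zero _ ha))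
  have e1 : ∑ x, η (a * x ^ 2 + b * x + c) = ∑ y, η (a * (y ^ 2 - d)) := by
    refine Fintype.sum_equiv (Equiv.addRight (b / (2 * a))) _ _ fun x => ?_
    congr 1
    simp only [Equiv.coe_addRight, hd_def]
    field_simp
    ring
  have e2 : ∑ y, η (a * (y ^ 2 - d)) = η a * ∑ t, η (t - d) * (1 + η t) := by
    rw [← sum_comp_sq hη hF fun t => η (t - d), Finset.mul_sum]
    simp
  have e3 : ∑ t, η (t - d) * (1 + η t) = ∑ t, η t * η (t - d) := by
    have : ∑ t, η (t - d) = 0 := by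
      rw [← MulChar.sum_eq_zero_of_ne_one hne]
      exact Fintype.sum_equiv (Equiv.subRight d) _ _ (by simp)
    simp only [mul_add, mul_one, Finset.sum_add_distrib, this, zero_add]
    simp [mul_comm]
  have e4 : ∑ t, η t * η (t - d) = η d * η (-d) * jacobiSum η η := by
    rw [jacobiSum, Finset.mul_sum]
    refine (Fintype.sum_equiv (Equiv.mulLeft₀ d hd0) _ _ fun t => ?_).symm
    change _ = η (d * t) * η (d * t - d)
    rw [show d * t - d = -d * (1 - t) by ring, map_mul η d t, map_mul η (-d)]
    ring
  have hj : jacobiSum η η = -η (-1) := by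
    have := jacobiSum_nontrivial_inv hne
    rwa [hinv] at this
  rw [e1, e2, e3, e4, hj, norm_mul, norm_mul, norm_mul, norm_neg]
  have hn : ∀ x, ‖η x‖ ≤ 1 := fun x => monoidHom_norm_le_one (η : F →* ℂ) x
  have := hn a; have := hn d; have := hn (-d); have := hn (-1)
  calc ‖η a‖ * (‖η d‖ * ‖η (-d)‖ * ‖η (-1)‖) ≤ 1 * (1 * 1 * 1) := by gcongr
    _ = 1 := by norm_num

end QuadraticCharacter

section Bilinear

variable {F : Type*} [Field F] [Fintype F] [Fintype (MulChar F ℂ)]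

/-- The function on `F` whose Fourier expansion in multiplicative characters is `u`. -/
noncomputable def evalChar (x : F) (u : MonoidAlgebra ℂ (MulChar F ℂ)) : ℂ :=
  ∑ χ, u.coeff χ * χ x

/-- `evalChar x` as an algebra homomorphism, for a unit `x`. -/
noncomputable def evalUnit (x : Fˣ) : MonoidAlgebra ℂ (MulChar F ℂ) →ₐ[ℂ] ℂ :=
  MonoidAlgebra.lift ℂ ℂ (MulChar F ℂ)
    { toFun := fun χ => χ x
      map_one' := MulChar.one_apply_coe x
      map_mul' := fun _ _ => MulChar.mul_apply _ _ _ }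

omit [Fintype F] in
theorem evalChar_unit (x : Fˣ) (u : MonoidAlgebra ℂ (MulChar F ℂ)) :
    evalChar (x : F) u = evalUnit x u := by
  rw [evalUnit, MonoidAlgebra.lift_apply, Finsupp.sum_fintype _ _ (by simp)]
  rfl

omit [Fintype F] in
theorem evalChar_zero (u : MonoidAlgebra ℂ (MulChar F ℂ)) : evalChar (0 : F) u = 0 :=
  Finset.sum_eq_zero fun χ _ => by rw [χ.map_zero, mul_zero]

omit [Fintype F] in
theorem evalChar_add (x : F) (u v : MonoidAlgebra ℂ (MulChar F ℂ)) :
    evalChar x (u + v) = evalChar x u + evalChar x v := by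
  simp [evalChar, add_mul, Finset.sum_add_distrib]

omit [Fintype F] in
theorem evalChar_smul (x : F) (r : ℂ) (u : MonoidAlgebra ℂ (MulChar F ℂ)) :
    evalChar x (r • u) = r * evalChar x u := by
  simp [evalChar, Finset.mul_sum, mul_assoc]

omit [Fintype F] in
theorem evalChar_single (x : F) (χ : MulChar F ℂ) (r : ℂ) :
    evalChar x (MonoidAlgebra.single χ r) = r * χ x := by
  classical
  rw [evalChar, Finset.sum_eq_single χ] <;> simp +contextual [eq_comm]

theorem sum_evalChar (u : MonoidAlgebra ℂ (MulChar F ℂ)) :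
    ∑ x, evalChar x u = u.coeff 1 * ((Fintype.card F : ℂ) - 1) := by
  classical
  simp only [evalChar]
  rw [Finset.sum_comm, Finset.sum_eq_single 1]
  · rw [← Finset.mul_sum, MulChar.sum_one_eq_card_units, Fintype.card_units,
      Nat.cast_sub Fintype.card_pos]
    simp
  · intro χ _ hχ
    rw [← Finset.mul_sum, MulChar.sum_eq_zero_of_ne_one hχ, mul_zero]
  · simp

variable {a b c : F} (ha : a ≠ 0) (hd : b ^ 2 - 4 * a * c ≠ 0)

include ha hd

theorem norm_sum_evalChar_comp_le {v : MonoidAlgebra ℂ (MulChar F ℂ)} (hv : v.coeff 1 = 0) :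
    ‖∑ x, evalChar (a * x ^ 2 + b * x + c) v‖ ≤ √(Fintype.card F) * l1 v := by
  simp only [evalChar]
  rw [Finset.sum_comm, l1, Finset.mul_sum]
  refine (norm_sum_le _ _).trans (Finset.sum_le_sum fun χ _ => ?_)
  rw [← Finset.mul_sum, norm_mul, mul_comm]
  by_cases h : χ = 1
  · rw [h, hv]; simp
  · gcongr
    have := (norm_sum_char_quadratic_le a b c ha hd 1 (χ : F →* ℂ) χ.map_zero
      (MulChar.sum_eq_zero_of_ne_one h)).2 rfl
    simpa using this

theorem norm_sum_evalChar_mul_le {u v : MonoidAlgebra ℂ (MulChar F ℂ)} (hv : v.coeff 1 = 0) :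
    ‖∑ x, evalChar x u * evalChar (a * x ^ 2 + b * x + c) v‖ ≤
      2 * √(Fintype.card F) * (l1 u * l1 v) := by
  have : ∑ x, evalChar x u * evalChar (a * x ^ 2 + b * x + c) v =
      ∑ χ, ∑ ψ, u.coeff χ * v.coeff ψ * ∑ x, χ x * ψ (a * x ^ 2 + b * x + c) := by
    simp only [evalChar, Finset.sum_mul_sum]
    rw [Finset.sum_comm]
    refine Finset.sum_congr rfl fun χ _ => ?_
    rw [Finset.sum_comm]
    refine Finset.sum_congr rfl fun ψ _ => ?_
    rw [Finset.mul_sum]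
    exact Finset.sum_congr rfl fun x _ => by ring
  rw [this, l1, l1, Finset.sum_mul_sum, Finset.mul_sum]
  refine (norm_sum_le _ _).trans (Finset.sum_le_sum fun χ _ => ?_)
  rw [Finset.mul_sum]
  refine (norm_sum_le _ _).trans (Finset.sum_le_sum fun ψ _ => ?_)
  rw [norm_mul, norm_mul, mul_comm]
  by_cases h : ψ = 1
  · rw [h, hv]; simp
  · gcongr
    exact (norm_sum_char_quadratic_le a b c ha hd (χ : F →* ℂ) (ψ : F →* ℂ) ψ.map_zero
      (MulChar.sum_eq_zero_of_ne_one h)).1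

omit ha hd

/-- The part of `u` away from the trivial character. -/
noncomputable def offOne (u : MonoidAlgebra ℂ (MulChar F ℂ)) : MonoidAlgebra ℂ (MulChar F ℂ) :=
  u - u.coeff 1 • 1

omit [Fintype F] [Fintype (MulChar F ℂ)] in
theorem coeff_offOne_one (u : MonoidAlgebra ℂ (MulChar F ℂ)) : (offOne u).coeff 1 = 0 := by
  simp [offOne]

omit [Fintype F] [Fintype (MulChar F ℂ)] in
theorem coeff_offOne {u : MonoidAlgebra ℂ (MulChar F ℂ)} {χ : MulChar F ℂ} (h : χ ≠ 1) :
    (offOne u).coeff χ = u.coeff χ := by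
  classical
  simp [offOne, MonoidAlgebra.one_def, h.symm]

theorem l1_offOne_add (u : MonoidAlgebra ℂ (MulChar F ℂ)) :
    l1 (offOne u) + ‖u.coeff 1‖ = l1 u := by
  classical
  rw [l1, l1, ← Finset.add_sum_erase _ _ (Finset.mem_univ 1), coeff_offOne_one, norm_zero, zero_add,
    ← Finset.add_sum_erase _ _ (Finset.mem_univ 1), add_comm]
  congr 1
  exact Finset.sum_congr rfl fun χ h => by rw [coeff_offOne (Finset.ne_of_mem_erase h)]

omit [Fintype F] in
theorem evalChar_one_of_ne_zero {x : F} (hx : x ≠ 0) :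
    evalChar x (1 : MonoidAlgebra ℂ (MulChar F ℂ)) = 1 := by
  rw [MonoidAlgebra.one_def, evalChar_single, MulChar.one_apply hx.isUnit, one_mul]

omit [Fintype F] in
theorem evalChar_offOne (u : MonoidAlgebra ℂ (MulChar F ℂ)) {x : F} (hx : x ≠ 0) :
    evalChar x (offOne u) = evalChar x u - u.coeff 1 := by
  rw [offOne, sub_eq_add_neg, ← neg_smul, evalChar_add, evalChar_smul, evalChar_one_of_ne_zero hx]
  ring

include ha hd

theorem norm_sum_evalChar_mul_sub_le [DecidableEq F] (u v : MonoidAlgebra ℂ (MulChar F ℂ)) :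
    ‖∑ x, evalChar x u * evalChar (a * x ^ 2 + b * x + c) v -
      (v.coeff 1 * (u.coeff 1 * ((Fintype.card F : ℂ) - 1) -
          ∑ x with a * x ^ 2 + b * x + c = 0, evalChar x u) +
        u.coeff 1 * (∑ x, evalChar (a * x ^ 2 + b * x + c) (offOne v) - evalChar c (offOne v)))‖ ≤
      2 * √(Fintype.card F) * (l1 (offOne u) * l1 (offOne v)) := by
  have key : ∑ x, evalChar x u * evalChar (a * x ^ 2 + b * x + c) v -
      (v.coeff 1 * (u.coeff 1 * ((Fintype.card F : ℂ) - 1) -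
          ∑ x with a * x ^ 2 + b * x + c = 0, evalChar x u) +
        u.coeff 1 * (∑ x, evalChar (a * x ^ 2 + b * x + c) (offOne v) - evalChar c (offOne v))) =
      ∑ x, evalChar x (offOne u) * evalChar (a * x ^ 2 + b * x + c) (offOne v) := by
    have hc : evalChar c (offOne v) =
        ∑ x, if x = 0 then evalChar (a * x ^ 2 + b * x + c) (offOne v) else 0 := by simp
    rw [← sum_evalChar, Finset.sum_filter, hc, ← Finset.sum_sub_distrib, ← Finset.sum_sub_distrib,
      Finset.mul_sum, Finset.mul_sum, ← Finset.sum_add_distrib, ← Finset.sum_sub_distrib]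
    refine Finset.sum_congr rfl fun x _ => ?_
    by_cases hx : x = 0
    · simp [hx, evalChar_zero]
    rw [if_neg hx, evalChar_offOne u hx]
    by_cases hf : a * x ^ 2 + b * x + c = 0
    · simp [hf, evalChar_zero]
    · rw [if_neg hf, evalChar_offOne v hf]
      ring
  rw [key]
  exact norm_sum_evalChar_mul_le ha hd (coeff_offOne_one v)

end Bilinear

section Indicators

variable {F : Type*} [Field F] [Fintype F]

theorem isPrimitiveRoot_of_mulChar_ne_one {χ : ℕ → MulChar F ℂ}
    (hχ : ∀ p ∈ (Fintype.card F - 1).primeFactors, orderOf (χ p) = p) {x : F} (hx : x ≠ 0)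
    (h : ∀ p ∈ (Fintype.card F - 1).primeFactors, χ p x ≠ 1) :
    IsPrimitiveRoot x (Fintype.card F - 1) := by
  classical
  have hn : 0 < Fintype.card F - 1 := Nat.sub_pos_of_lt Fintype.one_lt_card
  rw [IsPrimitiveRoot.iff_orderOf]
  refine orderOf_eq_of_pow_and_pow_div_prime hn (FiniteField.pow_card_sub_one_eq_one x hx)
    fun p hp hpn hpow => ?_
  have hmem : p ∈ (Fintype.card F - 1).primeFactors := Nat.mem_primeFactors.2 ⟨hp, hpn, hn.ne'⟩
  obtain ⟨g, hg⟩ := IsCyclic.exists_generator (α := Fˣ)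
  obtain ⟨k, hk⟩ := Subgroup.mem_zpowers_iff.1 (hg (Units.mk0 x hx))
  have hord : orderOf g = Fintype.card F - 1 := by
    rw [orderOf_eq_card_of_forall_mem_zpowers hg, Nat.card_eq_fintype_card, Fintype.card_units]
  obtain ⟨m, hm⟩ := hpn
  have hm0 : 0 < m := Nat.pos_of_ne_zero (by rintro rfl; omega)
  rw [hm, Nat.mul_div_cancel_left _ hp.pos] at hpow
  have h1 : g ^ (k * m) = 1 := by
    rw [zpow_mul, hk, zpow_natCast]
    exact Units.ext (by simpa using hpow)
  have h2 : (p : ℤ) ∣ k := by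
    have := orderOf_dvd_iff_zpow_eq_one.2 h1
    rw [hord, hm, Nat.cast_mul] at this
    exact Int.dvd_of_mul_dvd_mul_right (by exact_mod_cast hm0.ne') this
  obtain ⟨j, rfl⟩ := h2
  refine h p hmem ?_
  have hpow1 : χ p ^ p = 1 := by
    have := pow_orderOf_eq_one (χ p); rwa [hχ p hmem] at this
  have hx' : x = ((g ^ j : Fˣ) : F) ^ p := by
    have := congrArg Units.val hk
    rw [Units.val_mk0, mul_comm, zpow_mul, zpow_natCast] at this
    rw [← this]; push_cast; rfl
  rw [hx', map_pow, ← MulChar.pow_apply_coe, hpow1, MulChar.one_apply_coe]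

open Classical in
/-- The indicator function of the `x ≠ 0` with `χ p x ≠ 1` for all `p ∈ S`. -/
noncomputable def freeInd (χ : ℕ → MulChar F ℂ) (S : Finset ℕ) (x : F) : ℝ :=
  if x ≠ 0 ∧ ∀ p ∈ S, χ p x ≠ 1 then 1 else 0

open Classical in
/-- The indicator function of the `x` with `χ x = 1`. -/
noncomputable def oneInd (χ : MulChar F ℂ) (x : F) : ℝ := if χ x = 1 then 1 else 0

omit [Fintype F] in
theorem freeInd_nonneg (χ : ℕ → MulChar F ℂ) (S : Finset ℕ) (x : F) : 0 ≤ freeInd χ S x := by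
  rw [freeInd]; split_ifs <;> norm_num

omit [Fintype F] in
theorem freeInd_le_one (χ : ℕ → MulChar F ℂ) (S : Finset ℕ) (x : F) : freeInd χ S x ≤ 1 := by
  rw [freeInd]; split_ifs <;> norm_num

omit [Fintype F] in
theorem oneInd_nonneg (χ : MulChar F ℂ) (x : F) : 0 ≤ oneInd χ x := by
  rw [oneInd]; split_ifs <;> norm_num

omit [Fintype F] in
theorem freeInd_anti (χ : ℕ → MulChar F ℂ) {S T : Finset ℕ} (h : S ⊆ T) (x : F) :
    freeInd χ T x ≤ freeInd χ S x := by
  by_cases hT : x ≠ 0 ∧ ∀ p ∈ T, χ p x ≠ 1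
  · rw [freeInd, freeInd, if_pos hT, if_pos ⟨hT.1, fun p hp => hT.2 p (h hp)⟩]
  · rw [freeInd, if_neg hT]
    exact freeInd_nonneg _ _ _

variable [Fintype (MulChar F ℂ)]

omit [Fintype F] in
theorem evalUnit_cyclicAvg {χ : MulChar F ℂ} {p : ℕ} (hp : 0 < p) (hχ : orderOf χ = p) (x : Fˣ) :
    evalUnit x (cyclicAvg χ p) = (oneInd χ (x : F) : ℂ) := by
  have h1 : evalUnit x (cyclicAvg χ p) = (p : ℂ)⁻¹ * ∑ i ∈ Finset.range p, (χ x) ^ i := by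
    rw [cyclicAvg, map_smul, map_sum, smul_eq_mul]
    congr 1
    refine Finset.sum_congr rfl fun i _ => ?_
    rw [← evalChar_unit, evalChar_single, one_mul, MulChar.pow_apply_coe]
  have hpow : (χ x) ^ p = 1 := by
    rw [← MulChar.pow_apply_coe, ← hχ, pow_orderOf_eq_one, MulChar.one_apply_coe]
  rw [h1, oneInd]
  split_ifs with h
  · simp [h, hp.ne']
  · rw [geom_sum_eq h, hpow]; simp

variable {χ : ℕ → MulChar F ℂ}

omit [Fintype F] in
theorem evalChar_freeElt {S : Finset ℕ} (hS : ∀ p ∈ S, p.Prime)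
    (hχ : ∀ p ∈ S, orderOf (χ p) = p) (x : F) :
    evalChar x (freeElt χ S) = (freeInd χ S x : ℂ) := by
  classical
  by_cases hx : x = 0
  · simp [hx, evalChar_zero, freeInd]
  obtain ⟨u, rfl⟩ : ∃ u : Fˣ, (u : F) = x := ⟨Units.mk0 x hx, rfl⟩
  rw [evalChar_unit, freeElt, map_prod, freeInd]
  have : ∀ p ∈ S, evalUnit u (1 - cyclicAvg (χ p) p) = if χ p u = 1 then 0 else 1 := by
    intro p hp
    rw [map_sub, map_one, evalUnit_cyclicAvg (hS p hp).pos (hχ p hp), oneInd]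
    split_ifs <;> simp
  rw [Finset.prod_congr rfl this]
  split_ifs with h
  · rw [Finset.prod_congr rfl fun p hp => if_neg (h.2 p hp)]; simp
  · rw [not_and_or] at h
    obtain h | h := h
    · exact absurd hx h
    · push Not at h
      obtain ⟨p, hp, hp1⟩ := h
      rw [Finset.prod_eq_zero (i := p) hp (by simp [hp1])]; simp

theorem sum_freeInd {S : Finset ℕ} (hS : ∀ p ∈ S, p.Prime) (hχ : ∀ p ∈ S, orderOf (χ p) = p) :
    ∑ x, freeInd χ S x = (∏ p ∈ S, (1 - 1 / (p : ℝ))) * ((Fintype.card F : ℝ) - 1) := by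
  have := sum_evalChar (freeElt χ S)
  rw [coeff_freeElt_one hS hχ, Finset.sum_congr rfl fun x _ => evalChar_freeElt hS hχ x] at this
  exact_mod_cast this

/-- The sum over `p ∈ P` of the deviations of the `p`-th power indicators from their means. -/
noncomputable def devElt (χ : ℕ → MulChar F ℂ) (P : Finset ℕ) : MonoidAlgebra ℂ (MulChar F ℂ) :=
  ∑ p ∈ P, ((p : ℂ)⁻¹ • 1 - cyclicAvg (χ p) p)

omit [Fintype F] [Fintype (MulChar F ℂ)] in
/-- The function on `F` given by `devElt`. -/
noncomputable def devFun (χ : ℕ → MulChar F ℂ) (P : Finset ℕ) (x : F) : ℝ :=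
  ∑ p ∈ P, (1 / (p : ℝ) - oneInd (χ p) x)

omit [Fintype F] in
theorem l1_devElt_le {P : Finset ℕ} (hP : ∀ p ∈ P, p.Prime) :
    l1 (devElt χ P) ≤ P.card - ∑ p ∈ P, 1 / (p : ℝ) := by
  refine (l1_sum_le _ _).trans ?_
  calc _ ≤ ∑ p ∈ P, (1 - 1 / (p : ℝ)) :=
        Finset.sum_le_sum fun p hp => l1_inv_smul_sub_cyclicAvg_le (hP p hp).pos
    _ = _ := by simp

omit [Fintype F] in
theorem evalChar_freeElt_mul_devElt {E P : Finset ℕ} (hE : ∀ p ∈ E, p.Prime)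
    (hχE : ∀ p ∈ E, orderOf (χ p) = p) (hP : ∀ p ∈ P, p.Prime)
    (hχP : ∀ p ∈ P, orderOf (χ p) = p) (x : F) :
    evalChar x (freeElt χ E * devElt χ P) = ((freeInd χ E x * devFun χ P x : ℝ) : ℂ) := by
  by_cases hx : x = 0
  · simp [hx, evalChar_zero, freeInd]
  obtain ⟨u, rfl⟩ : ∃ u : Fˣ, (u : F) = x := ⟨Units.mk0 x hx, rfl⟩
  rw [evalChar_unit, map_mul, ← evalChar_unit, evalChar_freeElt hE hχE, devElt, map_sum, devFun]
  push_cast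
  congr 1
  refine Finset.sum_congr rfl fun p hp => ?_
  rw [map_sub, map_smul, map_one, evalUnit_cyclicAvg (hP p hp).pos (hχP p hp)]
  simp

omit [Fintype F] in
theorem coeff_freeElt_mul_devElt {E P : Finset ℕ} (hE : ∀ p ∈ E, p.Prime)
    (hχE : ∀ p ∈ E, orderOf (χ p) = p) (hP : ∀ p ∈ P, p.Prime)
    (hχP : ∀ p ∈ P, orderOf (χ p) = p) (hEP : Disjoint E P) :
    (freeElt χ E * devElt χ P).coeff 1 = 0 := by
  rw [devElt, Finset.mul_sum, MonoidAlgebra.coeff_sum, Finsupp.finsetSum_apply]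
  exact Finset.sum_eq_zero fun p hp => coeff_freeElt_mul_eq_zero hE hχE (hP p hp)
    (fun h => Finset.disjoint_left.1 hEP h hp) (hχP p hp) (one_pow _)

omit [Fintype F] [Fintype (MulChar F ℂ)] in
theorem weight_le {E P : Finset ℕ} (x y : F) (σ : ℝ) (hσ : σ = ∑ p ∈ P, 1 / (p : ℝ)) :
    freeInd χ E x * ((1 - 2 * σ) + devFun χ P x) * freeInd χ E y +
      freeInd χ E x * (freeInd χ E y * devFun χ P y) ≤
      freeInd χ (E ∪ P) x * freeInd χ (E ∪ P) y := by
  classical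
  by_cases hx : x ≠ 0 ∧ ∀ p ∈ E, χ p x ≠ 1
  swap
  · have : freeInd χ E x = 0 := by rw [freeInd, if_neg hx]
    rw [this]
    simpa using mul_nonneg (freeInd_nonneg χ (E ∪ P) x) (freeInd_nonneg χ (E ∪ P) y)
  by_cases hy : y ≠ 0 ∧ ∀ p ∈ E, χ p y ≠ 1
  swap
  · have : freeInd χ E y = 0 := by rw [freeInd, if_neg hy]
    rw [this]
    simpa using mul_nonneg (freeInd_nonneg χ (E ∪ P) x) (freeInd_nonneg χ (E ∪ P) y)
  have e1 : freeInd χ E x = 1 := by rw [freeInd, if_pos hx]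
  have e2 : freeInd χ E y = 1 := by rw [freeInd, if_pos hy]
  have dev : ∀ z : F, devFun χ P z = σ - ∑ p ∈ P, oneInd (χ p) z := by
    intro z; rw [devFun, Finset.sum_sub_distrib, hσ]
  have hnn : ∀ z : F, 0 ≤ ∑ p ∈ P, oneInd (χ p) z :=
    fun z => Finset.sum_nonneg fun p _ => oneInd_nonneg _ _
  have hbig : ∀ z : F, (∃ p ∈ P, χ p z = 1) → 1 ≤ ∑ p ∈ P, oneInd (χ p) z := by
    rintro z ⟨p, hp, hpz⟩
    calc (1 : ℝ) = oneInd (χ p) z := by rw [oneInd, if_pos hpz]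
      _ ≤ _ := Finset.single_le_sum (f := fun p => oneInd (χ p) z)
          (fun p _ => oneInd_nonneg (χ p) z) hp
  have hzero : ∀ z : F, (z ≠ 0 ∧ ∀ p ∈ E, χ p z ≠ 1) → (¬ ∃ p ∈ P, χ p z = 1) →
      freeInd χ (E ∪ P) z = 1 := by
    intro z hz h
    push Not at h
    rw [freeInd, if_pos]
    refine ⟨hz.1, fun p hp => ?_⟩
    rcases Finset.mem_union.1 hp with hp | hp
    · exact hz.2 p hp
    · exact h p hp
  rw [e1, e2, dev x, dev y]
  have h0 := mul_nonneg (freeInd_nonneg χ (E ∪ P) x) (freeInd_nonneg χ (E ∪ P) y)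
  by_cases hpx : ∃ p ∈ P, χ p x = 1
  · linarith [hbig x hpx, hnn y]
  by_cases hpy : ∃ p ∈ P, χ p y = 1
  · linarith [hbig y hpy, hnn x]
  rw [hzero x hx hpx, hzero y hy hpy]
  linarith [hnn x, hnn y]

end Indicators

section Sieve

variable {F : Type*} [Field F] [Fintype F]

theorem card_quadratic_fibre_le [DecidableEq F] {a : F} (ha : a ≠ 0) (b c y : F) :
    (Finset.univ.filter fun x : F => a * x ^ 2 + b * x + c = y).card ≤ 2 := by
  have hne : (Polynomial.C a * Polynomial.X ^ 2 + Polynomial.C b * Polynomial.X +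
      Polynomial.C (c - y)) ≠ 0 := by
    intro h
    have := Polynomial.natDegree_quadratic (b := b) (c := c - y) ha
    rw [h] at this
    simp at this
  have hsub : (Finset.univ.filter fun x : F => a * x ^ 2 + b * x + c = y) ⊆
      (Polynomial.C a * Polynomial.X ^ 2 + Polynomial.C b * Polynomial.X +
        Polynomial.C (c - y)).roots.toFinset := by
    intro x hx
    rw [Finset.mem_filter] at hx
    rw [Multiset.mem_toFinset, Polynomial.mem_roots hne]
    simp only [Polynomial.IsRoot.def, Polynomial.eval_add, Polynomial.eval_mul, Polynomial.eval_C,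
      Polynomial.eval_pow, Polynomial.eval_X]
    linear_combination hx.2
  calc _ ≤ _ := Finset.card_le_card hsub
    _ ≤ _ := Multiset.toFinset_card_le _
    _ ≤ _ := Polynomial.card_roots' _
    _ = 2 := Polynomial.natDegree_quadratic ha

theorem sum_comp_quadratic_le {a : F} (ha : a ≠ 0) (b c : F) {φ : F → ℝ} (hφ : ∀ x, 0 ≤ φ x) :
    ∑ x, φ (a * x ^ 2 + b * x + c) ≤ 2 * ∑ x, φ x := by
  classical
  rw [← Finset.sum_fiberwise Finset.univ (fun x : F => a * x ^ 2 + b * x + c), Finset.mul_sum]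
  refine Finset.sum_le_sum fun y _ => ?_
  have : ∑ x with a * x ^ 2 + b * x + c = y, φ (a * x ^ 2 + b * x + c) =
      ((Finset.univ.filter fun x : F => a * x ^ 2 + b * x + c = y).card : ℝ) * φ y := by
    rw [Finset.sum_congr rfl (g := fun _ => φ y), Finset.sum_const, nsmul_eq_mul]
    intro x hx
    rw [(Finset.mem_filter.1 hx).2]
  rw [this]
  exact mul_le_mul_of_nonneg_right (by exact_mod_cast card_quadratic_fibre_le ha b c y) (hφ y)

variable [Fintype (MulChar F ℂ)]

theorem l1_add_single_neg_coeff (u : MonoidAlgebra ℂ (MulChar F ℂ)) (η : MulChar F ℂ) :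
    l1 (u + MonoidAlgebra.single η (-u.coeff η)) + ‖u.coeff η‖ = l1 u := by
  classical
  rw [l1, l1, ← Finset.add_sum_erase _ _ (Finset.mem_univ η),
    ← Finset.add_sum_erase _ _ (Finset.mem_univ η), add_comm]
  congr 1
  rw [MonoidAlgebra.coeff_add, Finsupp.add_apply, MonoidAlgebra.coeff_single,
    Finsupp.single_eq_same, add_neg_cancel, norm_zero, zero_add]
  refine Finset.sum_congr rfl fun χ h => ?_
  rw [Finsupp.add_apply, Finsupp.single_eq_of_ne (Finset.ne_of_mem_erase h), add_zero]

theorem prod_one_sub_inv_pos {E : Finset ℕ} (hE : ∀ p ∈ E, p.Prime) :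
    0 < ∏ p ∈ E, (1 - 1 / (p : ℝ)) := by
  refine Finset.prod_pos fun p hp => ?_
  have : (1 : ℝ) < p := by exact_mod_cast (hE p hp).one_lt
  rw [sub_pos, div_lt_one (by linarith)]
  exact this

variable {χ : ℕ → MulChar F ℂ} {E P : Finset ℕ}

theorem l1_offOne_freeElt_le (hE : ∀ p ∈ E, p.Prime) (hχ : ∀ p ∈ E, orderOf (χ p) = p) :
    l1 (offOne (freeElt χ E)) ≤ (∏ p ∈ E, (1 - 1 / (p : ℝ))) * (2 ^ E.card - 1) := by
  have h := l1_offOne_add (freeElt χ E)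
  rw [coeff_freeElt_one hE hχ, Complex.norm_real,
    Real.norm_of_nonneg (prod_one_sub_inv_pos hE).le] at h
  linarith [l1_freeElt_le (χ := χ) hE]

variable {a b c : F} (ha : a ≠ 0) (hd : b ^ 2 - 4 * a * c ≠ 0)

include ha hd

theorem norm_sum_evalChar_freeElt_le (hE : ∀ p ∈ E, p.Prime) (hχ : ∀ p ∈ E, orderOf (χ p) = p)
    {t : ℝ} (ht : t = 0 ∨ t = 1 ∧ 2 ∈ E ∧ ringChar F ≠ 2) :
    ‖∑ x, evalChar (a * x ^ 2 + b * x + c) (offOne (freeElt χ E))‖ ≤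
      (∏ p ∈ E, (1 - 1 / (p : ℝ))) *
        ((2 ^ E.card - 1) * √(Fintype.card F) - t * (√(Fintype.card F) - 1)) := by
  have hl := l1_offOne_freeElt_le hE hχ
  have hm := prod_one_sub_inv_pos hE
  set m := ∏ p ∈ E, (1 - 1 / (p : ℝ)) with hmdef
  have hR := Real.sqrt_nonneg (Fintype.card F : ℝ)
  rcases ht with rfl | ⟨rfl, h2, hF⟩
  · refine (norm_sum_evalChar_comp_le ha hd (coeff_offOne_one _)).trans ?_
    calc _ ≤ √(Fintype.card F) * (m * (2 ^ E.card - 1)) := by gcongr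
      _ = _ := by ring
  set η := χ 2
  have hη : orderOf η = 2 := hχ 2 h2
  have hη1 : η ≠ 1 := by intro h; rw [h, orderOf_one] at hη; omega
  set u := offOne (freeElt χ E) with hu
  have hcoef : u.coeff η = -(m : ℂ) := by
    rw [hu, coeff_offOne hη1, coeff_freeElt_two hE hχ h2]
  have hsplit := l1_add_single_neg_coeff u η
  rw [hcoef, norm_neg, Complex.norm_real, Real.norm_of_nonneg hm.le, neg_neg] at hsplit
  have h1 : ∀ x, evalChar (a * x ^ 2 + b * x + c) u =
      evalChar (a * x ^ 2 + b * x + c) (u + MonoidAlgebra.single η (m : ℂ)) -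
        m * η (a * x ^ 2 + b * x + c) := by
    intro x; rw [evalChar_add, evalChar_single]; ring
  rw [Finset.sum_congr rfl fun x _ => h1 x, Finset.sum_sub_distrib, ← Finset.mul_sum]
  have h3 : (u + MonoidAlgebra.single η (m : ℂ)).coeff 1 = 0 := by
    rw [MonoidAlgebra.coeff_add, Finsupp.add_apply, MonoidAlgebra.coeff_single,
      Finsupp.single_eq_of_ne hη1.symm, add_zero, hu, coeff_offOne_one]
  have h4 := norm_sum_evalChar_comp_le ha hd h3
  have h5 : ‖(m : ℂ) * ∑ x, η (a * x ^ 2 + b * x + c)‖ ≤ m * 1 := by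
    rw [norm_mul, Complex.norm_real, Real.norm_of_nonneg hm.le]
    gcongr
    exact norm_sum_quadratic_char_le hη hF ha hd
  refine (norm_sub_le _ _).trans ((add_le_add h4 h5).trans ?_)
  have : l1 (u + MonoidAlgebra.single η (m : ℂ)) ≤ m * (2 ^ E.card - 1) - m := by linarith
  calc _ ≤ √(Fintype.card F) * (m * (2 ^ E.card - 1) - m) + m * 1 := by gcongr
    _ = _ := by ring

omit ha hd

omit [Fintype F] in
theorem l1_freeElt_mul_devElt_le (hE : ∀ p ∈ E, p.Prime) (hP : ∀ p ∈ P, p.Prime) :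
    l1 (freeElt χ E * devElt χ P) ≤
      (P.card - ∑ p ∈ P, 1 / (p : ℝ)) * (∏ p ∈ E, (1 - 1 / (p : ℝ))) * 2 ^ E.card := by
  refine (l1_mul_le _ _).trans ?_
  calc _ ≤ ((∏ p ∈ E, (1 - 1 / (p : ℝ))) * 2 ^ E.card) * (P.card - ∑ p ∈ P, 1 / (p : ℝ)) :=
        mul_le_mul (l1_freeElt_le hE) (l1_devElt_le hP) (l1_nonneg _)
          (mul_nonneg (prod_one_sub_inv_pos hE).le (by positivity))
    _ = _ := by ring

omit [Fintype F] [Fintype (MulChar F ℂ)] in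
theorem offOne_of_coeff_one_eq_zero {u : MonoidAlgebra ℂ (MulChar F ℂ)} (h : u.coeff 1 = 0) :
    offOne u = u := by
  rw [offOne, h, zero_smul, sub_zero]

omit [Fintype F] [Fintype (MulChar F ℂ)] in
theorem devFun_le (x : F) : devFun χ P x ≤ ∑ p ∈ P, 1 / (p : ℝ) := by
  refine Finset.sum_le_sum fun p _ => ?_
  linarith [oneInd_nonneg (χ p) x]

end Sieve

section SieveSum

variable {F : Type*} [Field F] [Fintype F] [Fintype (MulChar F ℂ)]
  {χ : ℕ → MulChar F ℂ} {E P : Finset ℕ}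
  {a b c : F} (ha : a ≠ 0) (hd : b ^ 2 - 4 * a * c ≠ 0)

include ha hd

theorem sum_freeInd_mul_ge (hE : ∀ p ∈ E, p.Prime) (hχE : ∀ p ∈ E, orderOf (χ p) = p)
    (hP : ∀ p ∈ P, p.Prime) (hχP : ∀ p ∈ P, orderOf (χ p) = p) (hEP : Disjoint E P)
    {t : ℝ} (ht : t = 0 ∨ t = 1 ∧ 2 ∈ E ∧ ringChar F ≠ 2) {σ m R w f : ℝ}
    (hσ : σ = ∑ p ∈ P, 1 / (p : ℝ)) (hm : m = ∏ p ∈ E, (1 - 1 / (p : ℝ)))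
    (hR : R = √(Fintype.card F)) (hw : w = 2 ^ E.card) (hf : f = P.card - σ)
    (hδ : 0 ≤ 1 - 2 * σ) :
    m ^ 2 * ((1 - 2 * σ) * (R ^ 2 - 1) - (1 - 2 * σ) * ((w - 1 - t) * R + t) - f * w * R -
        2 * R * (w - 1) * ((w - 1) * (1 - 2 * σ) + 2 * f * w)) - 3 * (1 - σ) * m ≤
      ∑ x, freeInd χ (E ∪ P) x * freeInd χ (E ∪ P) (a * x ^ 2 + b * x + c) := by
  classical
  have hm0 : 0 < m := hm ▸ prod_one_sub_inv_pos hE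
  have hm1 : m ≤ 1 := by
    rw [hm]
    refine Finset.prod_le_one (fun p hp => ?_) fun p _ => ?_
    · have : (1 : ℝ) < p := by exact_mod_cast (hE p hp).one_lt
      rw [sub_nonneg, div_le_one (by linarith)]; exact this.le
    · have : 0 ≤ 1 / (p : ℝ) := by positivity
      linarith
  have hR0 : 0 ≤ R := hR ▸ Real.sqrt_nonneg _
  have hR2 : R ^ 2 = (Fintype.card F : ℝ) := by rw [hR, Real.sq_sqrt (by positivity)]
  have hw1 : 1 ≤ w := by rw [hw]; exact one_le_pow₀ (by norm_num)
  have hσ0 : 0 ≤ σ := by rw [hσ]; positivity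
  have hf0 : 0 ≤ f := by
    rw [hf, hσ]
    exact (l1_nonneg (devElt χ P)).trans (l1_devElt_le hP)
  set h := freeElt χ E with hh
  set k := h * devElt χ P with hk
  set δ := 1 - 2 * σ with hδdef
  set u := (δ : ℂ) • h + k with hu
  have hh1 : h.coeff 1 = (m : ℂ) := by rw [hh, coeff_freeElt_one hE hχE, hm]
  have hk1 : k.coeff 1 = 0 := coeff_freeElt_mul_devElt hE hχE hP hχP hEP
  have hu1 : u.coeff 1 = ((δ * m : ℝ) : ℂ) := by
    rw [hu, MonoidAlgebra.coeff_add, Finsupp.add_apply, MonoidAlgebra.coeff_smul_apply, hh1, hk1]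
    simp
  have hlh : l1 (offOne h) ≤ m * (w - 1) := by rw [hm, hw]; exact l1_offOne_freeElt_le hE hχE
  have hlk : l1 k ≤ f * m * w := by rw [hf, hσ, hm, hw]; exact l1_freeElt_mul_devElt_le hE hP
  have hlu : l1 (offOne u) ≤ δ * (m * (w - 1)) + f * m * w := by
    have : offOne u = (δ : ℂ) • offOne h + k := by
      rw [offOne, offOne, hu1, hh1, hu, smul_sub, smul_smul]
      push_cast
      abel
    rw [this]
    refine (l1_add_le _ _).trans ?_
    rw [l1_smul, Complex.norm_real, Real.norm_of_nonneg hδ]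
    gcongr
  have evh : ∀ x, evalChar x h = ((freeInd χ E x : ℝ) : ℂ) := fun x => evalChar_freeElt hE hχE x
  have evk : ∀ x, evalChar x k = ((freeInd χ E x * devFun χ P x : ℝ) : ℂ) :=
    fun x => evalChar_freeElt_mul_devElt hE hχE hP hχP x
  have evu : ∀ x, evalChar x u = ((freeInd χ E x * (δ + devFun χ P x) : ℝ) : ℂ) := by
    intro x
    rw [hu, evalChar_add, evalChar_smul, evh, evk]
    push_cast; ring
  have kh := norm_sum_evalChar_mul_sub_le ha hd u h
  have kk := norm_sum_evalChar_mul_sub_le ha hd h k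
  have hTh := norm_sum_evalChar_freeElt_le ha hd hE hχE ht
  rw [← hm, ← hw, ← hR, ← hh] at hTh
  have hTk := norm_sum_evalChar_comp_le ha hd hk1
  rw [← hR] at kh kk hTk
  rw [offOne_of_coeff_one_eq_zero hk1, hh1, hk1, zero_mul, zero_add] at kk
  rw [hh1, hu1] at kh
  set Th := ∑ x, evalChar (a * x ^ 2 + b * x + c) (offOne h)
  set Tk := ∑ x, evalChar (a * x ^ 2 + b * x + c) k
  have hTh' := (Complex.abs_re_le_norm Th).trans hTh
  have hTk' := (Complex.abs_re_le_norm Tk).trans hTk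
  have hhc : (evalChar c (offOne h)).re ≤ 1 := by
    by_cases hc : c = 0
    · rw [hc, evalChar_zero]; simp
    · rw [evalChar_offOne h hc, evh, hh1, Complex.sub_re, Complex.ofReal_re, Complex.ofReal_re]
      linarith [freeInd_le_one χ E c]
  have hkc : (evalChar c k).re ≤ σ := by
    rw [evk, Complex.ofReal_re]
    have h1 : devFun χ P c ≤ σ := hσ ▸ devFun_le c
    rcases le_total 0 (devFun χ P c) with h2 | h2
    · exact (mul_le_of_le_one_left h2 (freeInd_le_one χ E c)).trans h1
    · exact (mul_nonpos_of_nonneg_of_nonpos (freeInd_nonneg χ E c) h2).trans hσ0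
  have hG : ∑ x with a * x ^ 2 + b * x + c = 0, freeInd χ E x * (δ + devFun χ P x) ≤
      2 * (1 - σ) := by
    have hle : ∀ x ∈ Finset.univ.filter (fun x : F => a * x ^ 2 + b * x + c = 0),
        freeInd χ E x * (δ + devFun χ P x) ≤ 1 - σ := by
      intro x _
      have h1 : δ + devFun χ P x ≤ 1 - σ := by
        have : devFun χ P x ≤ σ := hσ ▸ devFun_le x
        linarith
      rcases le_total 0 (δ + devFun χ P x) with h2 | h2
      · exact (mul_le_of_le_one_left h2 (freeInd_le_one χ E x)).trans h1
      · exact (mul_nonpos_of_nonneg_of_nonpos (freeInd_nonneg χ E x) h2).trans (by linarith)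
    refine (Finset.sum_le_card_nsmul _ _ _ hle).trans ?_
    rw [nsmul_eq_mul]
    have := card_quadratic_fibre_le ha b c 0
    have : (((Finset.univ.filter fun x : F => a * x ^ 2 + b * x + c = 0).card : ℕ) : ℝ) ≤ 2 := by
      exact_mod_cast this
    exact mul_le_mul_of_nonneg_right this (by linarith)
  set G := ∑ x with a * x ^ 2 + b * x + c = 0, freeInd χ E x * (δ + devFun χ P x)
  have hGc : ∑ x with a * x ^ 2 + b * x + c = 0, evalChar x u = (G : ℂ) := by
    rw [Finset.sum_congr rfl fun x _ => evu x, ← Complex.ofReal_sum]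
  set S₁ := ∑ x, freeInd χ E x * (δ + devFun χ P x) * freeInd χ E (a * x ^ 2 + b * x + c)
  set S₂ := ∑ x, freeInd χ E x *
    (freeInd χ E (a * x ^ 2 + b * x + c) * devFun χ P (a * x ^ 2 + b * x + c))
  have hS₁ : ∑ x, evalChar x u * evalChar (a * x ^ 2 + b * x + c) h = (S₁ : ℂ) := by
    rw [Finset.sum_congr rfl fun x _ => by rw [evu, evh, ← Complex.ofReal_mul],
      ← Complex.ofReal_sum]
  have hS₂ : ∑ x, evalChar x h * evalChar (a * x ^ 2 + b * x + c) k = (S₂ : ℂ) := by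
    rw [Finset.sum_congr rfl fun x _ => by rw [evh, evk, ← Complex.ofReal_mul],
      ← Complex.ofReal_sum]
  rw [hS₁, hGc] at kh
  rw [hS₂] at kk
  have kh' := (abs_le.1 ((Complex.abs_re_le_norm _).trans kh)).1
  have kk' := (abs_le.1 ((Complex.abs_re_le_norm _).trans kk)).1
  have card_cast : ((Fintype.card F : ℂ)) = ((R ^ 2 : ℝ) : ℂ) := by rw [hR2]; simp
  rw [card_cast] at kh'
  simp only [Complex.sub_re, Complex.add_re, Complex.re_ofReal_mul, Complex.ofReal_re,
    Complex.one_re] at kh' kk'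
  have hTh2 := (abs_le.1 hTh').1
  have hTk2 := (abs_le.1 hTk').1
  have b1 : 2 * R * (l1 (offOne u) * l1 (offOne h)) ≤
      2 * R * ((δ * (m * (w - 1)) + f * m * w) * (m * (w - 1))) := by
    have := l1_nonneg (offOne h)
    have := l1_nonneg (offOne u)
    gcongr
  have b2 : 2 * R * (l1 (offOne h) * l1 k) ≤ 2 * R * ((m * (w - 1)) * (f * m * w)) := by
    have := l1_nonneg k
    have := l1_nonneg (offOne h)
    have := mul_nonneg hm0.le (sub_nonneg.2 hw1)
    gcongr
  have b3 : R * l1 k ≤ R * (f * m * w) := by gcongr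
  have hsum : S₁ + S₂ ≤
      ∑ x, freeInd χ (E ∪ P) x * freeInd χ (E ∪ P) (a * x ^ 2 + b * x + c) := by
    rw [← Finset.sum_add_distrib]
    exact Finset.sum_le_sum fun x _ => weight_le x _ σ hσ
  have c1 : m * G ≤ m * (2 * (1 - σ)) := by gcongr
  have hδm : 0 ≤ δ * m := mul_nonneg hδ hm0.le
  have c2 : δ * m * (evalChar c (offOne h)).re ≤ δ * m * 1 := by gcongr
  have c3 : m * (evalChar c k).re ≤ m * σ := by gcongr
  have c4 : δ * m * (-(m * ((w - 1) * R - t * (R - 1)))) ≤ δ * m * Th.re := by gcongr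
  have c5 : m * -(R * (f * m * w)) ≤ m * Tk.re := by
    exact mul_le_mul_of_nonneg_left (by linarith) hm0.le
  refine le_trans ?_ hsum
  linarith

end SieveSum

/-- The main term minus the error terms in the modified prime sieve, divided by `m² = μ⁻²`. -/
def sieveMain (w s t μ σ ε R : ℝ) : ℝ :=
  (1 - 2 * σ) * (R ^ 2 - 1) - 3 * (1 - σ) * μ - (1 - 2 * σ) * ((w - 1 - t) * R + t) -
    (s - σ) * w * R - 2 * R * (w - 1) * ((w - 1) * (1 - 2 * σ) + 2 * (s - σ) * w) -
    3 * ε * μ * (R ^ 2 - 1)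

section SieveCriterion

variable {F : Type*} [Field F] [Fintype F]

theorem exists_isPrimitiveRoot_of_sieveMain_pos {a b c : F} (ha : a ≠ 0)
    (hd : b ^ 2 - 4 * a * c ≠ 0) {E P L : Finset ℕ}
    (hU : E ∪ P ∪ L = (Fintype.card F - 1).primeFactors)
    (hEP : Disjoint E P) (hEPL : Disjoint (E ∪ P) L) {t ε : ℝ}
    (ht : t = 0 ∨ t = 1 ∧ 2 ∈ E ∧ ringChar F ≠ 2)
    (hδ : 0 ≤ 1 - 2 * ∑ p ∈ P, 1 / (p : ℝ))
    (hε : (∏ p ∈ P, (1 - 1 / (p : ℝ))) * (1 - ∏ p ∈ L, (1 - 1 / (p : ℝ))) ≤ ε)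
    (hpos : 0 < sieveMain (2 ^ E.card) P.card t (∏ p ∈ E, (1 - 1 / (p : ℝ)))⁻¹
      (∑ p ∈ P, 1 / (p : ℝ)) ε √(Fintype.card F)) :
    ∃ g : F, IsPrimitiveRoot g (Fintype.card F - 1) ∧
      IsPrimitiveRoot (a * g ^ 2 + b * g + c) (Fintype.card F - 1) := by
  classical
  have : Fintype (MulChar F ℂ) := Fintype.ofFinite _
  have hn : 0 < Fintype.card F - 1 := Nat.sub_pos_of_lt Fintype.one_lt_card
  have hprime : ∀ p ∈ (Fintype.card F - 1).primeFactors, p.Prime :=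
    fun p hp => Nat.prime_of_mem_primeFactors hp
  have hex : ∀ p : ℕ, ∃ ψ : MulChar F ℂ, p ∈ (Fintype.card F - 1).primeFactors → orderOf ψ = p := by
    intro p
    by_cases hp : p ∈ (Fintype.card F - 1).primeFactors
    · obtain ⟨ψ, hψ⟩ := MulChar.exists_mulChar_orderOf F (Nat.dvd_of_mem_primeFactors hp)
        (Complex.isPrimitiveRoot_exp p (hprime p hp).ne_zero)
      exact ⟨ψ, fun _ => hψ⟩
    · exact ⟨1, fun h => absurd h hp⟩
  choose χ hχ using hex
  have hEU : ∀ p ∈ E, p ∈ (Fintype.card F - 1).primeFactors := fun p hp => by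
    rw [← hU]; simp [hp]
  have hPU : ∀ p ∈ P, p ∈ (Fintype.card F - 1).primeFactors := fun p hp => by
    rw [← hU]; simp [hp]
  have hEPU : ∀ p ∈ E ∪ P, p ∈ (Fintype.card F - 1).primeFactors := fun p hp => by
    rw [← hU]; exact Finset.mem_union_left _ hp
  have hallU : ∀ p ∈ E ∪ P ∪ L, p ∈ (Fintype.card F - 1).primeFactors := fun p hp => hU ▸ hp
  set m := ∏ p ∈ E, (1 - 1 / (p : ℝ)) with hm
  set σ := ∑ p ∈ P, 1 / (p : ℝ) with hσ
  set R := √(Fintype.card F : ℝ) with hR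
  have hm0 : 0 < m := prod_one_sub_inv_pos fun p hp => hprime p (hEU p hp)
  have hR2 : R ^ 2 = (Fintype.card F : ℝ) := by rw [hR, Real.sq_sqrt (by positivity)]
  have hR1 : 0 ≤ R ^ 2 - 1 := by
    rw [hR2, sub_nonneg]; exact_mod_cast Fintype.card_pos
  have main := sum_freeInd_mul_ge (χ := χ) ha hd (fun p hp => hprime p (hEU p hp))
    (fun p hp => hχ p (hEU p hp)) (fun p hp => hprime p (hPU p hp))
    (fun p hp => hχ p (hPU p hp)) hEP ht hσ hm hR rfl rfl hδ
  set f : F → F := fun x => a * x ^ 2 + b * x + c with hf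
  set H₁ := freeInd χ (E ∪ P) with hH₁
  set H₂ := freeInd χ (E ∪ P ∪ L) with hH₂
  have hanti : ∀ x, H₂ x ≤ H₁ x := freeInd_anti χ Finset.subset_union_left
  have hdiff : ∑ x, (H₁ x - H₂ x) =
      m * ((∏ p ∈ P, (1 - 1 / (p : ℝ))) * (1 - ∏ p ∈ L, (1 - 1 / (p : ℝ)))) * (R ^ 2 - 1) := by
    rw [Finset.sum_sub_distrib, hH₁, hH₂,
      sum_freeInd (fun p hp => hprime p (hEPU p hp)) fun p hp => hχ p (hEPU p hp),
      sum_freeInd (fun p hp => hprime p (hallU p hp)) fun p hp => hχ p (hallU p hp),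
      Finset.prod_union hEPL, Finset.prod_union hEP, hR2]
    ring
  have hdiff' : ∑ x, (H₁ x - H₂ x) ≤ m * ε * (R ^ 2 - 1) := by
    rw [hdiff]; gcongr
  have hcomp : ∑ x, (H₁ (f x) - H₂ (f x)) ≤ 2 * ∑ x, (H₁ x - H₂ x) :=
    sum_comp_quadratic_le ha b c (φ := fun x => H₁ x - H₂ x) fun x => sub_nonneg.2 (hanti x)
  have hsum : ∑ x, H₁ x * H₁ (f x) - ∑ x, (H₁ x - H₂ x) - ∑ x, (H₁ (f x) - H₂ (f x)) ≤
      ∑ x, H₂ x * H₂ (f x) := by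
    rw [← Finset.sum_sub_distrib, ← Finset.sum_sub_distrib]
    refine Finset.sum_le_sum fun x _ => ?_
    have h1 : H₁ x * (H₁ (f x) - H₂ (f x)) ≤ H₁ (f x) - H₂ (f x) :=
      mul_le_of_le_one_left (sub_nonneg.2 (hanti _)) (freeInd_le_one _ _ _)
    have h2 : (H₁ x - H₂ x) * H₂ (f x) ≤ H₁ x - H₂ x :=
      mul_le_of_le_one_right (sub_nonneg.2 (hanti _)) (freeInd_le_one _ _ _)
    linarith
  have hid : m ^ 2 * sieveMain (2 ^ E.card) P.card t m⁻¹ σ ε R =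
      m ^ 2 * ((1 - 2 * σ) * (R ^ 2 - 1) - (1 - 2 * σ) * ((2 ^ E.card - 1 - t) * R + t) -
        (P.card - σ) * 2 ^ E.card * R - 2 * R * (2 ^ E.card - 1) *
          ((2 ^ E.card - 1) * (1 - 2 * σ) + 2 * (P.card - σ) * 2 ^ E.card)) -
        3 * (1 - σ) * m - 3 * (m * ε * (R ^ 2 - 1)) := by
    rw [sieveMain]
    field_simp
    ring
  have hpos' : 0 < ∑ x, H₂ x * H₂ (f x) := by
    have := mul_pos (pow_pos hm0 2) hpos
    rw [hid] at this
    linarith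
  obtain ⟨g, -, hg⟩ := Finset.exists_lt_of_sum_lt (f := fun _ => (0 : ℝ))
    (by simpa using hpos' : ∑ _x : F, (0 : ℝ) < ∑ x, H₂ x * H₂ (f x))
  have prim : ∀ x, H₂ x ≠ 0 → IsPrimitiveRoot x (Fintype.card F - 1) := by
    intro x hx
    by_cases h : x ≠ 0 ∧ ∀ p ∈ E ∪ P ∪ L, χ p x ≠ 1
    · exact isPrimitiveRoot_of_mulChar_ne_one hχ h.1 (by rw [← hU]; exact h.2)
    · exact absurd (by rw [hH₂, freeInd, if_neg h]) hx
  exact ⟨g, prim g (left_ne_zero_of_mul hg.ne'), prim (f g) (right_ne_zero_of_mul hg.ne')⟩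

end SieveCriterion

section Monotonicity

theorem sieveMain_pos_of_le_sqrt {w s t μ σ ε R R' : ℝ} (ht : 0 ≤ t) (htw : 1 + t ≤ w) (hμ : 0 ≤ μ)
    (hσ2 : 2 * σ ≤ 1) (hσs : σ ≤ s) (hR' : 1 ≤ R') (hR : R' ≤ R)
    (h : 0 < sieveMain w s t μ σ ε R') : 0 < sieveMain w s t μ σ ε R := by
  rw [sieveMain] at h ⊢
  set δ := 1 - 2 * σ with hδ
  have hδ0 : 0 ≤ δ := by linarith
  set f := s - σ
  have hf : 0 ≤ f := sub_nonneg.2 hσs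
  obtain ⟨B, hB⟩ : ∃ B, B = δ * (w - 1 - t) + f * w + 2 * (w - 1) * ((w - 1) * δ + 2 * f * w) :=
    ⟨_, rfl⟩
  obtain ⟨C, hC⟩ : ∃ C, C = 3 * (1 - σ) * μ + δ * t := ⟨_, rfl⟩
  obtain ⟨α, hα⟩ : ∃ α, α = δ - 3 * ε * μ := ⟨_, rfl⟩
  have hw1 : 0 ≤ w - 1 := by linarith
  have hB0 : 0 ≤ B := by
    have h1 : 0 ≤ δ * (w - 1 - t) := mul_nonneg hδ0 (by linarith)
    have h2 : 0 ≤ f * w := mul_nonneg hf (by linarith)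
    have h3 : 0 ≤ 2 * (w - 1) * ((w - 1) * δ + 2 * f * w) := by
      have := mul_nonneg hw1 hδ0
      have h5 : 0 ≤ (w - 1) * δ + 2 * f * w := by linarith
      positivity
    linarith
  have hC0 : 0 ≤ C := by
    have h1 : 0 ≤ 3 * (1 - σ) * μ := mul_nonneg (by linarith) hμ
    have h2 : 0 ≤ δ * t := mul_nonneg hδ0 ht
    linarith
  have e : ∀ r : ℝ, δ * (r ^ 2 - 1) - 3 * (1 - σ) * μ - δ * ((w - 1 - t) * r + t) - f * w * r -
      2 * r * (w - 1) * ((w - 1) * δ + 2 * f * w) - 3 * ε * μ * (r ^ 2 - 1) =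
      α * (r ^ 2 - 1) - B * r - C := by
    intro r; rw [hα, hB, hC]; ring
  rw [e] at h ⊢
  have hsq : 0 ≤ R' ^ 2 - 1 := by nlinarith
  have hBR : 0 ≤ B * R' := by positivity
  have hα0 : 0 < α := by
    by_contra hcon
    push Not at hcon
    have := mul_nonpos_of_nonpos_of_nonneg hcon hsq
    linarith
  have h1 : B < α * R' := by
    have : B * R' < α * R' * R' := by nlinarith
    exact lt_of_mul_lt_mul_right this (by linarith)
  have h2 : 0 ≤ (R - R') * (α * (R + R') - B) := by
    apply mul_nonneg (by linarith)
    nlinarith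
  nlinarith

theorem sieveMain_pos_mono {w s t μ μ' σ σ' ε ε' R R' : ℝ} (ht : 0 ≤ t) (htw : 1 + t ≤ w)
    (hμ0 : 0 ≤ μ) (hμ : μ ≤ μ') (hμw : μ ≤ w) (hσ : σ ≤ σ') (hσ2 : 2 * σ' ≤ 1) (hσs : σ' ≤ s)
    (hε0 : 0 ≤ ε) (hε : ε ≤ ε') (hR' : 4 * w ^ 2 ≤ R') (hR : R' ≤ R)
    (h : 0 < sieveMain w s t μ' σ' ε' R') : 0 < sieveMain w s t μ σ ε R := by
  have hw : 1 ≤ w := by linarith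
  have hw2 : w ≤ w ^ 2 := by nlinarith
  have hR1 : 1 ≤ R' := by linarith
  have h1 := sieveMain_pos_of_le_sqrt ht htw (hμ0.trans hμ) hσ2 hσs hR1 hR h
  have hsq : 0 ≤ R ^ 2 - 1 := by nlinarith
  have h2 : 0 < sieveMain w s t μ σ' ε R := by
    refine h1.trans_le ?_
    rw [sieveMain, sieveMain]
    have a1 : 3 * (1 - σ') * μ ≤ 3 * (1 - σ') * μ' :=
      mul_le_mul_of_nonneg_left hμ (by linarith)
    have a2 : 3 * ε * μ * (R ^ 2 - 1) ≤ 3 * ε' * μ' * (R ^ 2 - 1) := by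
      have := hμ0.trans hμ
      have := hε0.trans hε
      gcongr
    linarith
  refine h2.trans_le ?_
  rw [sieveMain, sieveMain]
  have hR4 : 4 * w ^ 2 ≤ R := hR'.trans hR
  have k1 : 4 * w ^ 2 * R ≤ R * R := mul_le_mul_of_nonneg_right hR4 (by linarith)
  have k2 : w * 1 ≤ w * R := mul_le_mul_of_nonneg_left (by linarith) (by linarith)
  have k3 : 0 ≤ t * (R - 1) := mul_nonneg ht (by linarith)
  have k4 : 4 ≤ R := by nlinarith
  have k5 : (w - 1) * 4 ≤ (w - 1) * R := mul_le_mul_of_nonneg_left k4 (by linarith)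
  have key : 0 ≤ 2 * (R ^ 2 - 1) - 3 * μ - 2 * ((w - 1 - t) * R + t) - w * R -
      4 * R * (w - 1) * (2 * w - 1) := by
    nlinarith
  have := mul_nonneg (sub_nonneg.2 hσ) key
  linarith

end Monotonicity

section Lists

/-- The product of a list of natural numbers. -/
def listProd : List ℕ → ℕ
  | [] => 1
  | p :: l => p * listProd l

/-- The product of `p - 1` over the members of a list. -/
def predProd : List ℕ → ℕ
  | [] => 1
  | p :: l => (p - 1) * predProd l

/-- The numerator of the sum of the reciprocals of a list over the denominator `listProd`. -/
def invNum : List ℕ → ℕ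
  | [] => 0
  | p :: l => p * invNum l + listProd l

/-- The sum of the reciprocals of the members of a list. -/
noncomputable def recipSum (l : List ℕ) : ℝ := (l.map fun p : ℕ => 1 / (p : ℝ)).sum

/-- The product of `1 - 1 / p` over the members of a list. -/
noncomputable def density (l : List ℕ) : ℝ := (l.map fun p : ℕ => 1 - 1 / (p : ℝ)).prod

theorem recipSum_cons (p : ℕ) (l : List ℕ) : recipSum (p :: l) = 1 / (p : ℝ) + recipSum l := by
  simp [recipSum]

theorem density_cons (p : ℕ) (l : List ℕ) : density (p :: l) = (1 - 1 / (p : ℝ)) * density l := by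
  simp [density]

theorem recipSum_nil : recipSum [] = 0 := rfl

theorem density_nil : density [] = 1 := rfl

theorem recipSum_append (l l' : List ℕ) : recipSum (l ++ l') = recipSum l + recipSum l' := by
  simp [recipSum]

theorem density_append (l l' : List ℕ) : density (l ++ l') = density l * density l' := by
  simp [density]

theorem recipSum_nonneg (l : List ℕ) : 0 ≤ recipSum l := by
  induction l with
  | nil => exact le_rfl
  | cons p l ih => rw [recipSum_cons]; positivity

theorem listProd_pos {l : List ℕ} (h : ∀ p ∈ l, 2 ≤ p) : 0 < listProd l := by
  induction l with
  | nil => exact one_pos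
  | cons p l ih =>
    rw [List.forall_mem_cons] at h
    exact Nat.mul_pos (by omega) (ih h.2)

theorem predProd_pos {l : List ℕ} (h : ∀ p ∈ l, 2 ≤ p) : 0 < predProd l := by
  induction l with
  | nil => exact one_pos
  | cons p l ih =>
    rw [List.forall_mem_cons] at h
    exact Nat.mul_pos (by omega) (ih h.2)

theorem predProd_le_listProd (l : List ℕ) : predProd l ≤ listProd l := by
  induction l with
  | nil => exact le_rfl
  | cons p l ih => exact Nat.mul_le_mul (Nat.sub_le _ _) ih

theorem recipSum_eq {l : List ℕ} (h : ∀ p ∈ l, 2 ≤ p) :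
    recipSum l = (invNum l : ℝ) / listProd l := by
  induction l with
  | nil => simp [recipSum_nil, invNum]
  | cons p l ih =>
    rw [List.forall_mem_cons] at h
    have h1 : (p : ℝ) ≠ 0 := by exact_mod_cast (by omega : p ≠ 0)
    have h2 : (listProd l : ℝ) ≠ 0 := by exact_mod_cast (listProd_pos h.2).ne'
    rw [recipSum_cons, ih h.2, invNum, listProd]
    push_cast
    field_simp
    ring

theorem density_eq {l : List ℕ} (h : ∀ p ∈ l, 2 ≤ p) :
    density l = (predProd l : ℝ) / listProd l := by
  induction l with
  | nil => simp [density_nil, predProd, listProd]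
  | cons p l ih =>
    rw [List.forall_mem_cons] at h
    have h1 : (p : ℝ) ≠ 0 := by exact_mod_cast (by omega : p ≠ 0)
    have h2 : (listProd l : ℝ) ≠ 0 := by exact_mod_cast (listProd_pos h.2).ne'
    rw [density_cons, ih h.2, predProd, listProd]
    push_cast [Nat.cast_sub (by omega : 1 ≤ p)]
    field_simp

theorem density_pos {l : List ℕ} (h : ∀ p ∈ l, 2 ≤ p) : 0 < density l := by
  rw [density_eq h]
  have := listProd_pos h
  have := predProd_pos h
  positivity

theorem density_le_one {l : List ℕ} (h : ∀ p ∈ l, 2 ≤ p) : density l ≤ 1 := by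
  rw [density_eq h]
  exact div_le_one_of_le₀ (by exact_mod_cast predProd_le_listProd l) (by positivity)

theorem one_sub_recipSum_le_density {l : List ℕ} (h : ∀ p ∈ l, 2 ≤ p) :
    1 - recipSum l ≤ density l := by
  induction l with
  | nil => simp [recipSum_nil, density_nil]
  | cons p l ih =>
    rw [List.forall_mem_cons] at h
    have h1 := ih h.2
    have h2 := density_le_one h.2
    have h3 : 0 ≤ 1 / (p : ℝ) := by positivity
    rw [recipSum_cons, density_cons]
    nlinarith

theorem inv_density_le {l : List ℕ} (h : ∀ p ∈ l, 2 ≤ p) : (density l)⁻¹ ≤ 2 ^ l.length := by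
  rw [inv_le_comm₀ (density_pos h) (by positivity)]
  induction l with
  | nil => simp [density_nil]
  | cons p l ih =>
    rw [List.forall_mem_cons] at h
    have h1 := ih h.2
    have h2 : 1 / (p : ℝ) ≤ 1 / 2 :=
      one_div_le_one_div_of_le (by norm_num) (by exact_mod_cast h.1)
    rw [density_cons, List.length_cons, pow_succ, mul_inv, mul_comm]
    exact mul_le_mul (by linarith) h1 (by positivity) (by linarith)

theorem recipSum_le_length (l : List ℕ) : recipSum l ≤ l.length := by
  induction l with
  | nil => simp [recipSum_nil]
  | cons p l ih =>
    rw [recipSum_cons, List.length_cons]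
    push_cast
    have : 1 / (p : ℝ) ≤ 1 := by
      rw [one_div]; exact Nat.cast_inv_le_one p
    linarith

theorem recipSum_anti {l l' : List ℕ} (h : List.Forall₂ (· ≤ ·) l l') (hl : ∀ p ∈ l, 2 ≤ p) :
    recipSum l' ≤ recipSum l := by
  induction h with
  | nil => exact le_rfl
  | cons hp _ ih =>
    rw [List.forall_mem_cons] at hl
    rw [recipSum_cons, recipSum_cons]
    refine add_le_add (one_div_le_one_div_of_le ?_ (by exact_mod_cast hp)) (ih hl.2)
    exact_mod_cast (by omega : 0 < _)

theorem density_mono {l l' : List ℕ} (h : List.Forall₂ (· ≤ ·) l l') (hl : ∀ p ∈ l, 2 ≤ p) :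
    density l ≤ density l' := by
  induction h with
  | nil => exact le_rfl
  | @cons p p' l l' hp h ih =>
    rw [List.forall_mem_cons] at hl
    rw [density_cons, density_cons]
    have h0 : (0 : ℝ) < p := by exact_mod_cast (by omega : 0 < p)
    have h1 : 1 / (p' : ℝ) ≤ 1 / (p : ℝ) := one_div_le_one_div_of_le h0 (by exact_mod_cast hp)
    have h2 : 1 / (p : ℝ) ≤ 1 := by rw [one_div]; exact Nat.cast_inv_le_one p
    exact mul_le_mul (by linarith) (ih hl.2) (density_pos hl.2).le (by linarith)

theorem listProd_mono {l l' : List ℕ} (h : List.Forall₂ (· ≤ ·) l l') :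
    listProd l ≤ listProd l' := by
  induction h with
  | nil => exact le_rfl
  | cons hp _ ih => exact Nat.mul_le_mul hp ih

theorem listProd_append (l l' : List ℕ) : listProd (l ++ l') = listProd l * listProd l' := by
  induction l with
  | nil => simp [listProd]
  | cons p l ih => rw [List.cons_append, listProd, ih, listProd, mul_assoc]

theorem two_le_of_forall₂ {l l' : List ℕ} (h : List.Forall₂ (· ≤ ·) l l') (hl : ∀ p ∈ l, 2 ≤ p) :
    ∀ p ∈ l', 2 ≤ p := by
  induction h with
  | nil => simp
  | cons hp _ ih =>
    rw [List.forall_mem_cons] at hl ⊢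
    exact ⟨hl.1.trans hp, ih hl.2⟩

end Lists

section Checks

/-- An exact test for `0 < sieveMain w s t (A / B) (S / Q) (N / Z) √q` and `16 w⁴ ≤ q`. -/
def sieveCheck (t w s A B Q S N Z q : ℕ) : Bool :=
  (16 * w ^ 4).ble q && (1 + t).ble w && (2 * S).ble Q &&
    (3 * (Q - S) * A * Z + 3 * N * A * (q - 1) * Q + 1).ble ((Q - 2 * S) * (q - 1 - t) * B * Z) &&
    ((((Q - 2 * S) * (w - 1 - t) + (s * Q - S) * w +
        2 * (w - 1) * ((w - 1) * (Q - 2 * S) + 2 * (s * Q - S) * w)) * B * Z) ^ 2 * q + 1).ble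
      (((Q - 2 * S) * (q - 1 - t) * B * Z -
        (3 * (Q - S) * A * Z + 3 * N * A * (q - 1) * Q)) ^ 2)

theorem sieveMain_pos_of_sieveCheck {t w s A B Q S N Z q : ℕ} (hB : 0 < B) (hQ : 0 < Q)
    (hZ : 0 < Z) (hS : S ≤ s * Q) (h : sieveCheck t w s A B Q S N Z q = true) :
    16 * w ^ 4 ≤ q ∧ 1 + t ≤ w ∧ 2 * S ≤ Q ∧
      0 < sieveMain w s t ((A : ℝ) / B) ((S : ℝ) / Q) ((N : ℝ) / Z) √q := by
  simp only [sieveCheck, Bool.and_eq_true, Nat.ble_eq] at h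
  obtain ⟨⟨⟨⟨h1, h2⟩, h3⟩, h4⟩, h5⟩ := h
  refine ⟨h1, h2, h3, ?_⟩
  have hw4 : w ≤ w ^ 4 := Nat.le_self_pow (by norm_num) w
  have hqt : t + 1 ≤ q := by omega
  obtain ⟨y, hy⟩ := Nat.exists_eq_add_of_le' h3
  obtain ⟨z, hz⟩ := Nat.exists_eq_add_of_le' hS
  obtain ⟨v, hv⟩ := Nat.exists_eq_add_of_le' h2
  obtain ⟨n, hn⟩ := Nat.exists_eq_add_of_le' hqt
  have e1 : Q - 2 * S = y := by omega
  have e2 : Q - S = y + S := by omega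
  have e3 : s * Q - S = z := by omega
  have e4 : w - 1 - t = v := by omega
  have e5 : w - 1 = v + t := by omega
  have e6 : q - 1 - t = n := by omega
  have e7 : q - 1 = n + t := by omega
  rw [e1, e2, e6, e7] at h4
  rw [e1, e2, e3, e4, e5, e6, e7] at h5
  obtain ⟨u, hu⟩ := Nat.exists_eq_add_of_le' (show
    3 * (y + S) * A * Z + 3 * N * A * (n + t) * Q ≤ y * n * B * Z by omega)
  rw [hu, Nat.add_sub_cancel] at h5
  have hQ' : (0 : ℝ) < Q := by exact_mod_cast hQ
  have hB' : (0 : ℝ) < B := by exact_mod_cast hB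
  have hZ' : (0 : ℝ) < Z := by exact_mod_cast hZ
  have hr : √(q : ℝ) ^ 2 = q := Real.sq_sqrt (by positivity)
  have hr0 := Real.sqrt_nonneg (q : ℝ)
  have hyR : (Q : ℝ) = y + 2 * S := by exact_mod_cast hy
  have hzR : (s : ℝ) * Q = z + S := by exact_mod_cast hz
  have hvR : (w : ℝ) = v + (1 + t) := by exact_mod_cast hv
  have hnR : (q : ℝ) = n + (t + 1) := by exact_mod_cast hn
  have huR : (y : ℝ) * n * B * Z = u + (3 * (y + S) * A * Z + 3 * N * A * (n + t) * Q) := by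
    exact_mod_cast hu
  have h5R : (((y : ℝ) * v + z * w + 2 * (v + t) * ((v + t) * y + 2 * z * w)) * B * Z) ^ 2 * q <
      u ^ 2 := by exact_mod_cast h5
  set r := √(q : ℝ)
  set K : ℝ := ((y : ℝ) * v + z * w + 2 * (v + t) * ((v + t) * y + 2 * z * w)) * B * Z with hK
  have hlt : K * r < u := by
    refine lt_of_pow_lt_pow_left₀ 2 (by positivity) ?_
    rw [mul_pow, hr]; exact h5R
  have key : sieveMain w s t ((A : ℝ) / B) ((S : ℝ) / Q) ((N : ℝ) / Z) r * (Q * B * Z) =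
      u - K * r := by
    have hs : (s : ℝ) = (z + S) / Q := by rw [← hzR]; field_simp
    rw [sieveMain, hr, hnR, hs]
    have : (u : ℝ) = y * n * B * Z - (3 * (y + S) * A * Z + 3 * N * A * (n + t) * Q) := by
      linarith
    rw [this, hK]
    field_simp
    rw [hyR, hvR]
    ring
  have hpos : 0 < sieveMain w s t ((A : ℝ) / B) ((S : ℝ) / Q) ((N : ℝ) / Z) r * (Q * B * Z) := by
    rw [key]; linarith
  exact pos_of_mul_pos_left hpos (by positivity)

/-- Some splitting of the list `T` into consecutive parts makes the sieve succeed. -/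
def Sieved (t : ℕ) (T : List ℕ) (q : ℕ) : Prop :=
  ∃ E P L : List ℕ, E ++ P ++ L = T ∧ 1 + t ≤ 2 ^ E.length ∧ 0 ≤ 1 - 2 * recipSum P ∧
    ∃ ε, density P * (1 - density L) ≤ ε ∧
      0 < sieveMain (2 ^ E.length) P.length t (density E)⁻¹ (recipSum P) ε √q

theorem sieved_of_sieveCheck {t q q₀ : ℕ} {E P L E₀ P₀ : List ℕ} {N Z : ℕ}
    (hE : List.Forall₂ (· ≤ ·) E₀ E) (hP : List.Forall₂ (· ≤ ·) P₀ P)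
    (hE₀ : ∀ p ∈ E₀, 2 ≤ p) (hP₀ : ∀ p ∈ P₀, 2 ≤ p) (hL : ∀ p ∈ L, 2 ≤ p) (hZ : 0 < Z)
    (hε : density P * (1 - density L) ≤ (N : ℝ) / Z) (hq : q₀ ≤ q)
    (h : sieveCheck t (2 ^ E₀.length) P₀.length (listProd E₀) (predProd E₀) (listProd P₀)
      (invNum P₀) N Z q₀ = true) : Sieved t (E ++ P ++ L) q := by
  have hQ := listProd_pos hP₀
  have hQ' : (0 : ℝ) < listProd P₀ := by exact_mod_cast hQ
  have hS : invNum P₀ ≤ P₀.length * listProd P₀ := by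
    have := recipSum_le_length P₀
    rw [recipSum_eq hP₀, div_le_iff₀ hQ'] at this
    exact_mod_cast this
  obtain ⟨h1, h2, h3, h4⟩ := sieveMain_pos_of_sieveCheck (predProd_pos hE₀) hQ hZ hS h
  have hE' := two_le_of_forall₂ hE hE₀
  have hP' := two_le_of_forall₂ hP hP₀
  have hμ : (listProd E₀ : ℝ) / predProd E₀ = (density E₀)⁻¹ := by
    rw [density_eq hE₀, inv_div]
  rw [hμ, ← recipSum_eq hP₀] at h4
  have hσ2 : 2 * recipSum P₀ ≤ 1 := by
    rw [recipSum_eq hP₀, ← mul_div_assoc, div_le_one hQ']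
    exact_mod_cast h3
  have hσ := recipSum_anti hP hP₀
  refine ⟨E, P, L, rfl, by rwa [← hE.length_eq], by linarith,
    density P * (1 - density L), le_rfl, ?_⟩
  rw [← hE.length_eq, ← hP.length_eq]
  push_cast at h4
  refine sieveMain_pos_mono (R' := √q₀) (Nat.cast_nonneg t) (by exact_mod_cast h2)
    (inv_pos.2 (density_pos hE')).le (inv_anti₀ (density_pos hE₀) (density_mono hE hE₀)) ?_ hσ hσ2
    (recipSum_le_length P₀) ?_ hε ?_ (Real.sqrt_le_sqrt (by exact_mod_cast hq)) h4
  · rw [hE.length_eq]; exact inv_density_le hE'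
  · exact mul_nonneg (density_pos hP').le (sub_nonneg.2 (density_le_one hL))
  · refine Real.le_sqrt_of_sq_le ?_
    have : ((16 * (2 ^ E₀.length) ^ 4 : ℕ) : ℝ) ≤ q₀ := by exact_mod_cast h1
    push_cast at this
    linarith

/-- The numerator of `∏_P (1 - 1/p) (1 - ∏_L (1 - 1/l))` over the denominator `∏_P p ∏_L l`. -/
def excessNum (P L : List ℕ) : ℕ := predProd P * (listProd L - predProd L)

/-- Test whether one of the splittings in `pats` makes the sieve succeed, with `ε` given by
the numerator `num` and the denominator `den`. -/
def splitCheck (num den : List ℕ → List ℕ → ℕ) (t : ℕ) (l : List ℕ) (q : ℕ) : List (ℕ × ℕ) → Bool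
  | [] => false
  | (i, j) :: pats =>
    sieveCheck t (2 ^ (l.take i).length) ((l.drop i).take j).length (listProd (l.take i))
      (predProd (l.take i)) (listProd ((l.drop i).take j)) (invNum ((l.drop i).take j))
      (num ((l.drop i).take j) ((l.drop i).drop j))
      (den ((l.drop i).take j) ((l.drop i).drop j)) q ||
    splitCheck num den t l q pats

theorem sieved_of_splitCheck {num den : List ℕ → List ℕ → ℕ} {t q q₀ : ℕ} {l T : List ℕ}
    {pats : List (ℕ × ℕ)} (hlT : List.Forall₂ (· ≤ ·) l T) (hl : ∀ p ∈ l, 2 ≤ p)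
    (hε : ∀ P₀ L₀ P L, List.Forall₂ (· ≤ ·) P₀ P → List.Forall₂ (· ≤ ·) L₀ L →
      (∀ i j, (P = (T.drop i).take j → L = (T.drop i).drop j →
        P₀ = (l.drop i).take j → L₀ = (l.drop i).drop j → 0 < den P₀ L₀ ∧
      density P * (1 - density L) ≤ (num P₀ L₀ : ℝ) / den P₀ L₀)))
    (hq : q₀ ≤ q) (h : splitCheck num den t l q₀ pats = true) : Sieved t T q := by
  induction pats with
  | nil => simp [splitCheck] at h
  | cons ij pats ih =>
    obtain ⟨i, j⟩ := ij
    rw [splitCheck, Bool.or_eq_true] at h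
    rcases h with h | h
    · have hT : T.take i ++ (T.drop i).take j ++ (T.drop i).drop j = T := by
        rw [List.append_assoc, List.take_append_drop, List.take_append_drop]
      have hP := List.forall₂_take j (List.forall₂_drop i hlT)
      have hL := List.forall₂_drop j (List.forall₂_drop i hlT)
      have hT2 := two_le_of_forall₂ hlT hl
      obtain ⟨e1, e2⟩ := hε _ _ _ _ hP hL i j rfl rfl rfl rfl
      rw [← hT]
      exact sieved_of_sieveCheck (List.forall₂_take i hlT) hP
        (fun p hp => hl p (List.mem_of_mem_take hp))
        (fun p hp => hl p (List.mem_of_mem_drop (List.mem_of_mem_take hp)))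
        (fun p hp => hT2 p (List.mem_of_mem_drop (List.mem_of_mem_drop hp))) e1 e2 hq h
    · exact ih h

/-- The sieve test for every list dominating `l`. -/
def critSum (t : ℕ) (l : List ℕ) (pats : List (ℕ × ℕ)) : Bool :=
  splitCheck (fun _ L => invNum L) (fun _ L => listProd L) t l (listProd l + 1) pats

/-- The sieve test for the list `l` itself, when the field has at least `q` elements. -/
def critProd (t : ℕ) (l : List ℕ) (q : ℕ) (pats : List (ℕ × ℕ)) : Bool :=
  splitCheck excessNum (fun P L => listProd P * listProd L) t l q pats

theorem sieved_of_critSum {t q : ℕ} {l T : List ℕ} {pats : List (ℕ × ℕ)}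
    (hlT : List.Forall₂ (· ≤ ·) l T) (hl : ∀ p ∈ l, 2 ≤ p) (hq : listProd T + 1 ≤ q)
    (h : critSum t l pats = true) : Sieved t T q := by
  have hT2 := two_le_of_forall₂ hlT hl
  refine sieved_of_splitCheck hlT hl ?_ ((Nat.succ_le_succ (listProd_mono hlT)).trans hq) h
  rintro P₀ L₀ P L hP hL i j rfl rfl rfl rfl
  have hL₀ : ∀ p ∈ (l.drop i).drop j, 2 ≤ p :=
    fun p hp => hl p (List.mem_of_mem_drop (List.mem_of_mem_drop hp))
  have hL' := two_le_of_forall₂ hL hL₀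
  have hP' : ∀ p ∈ (T.drop i).take j, 2 ≤ p :=
    fun p hp => hT2 p (List.mem_of_mem_drop (List.mem_of_mem_take hp))
  refine ⟨listProd_pos hL₀, ?_⟩
  rw [← recipSum_eq hL₀]
  have h1 := one_sub_recipSum_le_density hL'
  have h2 := recipSum_anti hL hL₀
  have h3 := density_le_one hL'
  exact (mul_le_of_le_one_left (by linarith) (density_le_one hP')).trans (by linarith)

theorem sieved_of_critProd {t q q₀ : ℕ} {T : List ℕ} {pats : List (ℕ × ℕ)}
    (hT : ∀ p ∈ T, 2 ≤ p) (hq : q₀ ≤ q) (h : critProd t T q₀ pats = true) : Sieved t T q := by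
  refine sieved_of_splitCheck (List.forall₂_refl T) hT ?_ hq h
  rintro P₀ L₀ P L - - i j rfl rfl rfl rfl
  have hL : ∀ p ∈ (T.drop i).drop j, 2 ≤ p :=
    fun p hp => hT p (List.mem_of_mem_drop (List.mem_of_mem_drop hp))
  have hP : ∀ p ∈ (T.drop i).take j, 2 ≤ p :=
    fun p hp => hT p (List.mem_of_mem_drop (List.mem_of_mem_take hp))
  refine ⟨Nat.mul_pos (listProd_pos hP) (listProd_pos hL), le_of_eq ?_⟩
  have h1 : (listProd ((T.drop i).drop j) : ℝ) ≠ 0 := by exact_mod_cast (listProd_pos hL).ne'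
  have h2 : (listProd ((T.drop i).take j) : ℝ) ≠ 0 := by exact_mod_cast (listProd_pos hP).ne'
  rw [density_eq hP, density_eq hL, excessNum]
  push_cast [Nat.cast_sub (predProd_le_listProd ((T.drop i).drop j))]
  field_simp

end Checks

section Leaves

/-- A weak form, for lists of primes, of the hypotheses of the modified prime sieve. -/
def Admissible (E P L : List ℕ) (q : ℕ) : Prop :=
  2 * recipSum L < density E ^ 2 * (1 - 2 * recipSum P) ∧
    density E ^ 2 * (2 * P.length - 1 + 2 * (1 - 2 * recipSum P)) *
        (2 * (2 ^ E.length) ^ 2 - 3 * 2 ^ E.length) + (1 - 2 * recipSum P) + L.length -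
        recipSum L <
      √q * (density E ^ 2 * (1 - 2 * recipSum P) - 2 * recipSum L)

/-- The lower bound for `q` which follows from `Admissible E P L q`. -/
def hypBound (E P L : List ℕ) : ℕ :=
  (predProd E ^ 2 * ((2 * P.length - 1) * listProd P + 2 * (listProd P - 2 * invNum P)) *
          listProd L * (2 * (2 ^ E.length) ^ 2) +
        listProd E ^ 2 * ((listProd P - 2 * invNum P) * listProd L +
          L.length * listProd P * listProd L) -
      (predProd E ^ 2 * ((2 * P.length - 1) * listProd P + 2 * (listProd P - 2 * invNum P)) *
          listProd L * (3 * 2 ^ E.length) + listProd E ^ 2 * (invNum L * listProd P))) ^ 2 /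
    (predProd E ^ 2 * (listProd P - 2 * invNum P) * listProd L -
      2 * invNum L * listProd E ^ 2 * listProd P) ^ 2 + 1

/-- A test which excludes `Admissible E P L q` for every `q`. -/
def vacuous (E P L : List ℕ) : Bool :=
  (predProd E ^ 2 * (listProd P - 2 * invNum P) * listProd L).ble
    (2 * invNum L * listProd E ^ 2 * listProd P)

theorem vacuous_eq_false {E P L : List ℕ} (hE : ∀ p ∈ E, 2 ≤ p) (hP : ∀ p ∈ P, 2 ≤ p)
    (hL : ∀ p ∈ L, 2 ≤ p) (h : 2 * recipSum L < density E ^ 2 * (1 - 2 * recipSum P)) :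
    vacuous E P L = false := by
  rw [vacuous, ← Bool.not_eq_true, Nat.ble_eq, not_le]
  have hA : (0 : ℝ) < listProd E := by exact_mod_cast listProd_pos hE
  have hQ : (0 : ℝ) < listProd P := by exact_mod_cast listProd_pos hP
  have hZ : (0 : ℝ) < listProd L := by exact_mod_cast listProd_pos hL
  have h0 : 0 < 1 - 2 * recipSum P := by
    have : 0 < density E ^ 2 * (1 - 2 * recipSum P) :=
      (mul_nonneg zero_le_two (recipSum_nonneg L)).trans_lt h
    exact pos_of_mul_pos_right this (sq_nonneg _)
  rw [recipSum_eq hP] at h0 h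
  rw [recipSum_eq hL, density_eq hE] at h
  have h1 : 2 * invNum P ≤ listProd P := by
    have : 0 < (1 - 2 * ((invNum P : ℝ) / listProd P)) * listProd P := mul_pos h0 hQ
    field_simp at this
    have : 2 * (invNum P : ℝ) ≤ listProd P := by linarith
    exact_mod_cast this
  have h2 := mul_lt_mul_of_pos_right h
    (show 0 < (listProd E : ℝ) ^ 2 * listProd P * listProd L by positivity)
  have e1 : 2 * ((invNum L : ℝ) / listProd L) * (listProd E ^ 2 * listProd P * listProd L) =
      2 * invNum L * listProd E ^ 2 * listProd P := by field_simp
  have e2 : ((predProd E : ℝ) / listProd E) ^ 2 * (1 - 2 * ((invNum P : ℝ) / listProd P)) *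
      (listProd E ^ 2 * listProd P * listProd L) =
      predProd E ^ 2 * (listProd P - 2 * invNum P) * listProd L := by field_simp
  rw [e1, e2] at h2
  have h3 : ((listProd P - 2 * invNum P : ℕ) : ℝ) = listProd P - 2 * invNum P := by
    push_cast [Nat.cast_sub h1]; ring
  rw [← h3] at h2
  exact_mod_cast h2

theorem hypBound_le {E P L : List ℕ} {q : ℕ} (hE : ∀ p ∈ E, 2 ≤ p) (hP : ∀ p ∈ P, 2 ≤ p)
    (hL : ∀ p ∈ L, 2 ≤ p) (hs : P ≠ []) (hq : 0 < q) (h : Admissible E P L q) :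
    hypBound E P L ≤ q := by
  have hv := vacuous_eq_false hE hP hL h.1
  rw [vacuous, ← Bool.not_eq_true, Nat.ble_eq, not_le] at hv
  obtain ⟨-, h⟩ := h
  rw [hypBound]
  have hA : (0 : ℝ) < listProd E := by exact_mod_cast listProd_pos hE
  have hQ : (0 : ℝ) < listProd P := by exact_mod_cast listProd_pos hP
  have hZ : (0 : ℝ) < listProd L := by exact_mod_cast listProd_pos hL
  have h1 : 2 * invNum P ≤ listProd P := by
    by_contra hcon
    rw [Nat.sub_eq_zero_of_le (by omega)] at hv
    simp at hv
  obtain ⟨d, hd⟩ := Nat.exists_eq_add_of_le' h1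
  have e1 : listProd P - 2 * invNum P = d := by omega
  obtain ⟨k, hk⟩ := Nat.exists_eq_add_of_le' (List.length_pos_of_ne_nil hs)
  have e2 : 2 * P.length - 1 = 2 * k + 1 := by omega
  rw [e1] at hv ⊢
  rw [e2]
  obtain ⟨D, hD⟩ := Nat.exists_eq_add_of_lt hv
  have e3 : predProd E ^ 2 * d * listProd L - 2 * invNum L * listProd E ^ 2 * listProd P =
    D + 1 := by omega
  rw [e3]
  refine Nat.succ_le_of_lt ((Nat.div_lt_iff_lt_mul (by positivity)).2 ?_)
  obtain ⟨U, hU⟩ : ∃ U, U = predProd E ^ 2 * ((2 * k + 1) * listProd P + 2 * d) * listProd L *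
      (2 * (2 ^ E.length) ^ 2) + listProd E ^ 2 * (d * listProd L +
        L.length * listProd P * listProd L) := ⟨_, rfl⟩
  obtain ⟨V, hV⟩ : ∃ V, V = predProd E ^ 2 * ((2 * k + 1) * listProd P + 2 * d) * listProd L *
      (3 * 2 ^ E.length) + listProd E ^ 2 * (invNum L * listProd P) := ⟨_, rfl⟩
  rw [← hU, ← hV]
  rcases le_total U V with hUV | hUV
  · rw [Nat.sub_eq_zero_of_le hUV]; positivity
  have hdR : (listProd P : ℝ) = d + 2 * invNum P := by exact_mod_cast hd
  have hDR : (predProd E : ℝ) ^ 2 * d * listProd L = 2 * invNum L * listProd E ^ 2 * listProd P +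
    D + 1 := by exact_mod_cast hD
  have hδ : 1 - 2 * ((invNum P : ℝ) / listProd P) = d / listProd P := by
    field_simp; linarith
  rw [recipSum_eq hP, recipSum_eq hL, density_eq hE, hδ, hk] at h
  have h2 := mul_lt_mul_of_pos_right h
    (show 0 < (listProd E : ℝ) ^ 2 * listProd P * listProd L by positivity)
  have e4 : (((predProd E : ℝ) / listProd E) ^ 2 * (2 * ((k + 1 : ℕ) : ℝ) - 1 +
      2 * (d / listProd P)) * (2 * (2 ^ E.length) ^ 2 - 3 * 2 ^ E.length) + d / listProd P +
      L.length - invNum L / listProd L) * (listProd E ^ 2 * listProd P * listProd L) =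
      (U : ℝ) - V := by
    rw [hU, hV]; push_cast; field_simp; ring
  have e5 : √(q : ℝ) * (((predProd E : ℝ) / listProd E) ^ 2 * (d / listProd P) -
      2 * (invNum L / listProd L)) * (listProd E ^ 2 * listProd P * listProd L) =
      √q * (D + 1) := by
    have : (D : ℝ) + 1 = predProd E ^ 2 * d * listProd L -
      2 * invNum L * listProd E ^ 2 * listProd P := by linarith
    rw [this]; field_simp
  rw [e4, e5] at h2
  have h3 : ((U - V : ℕ) : ℝ) < √q * (D + 1) := by rwa [Nat.cast_sub hUV]
  have h4 := pow_lt_pow_left₀ h3 (by positivity) two_ne_zero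
  rw [mul_pow, Real.sq_sqrt (by positivity)] at h4
  exact_mod_cast h4

/-- Test `fin` at the lower bounds for `q` coming from all the ways in which the members of a list
can be distributed over `E`, `P` and `L`. -/
def leafCheck (fin : ℕ → Bool) : List ℕ → List ℕ → List ℕ → List ℕ → Bool
  | [], E, P, L => vacuous E P L || P.isEmpty || L.isEmpty || fin (hypBound E P L)
  | p :: T, E, P, L => vacuous E P L ||
      (leafCheck fin T (p :: E) P L && leafCheck fin T E (p :: P) L && leafCheck fin T E P (p :: L))

theorem two_mul_recipSum_lt_of_append {E P L E' P' L' : List ℕ} (hE : ∀ p ∈ E ++ E', 2 ≤ p)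
    (h : 2 * recipSum (L ++ L') < density (E ++ E') ^ 2 * (1 - 2 * recipSum (P ++ P'))) :
    2 * recipSum L' < density E' ^ 2 * (1 - 2 * recipSum P') := by
  simp only [List.mem_append] at hE
  rw [recipSum_append, recipSum_append, density_append] at h
  have h1 := recipSum_nonneg L
  have h1' := recipSum_nonneg L'
  have h2 := recipSum_nonneg P
  have h3 := density_pos fun p hp => hE p (Or.inl hp)
  have h4 := density_pos fun p hp => hE p (Or.inr hp)
  have h5 := density_le_one fun p hp => hE p (Or.inl hp)
  have h6 : 0 < 1 - 2 * (recipSum P + recipSum P') := by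
    refine pos_of_mul_pos_right (a := (density E * density E') ^ 2) ?_ (sq_nonneg _)
    linarith
  have h7 : (density E * density E') ^ 2 ≤ density E' ^ 2 :=
    pow_le_pow_left₀ (by positivity) (mul_le_of_le_one_left h4.le h5) 2
  have h8 := mul_le_mul_of_nonneg_right h7 h6.le
  have h9 : density E' ^ 2 * (1 - 2 * (recipSum P + recipSum P')) ≤
    density E' ^ 2 * (1 - 2 * recipSum P') := mul_le_mul_of_nonneg_left (by linarith) (by
        positivity)
  linarith

theorem leafCheck_apply {fin : ℕ → Bool} {f : ℕ → ℕ} {T E P L : List ℕ}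
    (hT : ∀ p ∈ T, 2 ≤ p ∧ (f p = 0 ∨ f p = 1 ∨ f p = 2)) (hE : ∀ p ∈ E, 2 ≤ p)
    (hP : ∀ p ∈ P, 2 ≤ p) (hL : ∀ p ∈ L, 2 ≤ p) (h : leafCheck fin T E P L = true)
    (hP' : (T.filter (f · = 1)).reverse ++ P ≠ []) (hL' : (T.filter (f · = 2)).reverse ++ L ≠ [])
    (hv : 2 * recipSum ((T.filter (f · = 2)).reverse ++ L) <
      density ((T.filter (f · = 0)).reverse ++ E) ^ 2 *
        (1 - 2 * recipSum ((T.filter (f · = 1)).reverse ++ P))) :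
    fin (hypBound ((T.filter (f · = 0)).reverse ++ E) ((T.filter (f · = 1)).reverse ++ P)
      ((T.filter (f · = 2)).reverse ++ L)) = true := by
  have hEE : ∀ p ∈ (T.filter (f · = 0)).reverse ++ E, 2 ≤ p := by
    intro p hp
    rw [List.mem_append, List.mem_reverse] at hp
    exact hp.elim (fun hp => (hT p (List.mem_of_mem_filter hp)).1) (hE p)
  have h0 := vacuous_eq_false hE hP hL (two_mul_recipSum_lt_of_append hEE hv)
  induction T generalizing E P L with
  | nil =>
    simp only [leafCheck, h0, Bool.false_or, Bool.or_eq_true, List.isEmpty_iff] at h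
    simp only [List.filter_nil, List.reverse_nil, List.nil_append] at hP' hL' ⊢
    tauto
  | cons p T ih =>
    simp only [leafCheck, h0, Bool.false_or, Bool.and_eq_true] at h
    rw [List.forall_mem_cons] at hT
    obtain ⟨⟨hp, hf⟩, hT⟩ := hT
    have key : ∀ E P L : List ℕ, (∀ p ∈ E, 2 ≤ p) → (∀ p ∈ P, 2 ≤ p) → (∀ p ∈ L, 2 ≤ p) →
        leafCheck fin T E P L = true → (T.filter (f · = 1)).reverse ++ P ≠ [] →
        (T.filter (f · = 2)).reverse ++ L ≠ [] →
        2 * recipSum ((T.filter (f · = 2)).reverse ++ L) <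
          density ((T.filter (f · = 0)).reverse ++ E) ^ 2 *
            (1 - 2 * recipSum ((T.filter (f · = 1)).reverse ++ P)) →
        fin (hypBound ((T.filter (f · = 0)).reverse ++ E) ((T.filter (f · = 1)).reverse ++ P)
          ((T.filter (f · = 2)).reverse ++ L)) = true := by
      intro E P L hE hP hL h hP' hL' hv
      have hEE : ∀ p ∈ (T.filter (f · = 0)).reverse ++ E, 2 ≤ p := by
        intro p hp
        rw [List.mem_append, List.mem_reverse] at hp
        exact hp.elim (fun hp => (hT p (List.mem_of_mem_filter hp)).1) (hE p)
      exact ih hT hE hP hL h hP' hL' hv hEE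
        (vacuous_eq_false hE hP hL (two_mul_recipSum_lt_of_append hEE hv))
    rcases hf with hf | hf | hf <;>
    · simp only [List.filter_cons, hf, decide_true, decide_false, if_true, List.reverse_cons,
        List.append_assoc, List.singleton_append, zero_ne_one, one_ne_zero, OfNat.ofNat_ne_zero,
        OfNat.zero_ne_ofNat, OfNat.one_ne_ofNat, OfNat.ofNat_ne_one, Bool.false_eq_true,
        if_false] at hP' hL' hv ⊢
      refine key _ _ _ ?_ ?_ ?_ ?_ hP' hL' hv <;>
      first
        | exact h.1.1 | exact h.1.2 | exact h.2 | assumption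
        | exact List.forall_mem_cons.2 ⟨hp, by assumption⟩

/-- The sieve test for the list `T` itself, at the least `q` allowed by the hypotheses. -/
def leafTest (t : ℕ) (nxt : ℕ → ℕ → ℕ) (pats : List (ℕ × ℕ)) (T : List ℕ) : Bool :=
  leafCheck (fun b => critProd t T (nxt (listProd T) b) pats) T [] [] []

theorem sieved_of_leafTest {t q : ℕ} {nxt : ℕ → ℕ → ℕ} {pats : List (ℕ × ℕ)} {T : List ℕ}
    {f : ℕ → ℕ} (hT : ∀ p ∈ T, 2 ≤ p ∧ (f p = 0 ∨ f p = 1 ∨ f p = 2)) (hq : 0 < q)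
    (hnxt : ∀ b ≤ q, nxt (listProd T) b ≤ q)
    (hP : T.filter (f · = 1) ≠ []) (hL : T.filter (f · = 2) ≠ [])
    (hadm : Admissible (T.filter (f · = 0)).reverse (T.filter (f · = 1)).reverse
      (T.filter (f · = 2)).reverse q) (h : leafTest t nxt pats T = true) : Sieved t T q := by
  have hmem : ∀ i, ∀ p ∈ (T.filter (f · = i)).reverse, 2 ≤ p := fun i p hp =>
    (hT p (List.mem_of_mem_filter (List.mem_reverse.1 hp))).1
  have h1 := leafCheck_apply hT (by simp) (by simp) (by simp) h (by simpa using hP)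
    (by simpa using hL) (by simpa using hadm.1)
  simp only [List.append_nil] at h1
  exact sieved_of_critProd (fun p hp => (hT p hp).1)
    (hnxt _ (hypBound_le (hmem 0) (hmem 1) (hmem 2) (by simpa using hP) hq hadm)) h1

end Leaves

section Trees

/-- The sieve test for all the increasing lists which extend `pre` by `k` entries, each of them
either a member of the given list of candidates or larger than all the candidates. -/
def treeCheck (t : ℕ) (nxt : ℕ → ℕ → ℕ) (pats : List (ℕ × ℕ)) : List ℕ → ℕ → List ℕ → Bool
  | [], 0, pre => critSum t pre pats || leafTest t nxt pats pre
  | [], _ + 1, _ => false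
  | _ :: _, 0, pre => critSum t pre pats || leafTest t nxt pats pre
  | c :: cs, k + 1, pre =>
    (k.ble cs.length && critSum t (pre ++ c :: cs.take k) pats) ||
      (treeCheck t nxt pats cs k (pre ++ [c]) && treeCheck t nxt pats cs (k + 1) pre)

theorem mem_tail_or_lt {c : ℕ} {cs S : List ℕ} (hS : ∀ p ∈ S, p ∈ c :: cs ∨ ∀ d ∈ c :: cs, d < p)
    (hc : ∀ p ∈ S, c < p) : ∀ p ∈ S, p ∈ cs ∨ ∀ d ∈ cs, d < p := by
  intro p hp
  rcases hS p hp with h | h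
  · rcases List.mem_cons.1 h with rfl | h
    · exact absurd (hc p hp) (lt_irrefl _)
    · exact Or.inl h
  · exact Or.inr fun d hd => h d (List.mem_cons_of_mem c hd)

theorem le_of_mem_or_lt {c p : ℕ} {cs : List ℕ} (hcs : (c :: cs).Pairwise (· < ·))
    (hp : p ∈ c :: cs ∨ ∀ d ∈ c :: cs, d < p) : c ≤ p := by
  rcases hp with h | h
  · rcases List.mem_cons.1 h with rfl | h
    · exact le_rfl
    · exact (List.rel_of_pairwise_cons hcs h).le
  · exact (h c List.mem_cons_self).le

theorem forall₂_take_of_mem_or_lt {cs S : List ℕ} (hcs : cs.Pairwise (· < ·))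
    (hSs : S.Pairwise (· < ·)) (hS : ∀ p ∈ S, p ∈ cs ∨ ∀ d ∈ cs, d < p)
    (hlen : S.length ≤ cs.length) : List.Forall₂ (· ≤ ·) (cs.take S.length) S := by
  induction S generalizing cs with
  | nil => simp
  | cons s S ih =>
    cases cs with
    | nil => simp at hlen
    | cons c cs =>
      have hcs' : c ≤ s := le_of_mem_or_lt hcs (hS s List.mem_cons_self)
      rw [List.length_cons, List.take_succ_cons]
      refine List.Forall₂.cons hcs' (ih hcs.of_cons hSs.of_cons ?_ (by simpa using hlen))
      exact mem_tail_or_lt (fun p hp => hS p (List.mem_cons_of_mem s hp))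
        fun p hp => hcs'.trans_lt (List.rel_of_pairwise_cons hSs hp)

theorem sieved_of_treeCheck {t q k : ℕ} {nxt : ℕ → ℕ → ℕ} {pats : List (ℕ × ℕ)}
    {cands pre S : List ℕ} (hleaf : leafTest t nxt pats (pre ++ S) = true → Sieved t (pre ++ S) q)
    (hq : listProd (pre ++ S) + 1 ≤ q) (hpre : ∀ p ∈ pre, 2 ≤ p) (hc2 : ∀ c ∈ cands, 2 ≤ c)
    (hcs : cands.Pairwise (· < ·)) (hSs : S.Pairwise (· < ·))
    (hS : ∀ p ∈ S, p ∈ cands ∨ ∀ d ∈ cands, d < p) (hk : S.length = k)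
    (h : treeCheck t nxt pats cands k pre = true) : Sieved t (pre ++ S) q := by
  induction cands generalizing k pre S with
  | nil =>
    cases k with
    | zero =>
      rw [List.length_eq_zero_iff] at hk
      subst hk
      rw [treeCheck, Bool.or_eq_true] at h
      refine h.elim (fun h => ?_) (fun h => hleaf (by simpa using h))
      exact sieved_of_critSum (by simp) hpre hq h
    | succ k => simp [treeCheck] at h
  | cons c cs ih =>
    cases k with
    | zero =>
      rw [List.length_eq_zero_iff] at hk
      subst hk
      rw [treeCheck, Bool.or_eq_true] at h
      refine h.elim (fun h => ?_) (fun h => hleaf (by simpa using h))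
      exact sieved_of_critSum (by simp) hpre hq h
    | succ k =>
      rw [treeCheck, Bool.or_eq_true, Bool.and_eq_true, Bool.and_eq_true, Nat.ble_eq] at h
      rcases h with ⟨hlen, h⟩ | ⟨h1, h2⟩
      · refine sieved_of_critSum (List.rel_append (List.forall₂_refl pre) ?_) ?_ hq h
        · have := forall₂_take_of_mem_or_lt hcs hSs hS (by simpa [hk] using hlen)
          rwa [hk] at this
        · intro p hp
          rcases List.mem_append.1 hp with hp | hp
          · exact hpre p hp
          · exact hc2 p (List.mem_of_mem_take (i := k + 1) hp)
      · cases S with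
        | nil => simp at hk
        | cons s S =>
          have hcs' : c ≤ s := le_of_mem_or_lt hcs (hS s List.mem_cons_self)
          have hlt : ∀ p ∈ S, s < p := fun p hp => List.rel_of_pairwise_cons hSs hp
          rcases hcs'.eq_or_lt with rfl | hcs'
          · have e : pre ++ c :: S = (pre ++ [c]) ++ S := by simp
            rw [e] at hleaf hq ⊢
            refine ih hleaf hq ?_ (fun d hd => hc2 d (List.mem_cons_of_mem c hd)) hcs.of_cons
              hSs.of_cons ?_ (by simpa using hk) h1
            · intro p hp
              rcases List.mem_append.1 hp with hp | hp
              · exact hpre p hp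
              · exact hc2 p (by rw [List.mem_singleton.1 hp]; exact List.mem_cons_self)
            · exact mem_tail_or_lt (fun p hp => hS p (List.mem_cons_of_mem _ hp)) hlt
          · refine ih hleaf hq hpre (fun d hd => hc2 d (List.mem_cons_of_mem c hd)) hcs.of_cons
              hSs ?_ hk h2
            refine mem_tail_or_lt hS fun p hp => ?_
            rcases List.mem_cons.1 hp with rfl | hp
            · exact hcs'
            · exact hcs'.trans (hlt p hp)

/-- The least `q` above `n` and not below `b` with `n ∣ q - 1`. -/
def nextMul (n b : ℕ) : ℕ := n * max 1 ((b - 1 + n - 1) / n) + 1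

theorem nextMul_le {n b q : ℕ} (hn : 0 < n) (hd : n ∣ q - 1) (hq : 1 < q) (hb : b ≤ q) :
    nextMul n b ≤ q := by
  obtain ⟨k, hk⟩ := hd
  have hk0 : 1 ≤ k := by
    rcases Nat.eq_zero_or_pos k with rfl | h
    · omega
    · exact h
  rw [nextMul]
  have : max 1 ((b - 1 + n - 1) / n) ≤ k := by
    refine max_le hk0 ?_
    rw [← Nat.lt_succ_iff, Nat.div_lt_iff_lt_mul hn, Nat.succ_mul, mul_comm k]
    omega
  have := Nat.mul_le_mul_left n this
  omega

/-- A lower bound for the powers `2 ^ j ≠ 64` not below `b` with `n ∣ 2 ^ j - 1`, found by testing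
`k` exponents from `j` on. -/
def nextPow (n b : ℕ) : ℕ → ℕ → ℕ
  | 0, j => 2 ^ j
  | k + 1, j => bif !(j.beq 6) && b.ble (2 ^ j) && ((2 ^ j - 1) % n).beq 0 then 2 ^ j
    else nextPow n b k (j + 1)

theorem nextPow_le {n b J k j : ℕ} (hJ : J ≠ 6) (hd : n ∣ 2 ^ J - 1) (hb : b ≤ 2 ^ J)
    (hj : j ≤ J) : nextPow n b k j ≤ 2 ^ J := by
  induction k generalizing j with
  | zero => exact Nat.pow_le_pow_right two_pos hj
  | succ k ih =>
    rw [nextPow]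
    cases hc : (!(j.beq 6) && b.ble (2 ^ j) && ((2 ^ j - 1) % n).beq 0) with
    | true => exact Nat.pow_le_pow_right two_pos hj
    | false =>
      refine ih (hj.lt_of_ne ?_)
      rintro rfl
      rw [← Bool.not_eq_true] at hc
      apply hc
      have h6 : j.beq 6 = false := by rw [← Bool.not_eq_true, Nat.beq_eq]; exact hJ
      simp [h6, hb, Nat.mod_eq_zero_of_dvd hd]

end Trees

section Primes

/-- The odd primes below 520. -/
def oddPrimes : List ℕ :=
  [3, 5, 7, 11, 13, 17, 19, 23, 29, 31, 37, 41, 43, 47, 53, 59, 61, 67, 71, 73, 79, 83, 89, 97,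
    101, 103, 107, 109, 113, 127, 131, 137, 139, 149, 151, 157, 163, 167, 173, 179, 181, 191, 193,
    197, 199, 211, 223, 227, 229, 233, 239, 241, 251, 257, 263, 269, 271, 277, 281, 283, 293, 307,
    311, 313, 317, 331, 337, 347, 349, 353, 359, 367, 373, 379, 383, 389, 397, 401, 409, 419, 421,
    431, 433, 439, 443, 449, 457, 461, 463, 467, 479, 487, 491, 499, 503, 509]

theorem oddPrimes_spec : oddPrimes.Pairwise (· < ·) ∧ (∀ c ∈ oddPrimes, 2 ≤ c ∧ c < 520) ∧
    ∀ n < 520, n ∈ oddPrimes ∨ n ≤ 2 ∨ ∃ d ∈ [2, 3, 5, 7, 11, 13, 17, 19, 23], d < n ∧ n % d = 0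
        := by
  decide +kernel

theorem mem_oddPrimes_or_lt {p : ℕ} (hp : p.Prime) (h2 : p ≠ 2) :
    p ∈ oddPrimes ∨ ∀ d ∈ oddPrimes, d < p := by
  obtain ⟨-, h, hc⟩ := oddPrimes_spec
  rcases lt_or_ge p 520 with hlt | hge
  · rcases hc p hlt with h | h | ⟨d, hd, hdp, hmod⟩
    · exact Or.inl h
    · exact absurd h (by have := hp.two_le; omega)
    · have hd2 : 2 ≤ d := by
        simp only [List.mem_cons, List.not_mem_nil, or_false] at hd
        omega
      rcases (Nat.dvd_prime hp).1 (Nat.dvd_of_mod_eq_zero hmod) with h | h <;> omega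
  · exact Or.inr fun d hd => (h d hd).2.trans_le hge

end Primes

section Computations

/-- The splittings which are tried for odd `q` when `q - 1` has `w` prime factors. -/
def oddPatterns (w : ℕ) : List (ℕ × ℕ) :=
  if w = 3 then [(1, 1), (1, 0)]
  else if w = 4 then [(1, 2), (2, 1), (2, 0), (1, 1), (1, 3)]
  else if w = 5 then [(2, 2), (2, 1), (1, 3), (1, 4), (2, 3)]
  else if w = 6 then [(2, 4), (2, 3), (2, 2), (3, 2), (1, 5)]
  else if w = 7 then [(3, 4), (2, 5), (3, 3), (3, 2)]
  else [(3, 5), (2, 6), (4, 5), (4, 6), (4, 7), (4, 8), (4, 9), (4, 10), (4, 11), (5, 11), (5, 12)]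

/-- The splittings which are tried for even `q` when `q - 1` has `w` prime factors. -/
def evenPatterns (w : ℕ) : List (ℕ × ℕ) :=
  if w = 2 then [(0, 0), (0, 1)]
  else if w = 3 then [(1, 0), (1, 1), (0, 2), (0, 1), (0, 0)]
  else if w = 4 then [(1, 2), (2, 0), (1, 1), (0, 4), (0, 3), (0, 1)]
  else if w = 5 then [(1, 4), (2, 2), (1, 3), (1, 2)]
  else if w = 6 then [(2, 4), (2, 3), (1, 5), (1, 4), (2, 2)]
  else [(2, 5), (2, 6), (3, 5), (3, 6), (3, 7), (3, 8), (3, 10), (3, 11), (4, 10), (4, 11), (4, 12)]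

set_option maxRecDepth 100000 in
theorem treeCheck_odd : ∀ w < 18, 3 ≤ w →
    treeCheck 1 nextMul (oddPatterns w) oddPrimes (w - 1) [2] = true := by
  decide +kernel

set_option maxRecDepth 100000 in
theorem treeCheck_even : ∀ w < 18, 2 ≤ w →
    treeCheck 0 (fun n b => nextPow n b 40 1) (evenPatterns w) oddPrimes w [] = true := by
  decide +kernel

end Computations

section ManyPrimes

theorem sieveMain_pos_of_two_mul_sq_le {w t μ R : ℝ} (ht0 : 0 ≤ t) (ht1 : t ≤ 1) (hw : 2 ≤ w)
    (hμ : μ ≤ w) (hR : 2 * w ^ 2 ≤ R) : 0 < sieveMain w 0 t μ 0 0 R := by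
  rw [sieveMain]
  have h1 : 2 * w ^ 2 * R ≤ R * R := mul_le_mul_of_nonneg_right hR (by nlinarith)
  have h2 : 0 ≤ (w - 2) * R := mul_nonneg (by linarith) (by nlinarith)
  have h3 : 0 ≤ t * R := mul_nonneg ht0 (by nlinarith)
  have h4 : 4 * w ≤ R := by nlinarith
  nlinarith

theorem sieved_of_four_mul_le {t q : ℕ} {T : List ℕ} (ht : t ≤ 1) (hT : ∀ p ∈ T, 2 ≤ p)
    (hT0 : T ≠ []) (hq : 4 * 16 ^ T.length ≤ q) : Sieved t T q := by
  have hw : 2 ≤ 2 ^ T.length := Nat.le_self_pow (List.length_pos_of_ne_nil hT0).ne' 2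
  refine ⟨T, [], [], by simp, by omega, by simp [recipSum_nil], 0,
    by simp [density_nil], ?_⟩
  rw [recipSum_nil, List.length_nil, Nat.cast_zero]
  refine sieveMain_pos_of_two_mul_sq_le (Nat.cast_nonneg t) (by exact_mod_cast ht)
    (by exact_mod_cast hw) (inv_density_le hT) (Real.le_sqrt_of_sq_le ?_)
  have h : ((4 * 16 ^ T.length : ℕ) : ℝ) ≤ q := by exact_mod_cast hq
  refine le_trans (le_of_eq ?_) h
  push_cast
  rw [show (16 : ℝ) = 2 ^ 4 by norm_num, mul_pow, ← pow_mul, ← pow_mul, ← pow_mul]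
  ring_nf

theorem pow_le_listProd {n : ℕ} {l : List ℕ} (h : ∀ p ∈ l, n ≤ p) : n ^ l.length ≤ listProd l := by
  induction l with
  | nil => exact le_rfl
  | cons p l ih =>
    rw [List.forall_mem_cons] at h
    rw [List.length_cons, pow_succ', listProd]
    exact Nat.mul_le_mul h.1 (ih h.2)

theorem le_listProd_of_primes {S : List ℕ} (hSs : S.Pairwise (· < ·))
    (hS : ∀ p ∈ S, p.Prime ∧ p ≠ 2) (hlen : 17 ≤ S.length) :
    4 * 16 ^ (S.length + 1) ≤ listProd S := by
  have hlt : (S.take 17).length = 17 := by rw [List.length_take]; omega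
  have hd : ∀ p ∈ S.drop 17, 16 ≤ p := by
    intro p hp
    have h1 : ∀ x ∈ S.take 17, x < p := by
      rw [← List.take_append_drop 17 S, List.pairwise_append] at hSs
      exact fun x hx => hSs.2.2 x hx p hp
    have h2 : (S.take 17).toFinset ⊆ Finset.range p := fun x hx =>
      Finset.mem_range.2 (h1 x (List.mem_toFinset.1 hx))
    have h3 := Finset.card_le_card h2
    rw [List.toFinset_card_of_nodup (hSs.nodup.sublist (List.take_sublist 17 S)), hlt,
      Finset.card_range] at h3
    omega
  have hf := forall₂_take_of_mem_or_lt oddPrimes_spec.1 (hSs.sublist (List.take_sublist 17 S))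
    (fun p hp => mem_oddPrimes_or_lt (hS p (List.mem_of_mem_take hp)).1
      (hS p (List.mem_of_mem_take hp)).2) (by rw [hlt]; decide)
  have h1 := listProd_mono hf
  rw [hlt] at h1
  have h2 : 4 * 16 ^ 18 ≤ listProd (oddPrimes.take 17) := by decide +kernel
  have h3 := pow_le_listProd hd
  rw [List.length_drop] at h3
  calc 4 * 16 ^ (S.length + 1) = 4 * 16 ^ 18 * 16 ^ (S.length - 17) := by
        rw [mul_assoc, ← pow_add]; congr 2; omega
    _ ≤ listProd (S.take 17) * listProd (S.drop 17) := Nat.mul_le_mul (h2.trans h1) h3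
    _ = listProd S := by rw [← listProd_append, List.take_append_drop]

end ManyPrimes

section Lists

theorem recipSum_of_toFinset {l : List ℕ} (h : l.Nodup) :
    recipSum l = ∑ p ∈ l.toFinset, 1 / (p : ℝ) := (List.sum_toFinset _ h).symm

theorem density_of_toFinset {l : List ℕ} (h : l.Nodup) :
    density l = ∏ p ∈ l.toFinset, (1 - 1 / (p : ℝ)) := (List.prod_toFinset _ h).symm

theorem listProd_of_toFinset {l : List ℕ} (h : l.Nodup) : listProd l = ∏ p ∈ l.toFinset, p := by
  rw [List.prod_toFinset _ h]
  clear h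
  induction l with
  | nil => rfl
  | cons p l ih => simp [listProd, ih]

end Lists

section Finsets

variable {E P L : Finset ℕ}

/-- A weak form, for sets of primes, of the hypotheses of the modified prime sieve. -/
def FinsetAdmissible (E P L : Finset ℕ) (q : ℕ) : Prop :=
  2 * ∑ p ∈ L, 1 / (p : ℝ) <
      (∏ p ∈ E, (1 - 1 / (p : ℝ))) ^ 2 * (1 - 2 * ∑ p ∈ P, 1 / (p : ℝ)) ∧
    (∏ p ∈ E, (1 - 1 / (p : ℝ))) ^ 2 *
        (2 * P.card - 1 + 2 * (1 - 2 * ∑ p ∈ P, 1 / (p : ℝ))) *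
        (2 * (2 ^ E.card) ^ 2 - 3 * 2 ^ E.card) + (1 - 2 * ∑ p ∈ P, 1 / (p : ℝ)) + L.card -
        ∑ p ∈ L, 1 / (p : ℝ) <
      √q * ((∏ p ∈ E, (1 - 1 / (p : ℝ))) ^ 2 * (1 - 2 * ∑ p ∈ P, 1 / (p : ℝ)) -
        2 * ∑ p ∈ L, 1 / (p : ℝ))

theorem sieved_of_finsetAdmissible {t q : ℕ} {nxt : ℕ → ℕ → ℕ} {pats : List (ℕ × ℕ)}
    {pre S : List ℕ} (ht : t ≤ 1)
    (hTs : (pre ++ S).Nodup) (hSs : S.Pairwise (· < ·)) (hS : ∀ p ∈ S, p.Prime ∧ p ≠ 2)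
    (hpre : ∀ p ∈ pre, 2 ≤ p) (hpre1 : pre.length ≤ 1)
    (hU : E ∪ P ∪ L = (pre ++ S).toFinset) (hEP : Disjoint E P) (hEPL : Disjoint (E ∪ P) L)
    (hP : P.Nonempty) (hL : L.Nonempty) (hadm : FinsetAdmissible E P L q)
    (hq : listProd (pre ++ S) + 1 ≤ q)
    (hnxt : ∀ b ≤ q, nxt (listProd (pre ++ S)) b ≤ q)
    (htree : (pre ++ S).length < 18 → treeCheck t nxt pats oddPrimes S.length pre = true) :
    Sieved t (pre ++ S) q := by
  have hT2 : ∀ p ∈ pre ++ S, 2 ≤ p := by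
    intro p hp
    exact (List.mem_append.1 hp).elim (hpre p) fun h => (hS p h).1.two_le
  rcases lt_or_ge (pre ++ S).length 18 with hlt | hge
  · refine sieved_of_treeCheck (fun hleaf => ?_) hq hpre (fun c hc => (oddPrimes_spec.2.1 c hc).1)
      oddPrimes_spec.1 hSs (fun p hp => mem_oddPrimes_or_lt (hS p hp).1 (hS p hp).2) rfl
      (htree hlt)
    obtain ⟨f, hf⟩ : ∃ f : ℕ → ℕ, f = fun p => if p ∈ E then 0 else if p ∈ P then 1 else 2 :=
      ⟨_, rfl⟩
    have hmem : ∀ p, p ∈ (pre ++ S).toFinset ↔ (p ∈ E ∨ p ∈ P) ∨ p ∈ L := by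
      intro p; rw [← hU, Finset.mem_union, Finset.mem_union]
    have hEP' : ∀ p ∈ P, p ∉ E := fun p hp hE => Finset.disjoint_left.1 hEP hE hp
    have hL' : ∀ p ∈ L, p ∉ E ∧ p ∉ P := fun p hp => by
      have := Finset.disjoint_right.1 hEPL hp
      simpa [not_or] using this
    have key : ∀ (i : ℕ) (A : Finset ℕ), (∀ p, p ∈ (pre ++ S).toFinset ∧ f p = i ↔ p ∈ A) →
        ((pre ++ S).filter (f · = i)).reverse.Nodup ∧
          ((pre ++ S).filter (f · = i)).reverse.toFinset = A := by
      intro i A h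
      refine ⟨List.nodup_reverse.2 (hTs.filter _), ?_⟩
      ext p
      rw [← h p, List.toFinset_reverse, List.mem_toFinset, List.mem_filter, List.mem_toFinset,
        decide_eq_true_iff]
    have h0 := key 0 E fun p => by rw [hmem, hf]; grind
    have h1 := key 1 P fun p => by rw [hmem, hf]; grind
    have h2 := key 2 L fun p => by rw [hmem, hf]; grind
    have hcard : ∀ (l : List ℕ), l.Nodup → l.length = l.toFinset.card := fun l hl =>
      (List.toFinset_card_of_nodup hl).symm
    refine sieved_of_leafTest (f := f) (fun p hp => ⟨hT2 p hp, ?_⟩) (by omega) hnxt ?_ ?_ ?_ hleaf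
    · rw [hf]; simp only; split_ifs <;> simp
    · rintro h
      rw [h] at h1
      exact hP.ne_empty (by simpa using h1.2.symm)
    · rintro h
      rw [h] at h2
      exact hL.ne_empty (by simpa using h2.2.symm)
    · rw [Admissible, recipSum_of_toFinset h1.1, recipSum_of_toFinset h2.1,
        density_of_toFinset h0.1, hcard _ h0.1, hcard _ h1.1, hcard _ h2.1, h0.2, h1.2, h2.2]
      exact hadm
  · have hge' := hge
    rw [List.length_append] at hge'
    refine sieved_of_four_mul_le ht hT2 ?_ ?_
    · rintro h
      simp [h] at hge
    · have h1 := le_listProd_of_primes hSs hS (by omega)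
      have h2 : 1 ≤ listProd pre := listProd_pos hpre
      rw [listProd_append] at hq
      have h3 : 16 ^ (pre ++ S).length ≤ 16 ^ (S.length + 1) :=
        Nat.pow_le_pow_right (by norm_num) (by rw [List.length_append]; omega)
      nlinarith

theorem two_mem_of_finsetAdmissible {q : ℕ} (h2 : 2 ∈ E ∪ P ∪ L)
    (hadm : FinsetAdmissible E P L q) : 2 ∈ E := by
  obtain ⟨h, -⟩ := hadm
  have hL0 : 0 ≤ ∑ p ∈ L, 1 / (p : ℝ) := Finset.sum_nonneg fun p _ => by positivity
  have hP0 : 0 ≤ ∑ p ∈ P, 1 / (p : ℝ) := Finset.sum_nonneg fun p _ => by positivity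
  rw [Finset.mem_union, Finset.mem_union] at h2
  rcases h2 with (h2 | h2) | h2
  · exact h2
  · have h1 := Finset.single_le_sum (f := fun p : ℕ => 1 / (p : ℝ)) (fun p _ => by positivity) h2
    push_cast at h1
    nlinarith [sq_nonneg (∏ p ∈ E, (1 - 1 / (p : ℝ)))]
  · have h1 := Finset.single_le_sum (f := fun p : ℕ => 1 / (p : ℝ)) (fun p _ => by positivity) h2
    push_cast at h1
    have h3 : ∀ p ∈ E, 0 ≤ 1 - 1 / (p : ℝ) ∧ 1 - 1 / (p : ℝ) ≤ 1 := fun p _ => by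
      have h4 : 1 / (p : ℝ) ≤ 1 := by rw [one_div]; exact Nat.cast_inv_le_one p
      have h5 : 0 ≤ 1 / (p : ℝ) := by positivity
      constructor <;> linarith
    have h4 : (∏ p ∈ E, (1 - 1 / (p : ℝ))) ^ 2 ≤ 1 :=
      pow_le_one₀ (Finset.prod_nonneg fun p hp => (h3 p hp).1)
        (Finset.prod_le_one (fun p hp => (h3 p hp).1) fun p hp => (h3 p hp).2)
    nlinarith [sq_nonneg (∏ p ∈ E, (1 - 1 / (p : ℝ)))]

end Finsets

section FiniteFields

variable {F : Type*} [Field F] [Fintype F] {a b c : F}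

theorem exists_isPrimitiveRoot_of_sieved (ha : a ≠ 0) (hd : b ^ 2 - 4 * a * c ≠ 0) {t : ℕ}
    {T : List ℕ} (hT : T.Nodup) (hTU : T.toFinset = (Fintype.card F - 1).primeFactors)
    (ht : t = 0 ∨ t = 1 ∧ T.head? = some 2 ∧ ringChar F ≠ 2) (h : Sieved t T (Fintype.card F)) :
    ∃ g : F, IsPrimitiveRoot g (Fintype.card F - 1) ∧
      IsPrimitiveRoot (a * g ^ 2 + b * g + c) (Fintype.card F - 1) := by
  obtain ⟨E, P, L, rfl, hE, hP, ε, hε, hpos⟩ := h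
  rw [List.nodup_append, List.nodup_append] at hT
  obtain ⟨⟨hEn, hPn, hEP⟩, hLn, hEPL⟩ := hT
  rw [density_of_toFinset hPn, density_of_toFinset hLn] at hε
  rw [density_of_toFinset hEn, recipSum_of_toFinset hPn, ← List.toFinset_card_of_nodup hEn,
    ← List.toFinset_card_of_nodup hPn] at hpos
  rw [recipSum_of_toFinset hPn] at hP
  refine exists_isPrimitiveRoot_of_sieveMain_pos ha hd (E := E.toFinset) (P := P.toFinset)
    (L := L.toFinset) (by rw [← hTU, List.toFinset_append, List.toFinset_append]) ?_ ?_ ?_ hP hε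
    hpos
  · rw [Finset.disjoint_left]
    intro p hp hp'
    exact hEP p (List.mem_toFinset.1 hp) p (List.mem_toFinset.1 hp') rfl
  · rw [Finset.disjoint_left]
    intro p hp hp'
    rw [← List.toFinset_append, List.mem_toFinset] at hp
    exact hEPL p hp p (List.mem_toFinset.1 hp') rfl
  · rcases ht with rfl | ⟨rfl, h2, hF⟩
    · exact Or.inl (by simp)
    · refine Or.inr ⟨by simp, ?_, hF⟩
      cases E with
      | nil => simp at hE
      | cons x E =>
        simp only [List.cons_append, List.head?_cons, Option.some.injEq] at h2
        simp [h2]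

end FiniteFields

section SieveTheorem

variable {F : Type*} [Field F] [Fintype F] {a b c : F}

theorem exists_isPrimitiveRoot_of_finsetAdmissible (ha : a ≠ 0) (hd : b ^ 2 - 4 * a * c ≠ 0)
    {E P L : Finset ℕ} (hU : E ∪ P ∪ L = (Fintype.card F - 1).primeFactors)
    (hEP : Disjoint E P) (hEPL : Disjoint (E ∪ P) L) (hP : P.Nonempty) (hL : L.Nonempty)
    (hadm : FinsetAdmissible E P L (Fintype.card F)) (h64 : Fintype.card F ≠ 64) :
    ∃ g : F, IsPrimitiveRoot g (Fintype.card F - 1) ∧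
      IsPrimitiveRoot (a * g ^ 2 + b * g + c) (Fintype.card F - 1) := by
  obtain ⟨q, hq⟩ : ∃ q, q = Fintype.card F := ⟨_, rfl⟩
  rw [← hq] at hU hadm h64
  have hprime : ∀ p ∈ E ∪ P ∪ L, p.Prime := fun p hp => Nat.prime_of_mem_primeFactors (hU ▸ hp)
  have hq1 : q - 1 ≠ 0 := by
    obtain ⟨p, hp⟩ := hP
    have : p ∈ (q - 1).primeFactors := by
      rw [← hU]; exact Finset.mem_union_left _ (Finset.mem_union_right _ hp)
    exact (Nat.mem_primeFactors.1 this).2.2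
  have hdvd : ∀ T : List ℕ, T.Nodup → T.toFinset = E ∪ P ∪ L → listProd T ∣ q - 1 := by
    intro T hT hTU
    rw [listProd_of_toFinset hT, hTU, hU]
    exact Nat.prod_primeFactors_dvd _
  have hle : ∀ T : List ℕ, T.Nodup → T.toFinset = E ∪ P ∪ L → listProd T + 1 ≤ q := by
    intro T hT hTU
    have := Nat.le_of_dvd (Nat.pos_of_ne_zero hq1) (hdvd T hT hTU)
    omega
  have hcard : P.card + L.card + E.card = (E ∪ P ∪ L).card := by
    rw [Finset.card_union_of_disjoint hEPL, Finset.card_union_of_disjoint hEP]; omega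
  have hP1 := hP.card_pos
  have hL1 := hL.card_pos
  by_cases hchar : ringChar F = 2
  · obtain ⟨J, hJ⟩ : ∃ J : ℕ, q = 2 ^ J := by
      have : Fact (Nat.Prime 2) := ⟨Nat.prime_two⟩
      have : CharP F 2 := hchar ▸ ringChar.charP F
      obtain ⟨n, -, hn⟩ := FiniteField.card F 2
      exact ⟨n, hq.trans hn⟩
    have hJ0 : 1 ≤ J := by
      rcases Nat.eq_zero_or_pos J with rfl | h
      · simp [hJ] at hq1
      · exact h
    have h2 : 2 ∉ E ∪ P ∪ L := by
      intro h
      have h1 := Nat.dvd_of_mem_primeFactors (hU ▸ h)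
      have h3 : 2 ∣ q := hJ ▸ dvd_pow_self 2 (by omega)
      omega
    have hT : ((E ∪ P ∪ L).sort (· ≤ ·)).Nodup := Finset.sort_nodup _ _
    have hTU : ((E ∪ P ∪ L).sort (· ≤ ·)).toFinset = E ∪ P ∪ L := Finset.sort_toFinset _ _
    have hs := sieved_of_finsetAdmissible (pre := []) (S := (E ∪ P ∪ L).sort (· ≤ ·)) (t := 0) (q
        := q)
      (nxt := fun n b => nextPow n b 40 1) (pats := evenPatterns (E ∪ P ∪ L).card)
      (E := E) (P := P) (L := L) zero_le_one hT (Finset.sortedLT_sort _).pairwise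
      (fun p hp => by
        rw [Finset.mem_sort] at hp
        exact ⟨hprime p hp, by rintro rfl; exact h2 hp⟩)
      (by simp) (by simp) hTU.symm hEP hEPL hP hL hadm (hle _ hT hTU)
      (fun b hb => by
        have := hdvd _ hT hTU
        rw [hJ] at this hb ⊢
        refine nextPow_le ?_ this hb hJ0
        rintro rfl
        exact h64 (by rw [hJ]; norm_num))
      (fun h => by
        rw [List.nil_append, Finset.length_sort] at h
        rw [Finset.length_sort]
        exact treeCheck_even _ h (by omega))
    rw [hq] at hs
    exact exists_isPrimitiveRoot_of_sieved ha hd hT (by rw [← hq, ← hU]; exact hTU) (Or.inl rfl) hs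
  · have hodd : q % 2 = 1 := hq ▸ FiniteField.odd_card_of_char_ne_two hchar
    have h2 : 2 ∈ E ∪ P ∪ L := by
      rw [hU]
      exact Nat.mem_primeFactors.2 ⟨Nat.prime_two, by omega, hq1⟩
    have h2E := two_mem_of_finsetAdmissible h2 hadm
    have hE1 := Finset.card_pos.2 ⟨2, h2E⟩
    obtain ⟨S, hS⟩ : ∃ S, S = ((E ∪ P ∪ L).erase 2).sort (· ≤ ·) := ⟨_, rfl⟩
    have hSmem : ∀ p, p ∈ S ↔ p ≠ 2 ∧ p ∈ E ∪ P ∪ L := by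
      intro p; rw [hS, Finset.mem_sort, Finset.mem_erase]
    have hT : (2 :: S).Nodup := List.nodup_cons.2
      ⟨by rw [hSmem]; simp, hS ▸ Finset.sort_nodup _ _⟩
    have hTU : (2 :: S).toFinset = E ∪ P ∪ L := by
      rw [List.toFinset_cons, hS, Finset.sort_toFinset, Finset.insert_erase h2]
    have hlen : S.length = (E ∪ P ∪ L).card - 1 := by
      rw [hS, Finset.length_sort, Finset.card_erase_of_mem h2]
    have hs := sieved_of_finsetAdmissible (pre := [2]) (S := S) (t := 1) (q := q)
      (nxt := nextMul) (pats := oddPatterns (E ∪ P ∪ L).card)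
      (E := E) (P := P) (L := L) le_rfl hT (hS ▸ (Finset.sortedLT_sort _).pairwise)
      (fun p hp => by
        rw [hSmem] at hp
        exact ⟨hprime p hp.2, hp.1⟩)
      (by simp) (by simp) hTU.symm hEP hEPL hP hL hadm (hle _ hT hTU)
      (fun b hb => nextMul_le
        (Nat.pos_of_ne_zero fun h0 => hq1 (Nat.eq_zero_of_zero_dvd (h0 ▸ hdvd _ hT hTU)))
        (hdvd _ hT hTU) (by omega) hb)
      (fun h => by
        have e : ([2] ++ S).length = (E ∪ P ∪ L).card := by
          rw [List.singleton_append, List.length_cons]; omega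
        rw [e] at h
        rw [hlen]
        exact treeCheck_odd _ h (by omega))
    rw [hq] at hs
    exact exists_isPrimitiveRoot_of_sieved ha hd hT (by rw [← hq, ← hU]; exact hTU)
      (Or.inr ⟨rfl, rfl, hchar⟩) hs

end SieveTheorem

section FieldOfOrder64

/-- The codes of the powers of a root `α` of `X ^ 6 + X + 1` in characteristic two, six bits each:
the bits of the code of an element are its coordinates in the basis `1, α, …, α ^ 5`. -/
def powTable : ℕ :=
 
      324948975432320371080866489111452917039159851672880359415289456819899054707732937472241880484391502374330200768641

/-- The code of `α ^ k`. -/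
def powCode (k : ℕ) : ℕ := (powTable >>> (6 * k)) % 64

/-- The set of the codes of the elements of order `63`. -/
def primCodes : ℕ := 12805975642275911316

/-- For every code `v`, the set of those `c` for which `v ^^^ c` does not belong to `primCodes`. -/
def missTable : ℕ :=
  875456900566030743141370518628868989913672500881271414776066549949147278907897107029144002209668752563573881044776854979322145864491837607225460026658800697785987792292408429458224947722756657816480568437533779284189322466653967248636855991790588241208607724407942845393697718064312726081790781539819907124817377579925871556603745396305435270901333666352635058479972953860315455043020053454918934491094261016498726407310203568582046969102780291751590922613731889813862334168290062769217584183770867753669398745772474832593994174604154837972895733560630630280815997122396677142722476048502018076220508199574801169245707551545482803958528991231343527164018673016199594177614501640264284297444884520736392390005787897642901050255804311780946537603621051926293885518254006680381576891877036259713929083201242239999844255270303755165532463582060095406269108442495256665155712140266093607157856295987620024678637374049895840402105181863677113470244361142566571611225835890971412827085876828892675716357395156187323864324422189815253966941516997704093774260942940182298044647286753424650920167689079719083617570874859556580002792499547224413499030703887209867039349680532201242152508581808205658287652727315340591049881364640941238186862955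

/-- The set of those codes `c` for which `v ^^^ c` does not belong to `primCodes`. -/
def missCodes (v : ℕ) : ℕ := (missTable >>> (64 * v)) % 2 ^ 64

/-- The residues modulo `63` which are coprime to `63`. -/
def primExps : List ℕ :=
  [1, 2, 4, 5, 8, 10, 11, 13, 16, 17, 19, 20, 22, 23, 25, 26, 29, 31, 32, 34, 37, 38, 40, 41, 43,
    44, 46, 47, 50, 52, 53, 55, 58, 59, 61, 62]

/-- Test whether no code belongs to the set `m` and to all the sets
`missCodes (α ^ (i + 2 k) + α ^ (j + k))`. -/
def noCommonMiss (i j : ℕ) : List ℕ → ℕ → Bool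
  | [], m => m.beq 0
  | k :: l, m => bif m.beq 0 then true else
    noCommonMiss i j l
      (m &&& missCodes (powCode ((i + 2 * k) % 63) ^^^ powCode ((j + k) % 63)))

theorem powCode_succ : powCode 0 = 1 ∧ (∀ k < 63, powCode k < 64) ∧ ∀ k < 62,
    powCode (k + 1) = 2 * powCode k ∨ powCode (k + 1) = 2 * powCode k ^^^ 67 := by
  decide +kernel

theorem testBit_primCodes : ∀ n < 64, primCodes.testBit n = true →
    ∃ k < 63, Nat.Coprime k 63 ∧ powCode k = n := by
  decide +kernel

theorem testBit_missCodes : ∀ v < 64, ∀ c < 64,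
    (missCodes v).testBit c = !primCodes.testBit (v ^^^ c) := by
  decide +kernel

theorem noCommonMiss_primExps : ∀ i < 63, ∀ j < 63,
    noCommonMiss i j primExps (2 ^ 64 - 1) = true := by
  decide +kernel

theorem exists_testBit_of_noCommonMiss {i j c m : ℕ} {l : List ℕ}
    (h : noCommonMiss i j l m = true) (hm : m.testBit c = true) :
    ∃ k ∈ l, (missCodes (powCode ((i + 2 * k) % 63) ^^^ powCode ((j + k) % 63))).testBit c =
      false := by
  have hm0 : m.beq 0 = false := by
    rw [← Bool.not_eq_true, Nat.beq_eq]
    rintro rfl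
    simp at hm
  induction l generalizing m with
  | nil => simp [noCommonMiss, hm0] at h
  | cons k l ih =>
    simp only [noCommonMiss, hm0, cond_false] at h
    by_cases hk : (missCodes (powCode ((i + 2 * k) % 63) ^^^ powCode ((j + k) % 63))).testBit c =
      false
    · exact ⟨k, List.mem_cons_self, hk⟩
    · rw [Bool.not_eq_false] at hk
      have h1 : (m &&& missCodes (powCode ((i + 2 * k) % 63) ^^^
          powCode ((j + k) % 63))).testBit c = true := by
        rw [Nat.testBit_and, hm, hk]; rfl
      obtain ⟨k', hk', h'⟩ := ih h h1 (by
        rw [← Bool.not_eq_true, Nat.beq_eq]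
        intro h0
        rw [h0] at h1
        simp at h1)
      exact ⟨k', List.mem_cons_of_mem k hk', h'⟩

theorem coprime_of_mem_primExps : ∀ k ∈ primExps, Nat.Coprime k 63 := by decide +kernel

variable {F : Type*} [Field F] {α : F}

/-- The field element with a given code. -/
def decode (α : F) (n : ℕ) : F := ∑ i ∈ Finset.range 7, ((n.testBit i).toNat : F) * α ^ i

theorem decode_xor (h2 : (2 : F) = 0) (m n : ℕ) : decode α (m ^^^ n) = decode α m + decode α n := by
  rw [decode, decode, decode, ← Finset.sum_add_distrib]
  refine Finset.sum_congr rfl fun i _ => ?_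
  rw [Nat.testBit_xor, ← add_mul]
  congr 1
  cases m.testBit i <;> cases n.testBit i <;> norm_num
  exact h2.symm

theorem decode_two_mul {n : ℕ} (hn : n < 64) : decode α (2 * n) = α * decode α n := by
  have h6 : n.testBit 6 = false := Nat.testBit_lt_two_pow hn
  rw [decode, decode, Finset.sum_range_succ', Finset.sum_range_succ _ 6, h6, Nat.testBit_zero,
    mul_add, Finset.mul_sum]
  congr 1
  · refine Finset.sum_congr rfl fun i _ => ?_
    rw [Nat.testBit_succ, Nat.mul_div_cancel_left n two_pos]
    ring
  · simp

theorem decode_powCode (h2 : (2 : F) = 0) (hα : α ^ 6 + α + 1 = 0) {k : ℕ} (hk : k < 63) :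
    decode α (powCode k) = α ^ k := by
  have h67 : decode α 67 = 0 := by
    have : decode α 67 = α ^ 6 + α + 1 := by
      simp [decode, Finset.sum_range_succ, Nat.testBit]
      ring
    rw [this, hα]
  obtain ⟨h0, hlt, hs⟩ := powCode_succ
  induction k with
  | zero => rw [h0]; simp [decode, Finset.sum_range_succ, Nat.testBit]
  | succ k ih =>
    have h := ih (by omega)
    rcases hs k (by omega) with h1 | h1
    · rw [h1, decode_two_mul (hlt k (by omega)), h, pow_succ']
    · rw [h1, decode_xor h2, h67, add_zero, decode_two_mul (hlt k (by omega)), h, pow_succ']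

theorem isPrimitiveRoot_of_pow_six (h2 : (2 : F) = 0) (hα : α ^ 6 + α + 1 = 0)
    (h63 : α ^ 63 = 1) : IsPrimitiveRoot α 63 := by
  have h9 : α ^ 9 ≠ 1 := by
    intro h
    refine one_ne_zero (α := F) ?_
    linear_combination (α ^ 1 + α ^ 3 + α ^ 4 + α ^ 5 + α ^ 6) * hα +
      (1 + α ^ 1 + α ^ 2 + α ^ 3) * h - (α ^ 1 + α ^ 2 + α ^ 3 + α ^ 4 + α ^ 5 + α ^ 6 + α ^ 7 +
        α ^ 9 + α ^ 10 + α ^ 11 + α ^ 12 - (1 + α ^ 1 + α ^ 2 + α ^ 3)) * h2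
  have h21 : α ^ 21 ≠ 1 := by
    intro h
    refine one_ne_zero (α := F) ?_
    linear_combination (α ^ 1 + α ^ 2 + α ^ 4 + α ^ 7 + α ^ 10 + α ^ 11 + α ^ 12 + α ^ 16 +
        α ^ 18 + α ^ 19 + α ^ 20) * hα + (1 + α ^ 1 + α ^ 3 + α ^ 4 + α ^ 5) * h -
      (α ^ 1 + α ^ 2 + α ^ 3 + α ^ 4 + α ^ 5 + α ^ 7 + α ^ 8 + α ^ 10 + α ^ 11 + α ^ 12 + α ^ 13 +
        α ^ 16 + α ^ 17 + α ^ 18 + α ^ 19 + α ^ 20 + α ^ 21 + α ^ 22 + α ^ 24 + α ^ 25 + α ^ 26 -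
        (1 + α ^ 1 + α ^ 3 + α ^ 4 + α ^ 5)) * h2
  rw [IsPrimitiveRoot.iff_orderOf]
  refine orderOf_eq_of_pow_and_pow_div_prime (by norm_num) h63 fun p hp hd => ?_
  have hmem : p ∈ Nat.primeFactors 63 := Nat.mem_primeFactors.2 ⟨hp, hd, by norm_num⟩
  have : Nat.primeFactors 63 = {3, 7} := by
    rw [show 63 = 3 ^ 2 * 7 by norm_num, Nat.primeFactors_mul (by norm_num) (by norm_num),
      Nat.primeFactors_prime_pow (by norm_num) Nat.prime_three,
      Nat.Prime.primeFactors (by norm_num)]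
    rfl
  rw [this, Finset.mem_insert, Finset.mem_singleton] at hmem
  rcases hmem with rfl | rfl
  · exact h21
  · exact h9

variable [Fintype F]

theorem exists_pow_six_add_self_add_one (hF : Fintype.card F = 64) (h2 : (2 : F) = 0) :
    ∃ α : F, α ^ 6 + α + 1 = 0 := by
  classical
  obtain ⟨D, hD⟩ : ∃ D : Finset ℕ, D = {0, 1, 2, 3, 4, 5, 7, 9, 11, 12, 15, 16, 18, 19, 20, 22, 23,
    25, 28, 31, 32, 33, 37, 39, 40, 41, 42, 45, 47, 51, 52, 57} := ⟨_, rfl⟩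
  obtain ⟨Q, hQ⟩ : ∃ Q : Polynomial F, Q = ∑ i ∈ D, Polynomial.X ^ i := ⟨_, rfl⟩
  have hdeg : Q.natDegree ≤ 57 := by
    rw [hQ]
    refine Polynomial.natDegree_sum_le_of_forall_le _ _ fun i hi => ?_
    rw [Polynomial.natDegree_X_pow]
    revert i
    rw [hD]
    decide
  have hQ0 : Q ≠ 0 := by
    intro h
    have h57 : Q.coeff 57 = 1 := by
      rw [hQ, Polynomial.finsetSum_coeff, Finset.sum_eq_single_of_mem 57 (by rw [hD]; decide)]
      · simp
      · intro i _ hi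
        rw [Polynomial.coeff_X_pow, if_neg hi.symm]
    rw [h, Polynomial.coeff_zero] at h57
    exact zero_ne_one h57
  by_contra! hcon
  have hev : ∀ x : Fˣ, Q.eval (x : F) = 0 := by
    intro x
    have hx : (x : F) ^ 63 = 1 := by
      have := FiniteField.pow_card_sub_one_eq_one (x : F) x.ne_zero
      rwa [hF] at this
    refine (mul_eq_zero.1 ?_).resolve_left (hcon x)
    have hQx : Q.eval (x : F) = ∑ i ∈ D, (x : F) ^ i := by
      rw [hQ, Polynomial.eval_finsetSum]
      exact Finset.sum_congr rfl fun i _ => by simp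
    generalize (x : F) = y at hx hQx ⊢
    rw [hQx, hD]
    iterate 31 rw [Finset.sum_insert (by decide)]
    rw [Finset.sum_singleton]
    linear_combination hx + (1 + y ^ 1 + y ^ 2 + y ^ 3 + y ^ 4 + y ^ 5 + y ^ 6 + y ^ 7 + y ^
      8 + y ^ 9 + y ^ 10 + y ^ 11 + y ^ 12 + y ^ 13 + y ^ 15 + y ^ 16 + y ^ 17 + y ^ 18 + y
      ^ 19 + y ^ 20 + y ^ 21 + y ^ 22 + y ^ 23 + y ^ 24 + y ^ 25 + y ^ 26 + y ^ 28 + y ^ 29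
      + y ^ 31 + y ^ 32 + y ^ 33 + y ^ 34 + y ^ 37 + y ^ 38 + y ^ 39 + y ^ 40 + y ^ 41 + y ^
      42 + y ^ 43 + y ^ 45 + y ^ 46 + y ^ 47 + y ^ 48 + y ^ 51 + y ^ 52 + y ^ 53 + y ^ 57 +
      y ^ 58) * h2
  refine hQ0 (Polynomial.eq_zero_of_natDegree_lt_card_of_eval_eq_zero Q
    (f := fun x : Fˣ => (x : F)) Units.val_injective hev ?_)
  have := Fintype.card_units (α := F)
  omega

theorem exists_isPrimitiveRoot_of_card_eq_64 (hF : Fintype.card F = 64) {a b c : F} (ha : a ≠ 0)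
    (hd : b ^ 2 - 4 * a * c ≠ 0) : ∃ g : F, IsPrimitiveRoot g 63 ∧
      IsPrimitiveRoot (a * g ^ 2 + b * g + c) 63 := by
  have h2 : (2 : F) = 0 := by
    have h := FiniteField.cast_card_eq_zero F
    rw [hF] at h
    have : (2 : F) ^ 6 = 0 := by rw [← h]; norm_num
    exact pow_eq_zero_iff (by norm_num) |>.1 this
  have hb : b ≠ 0 := by
    rintro rfl
    apply hd
    linear_combination (-2 * a * c) * h2
  obtain ⟨α, hα⟩ := exists_pow_six_add_self_add_one hF h2
  have hpow : ∀ x : F, x ≠ 0 → x ^ 63 = 1 := fun x hx => by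
    have := FiniteField.pow_card_sub_one_eq_one x hx
    rwa [hF] at this
  have hα0 : α ≠ 0 := by rintro rfl; norm_num at hα
  have hprim := isPrimitiveRoot_of_pow_six h2 hα (hpow α hα0)
  have hlog : ∀ x : F, x ≠ 0 → ∃ k < 63, α ^ k = x := fun x hx => by
    have : NeZero 63 := ⟨by norm_num⟩
    exact hprim.eq_pow_of_pow_eq_one (hpow x hx)
  obtain ⟨i, hi, rfl⟩ := hlog a ha
  obtain ⟨j, hj, rfl⟩ := hlog b hb
  obtain ⟨n, hn, rfl⟩ : ∃ n < 64, decode α n = c := by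
    by_cases hc : c = 0
    · exact ⟨0, by norm_num, by simp [decode, hc]⟩
    · obtain ⟨k, hk, rfl⟩ := hlog c hc
      exact ⟨powCode k, powCode_succ.2.1 k hk, decode_powCode h2 hα hk⟩
  obtain ⟨k, hk, h⟩ := exists_testBit_of_noCommonMiss (c := n) (noCommonMiss_primExps i hi j hj)
    (by rw [Nat.testBit_two_pow_sub_one]; simpa using hn)
  have hmod : ∀ m, m % 63 < 63 := fun m => Nat.mod_lt m (by norm_num)
  have hα63 := hpow α hα0
  have hdec : ∀ m, decode α (powCode (m % 63)) = α ^ m := fun m => by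
    rw [decode_powCode h2 hα (hmod m), ← pow_eq_pow_mod m hα63]
  have hlt : powCode ((i + 2 * k) % 63) ^^^ powCode ((j + k) % 63) < 2 ^ 6 :=
    Nat.xor_lt_two_pow (powCode_succ.2.1 _ (hmod _)) (powCode_succ.2.1 _ (hmod _))
  rw [testBit_missCodes _ hlt n hn, Bool.not_eq_false'] at h
  obtain ⟨l, hl, hcop, hcode⟩ := testBit_primCodes _ (Nat.xor_lt_two_pow (n := 6) hlt hn) h
  have hval : α ^ l = α ^ i * (α ^ k) ^ 2 + α ^ j * α ^ k + decode α n := by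
    rw [← decode_powCode h2 hα hl, hcode, decode_xor h2, decode_xor h2, hdec, hdec]
    ring
  refine ⟨α ^ k, hprim.pow_of_coprime k (coprime_of_mem_primExps k hk), ?_⟩
  rw [← hval]
  exact hprim.pow_of_coprime l hcop

end FieldOfOrder64

theorem disjoint_of_coprime_prod {s t : Finset ℕ} (hs : ∀ p ∈ s, p.Prime)
    (h : Nat.Coprime (∏ p ∈ s, p) (∏ p ∈ t, p)) : Disjoint s t :=
  Finset.disjoint_left.2 fun p hps hpt =>
    (hs p hps).one_lt.ne' (Nat.eq_one_of_dvd_coprimes h (Finset.dvd_prod_of_mem _ hps)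
      (Finset.dvd_prod_of_mem _ hpt))

/-- The lower-order terms in the bound of the modified prime sieve may be discarded. -/
theorem finsetAdmissible_of_div_lt_sqrt {E P L : Finset ℕ} {q : ℕ} (hP : 1 ≤ P.card)
    (hL : ∀ l ∈ L, l.Prime) {m w : ℝ} (hm : m = ∏ p ∈ E, (1 - 1 / (p : ℝ)))
    (hw : w = 2 ^ E.card)
    (hδε : 2 * ∑ l ∈ L, (1 : ℝ) / l < m ^ 2 * (1 - 2 * ∑ p ∈ P, (1 : ℝ) / p))
    (hq : (m ^ 2 * (2 * (P.card : ℝ) - 1 + 2 * (1 - 2 * ∑ p ∈ P, (1 : ℝ) / p)) *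
            (2 * w * (w - 3 / 2) + 3 * w / (2 * √(q : ℝ))) +
          (1 - 2 * ∑ p ∈ P, (1 : ℝ) / p) + (L.card : ℝ) - (∑ l ∈ L, (1 : ℝ) / l) +
          (1 / √(q : ℝ)) * (3 * m ^ 2 * (1 - 2 * ∑ p ∈ P, (1 : ℝ) / p) * w / 2 +
              2 * (L.card : ℝ) - (∑ l ∈ L, (1 : ℝ) / l))) /
          (m ^ 2 * (1 - 2 * ∑ p ∈ P, (1 : ℝ) / p) - 2 * ∑ l ∈ L, (1 : ℝ) / l) < √(q : ℝ)) :
    FinsetAdmissible E P L q := by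
  have hε0 : 0 ≤ ∑ l ∈ L, (1 : ℝ) / l := Finset.sum_nonneg fun _ _ => by positivity
  have hεr : ∑ l ∈ L, (1 : ℝ) / l ≤ L.card := by
    have := Finset.sum_le_card_nsmul L (fun l => (1 : ℝ) / l) 1 fun l hl => by
      rw [div_le_one (by exact_mod_cast (hL l hl).pos)]
      exact_mod_cast (hL l hl).one_le
    simpa using this
  have hw0 : 0 ≤ w := by rw [hw]; positivity
  have hs : (1 : ℝ) ≤ P.card := by exact_mod_cast hP
  rw [FinsetAdmissible, ← hm]
  have hw' : (2 : ℝ) * (2 ^ E.card) ^ 2 - 3 * 2 ^ E.card = 2 * w * (w - 3 / 2) := by rw [hw]; ring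
  rw [hw']
  generalize (1 - 2 * ∑ p ∈ P, (1 : ℝ) / p) = δ at *
  generalize (∑ l ∈ L, (1 : ℝ) / l) = ε at *
  refine ⟨hδε, ?_⟩
  have hδ : 0 < δ := pos_of_mul_pos_right (hε0.trans_lt (by linarith)) (sq_nonneg m)
  rw [div_lt_iff₀ (by linarith)] at hq
  have h1 : 0 ≤ m ^ 2 * (2 * (P.card : ℝ) - 1 + 2 * δ) * (3 * w / (2 * √(q : ℝ))) := by
    have : 0 ≤ 2 * (P.card : ℝ) - 1 + 2 * δ := by linarith
    positivity
  have h2 : 0 ≤ (1 / √(q : ℝ)) * (3 * m ^ 2 * δ * w / 2 + 2 * (L.card : ℝ) - ε) := by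
    have h3 : 0 ≤ 3 * m ^ 2 * δ * w / 2 := by positivity
    have : 0 ≤ 3 * m ^ 2 * δ * w / 2 + 2 * (L.card : ℝ) - ε := by linarith
    positivity
  linarith

/-- **Theorem 6, the modified prime sieve.** With
`Rad(q−1) = Rad(e)·P·L` (pairwise coprime), `P = p₁⋯p_s`, `L = l₁⋯l_r`,
`δ = 1 − 2Σ 1/pᵢ`, `ε = Σ 1/l_j`, `m = θ(e)`, `W = W(e)`: if `m²δ > 2ε` and
`√q > [m²(2s−1+2δ)(2W(W−3/2)+3W/(2√q)) + δ + r − ε + (1/√q)((3m²δW)/2 + 2r − ε)]/(m²δ−2ε)`,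
then there is a primitive root `g` of `F_q` such that `a·g² + b·g + c` is also primitive. -/
theorem stmt_10 (F : Type*) [Field F] [Fintype F]
    (a b c : F) (ha : a ≠ 0) (hdisc : b ^ 2 - 4 * a * c ≠ 0)
    (e : ℕ) (he : e ∣ Fintype.card F - 1)
    (ps ls : Finset ℕ)
    (hps : ∀ p ∈ ps, p.Prime ∧ p ∣ Fintype.card F - 1)
    (hls : ∀ l ∈ ls, l.Prime ∧ l ∣ Fintype.card F - 1)
    (hs : 1 ≤ ps.card) (hr : 1 ≤ ls.card)
    (hrad : Rad (Fintype.card F - 1) = Rad e * (∏ p ∈ ps, p) * (∏ l ∈ ls, l))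
    (hcop₁ : Nat.Coprime (Rad e) (∏ p ∈ ps, p))
    (hcop₂ : Nat.Coprime (Rad e) (∏ l ∈ ls, l))
    (hcop₃ : Nat.Coprime (∏ p ∈ ps, p) (∏ l ∈ ls, l))
    (hδε : 2 * ∑ l ∈ ls, (1 : ℝ) / l <
      θ e ^ 2 * (1 - 2 * ∑ p ∈ ps, (1 : ℝ) / p))
    (hq : (θ e ^ 2 * (2 * (ps.card : ℝ) - 1 + 2 * (1 - 2 * ∑ p ∈ ps, (1 : ℝ) / p)) *
            (2 * (W e : ℝ) * ((W e : ℝ) - 3 / 2) +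
              3 * (W e : ℝ) / (2 * Real.sqrt (Fintype.card F))) +
          (1 - 2 * ∑ p ∈ ps, (1 : ℝ) / p) + (ls.card : ℝ) - (∑ l ∈ ls, (1 : ℝ) / l) +
          (1 / Real.sqrt (Fintype.card F)) *
            (3 * θ e ^ 2 * (1 - 2 * ∑ p ∈ ps, (1 : ℝ) / p) * (W e : ℝ) / 2 +
              2 * (ls.card : ℝ) - (∑ l ∈ ls, (1 : ℝ) / l))) /
          (θ e ^ 2 * (1 - 2 * ∑ p ∈ ps, (1 : ℝ) / p) - 2 * ∑ l ∈ ls, (1 : ℝ) / l) <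
        Real.sqrt (Fintype.card F)) :
    ∃ g : F, IsPrimitiveRoot g (Fintype.card F - 1) ∧
      IsPrimitiveRoot (a * g ^ 2 + b * g + c) (Fintype.card F - 1) := by
  have hE : ∀ p ∈ e.primeFactors, p.Prime := fun _ => Nat.prime_of_mem_primeFactors
  have hP : ∀ p ∈ ps, p.Prime := fun p hp => (hps p hp).1
  have hL : ∀ l ∈ ls, l.Prime := fun l hl => (hls l hl).1
  have hEP := disjoint_of_coprime_prod hE hcop₁
  have hEPL : Disjoint (e.primeFactors ∪ ps) ls := Finset.disjoint_union_left.2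
    ⟨disjoint_of_coprime_prod hE hcop₂, disjoint_of_coprime_prod hP hcop₃⟩
  have hU : e.primeFactors ∪ ps ∪ ls = (Fintype.card F - 1).primeFactors := by
    rw [Rad, Rad, ← Finset.prod_union hEP, ← Finset.prod_union hEPL] at hrad
    rw [← Nat.primeFactors_prod (s := (Fintype.card F - 1).primeFactors)
      fun _ => Nat.prime_of_mem_primeFactors, hrad, Nat.primeFactors_prod]
    intro p hp
    simp only [Finset.mem_union] at hp
    rcases hp with (hp | hp) | hp
    exacts [hE p hp, hP p hp, hL p hp]
  by_cases h64 : Fintype.card F = 64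
  · have := exists_isPrimitiveRoot_of_card_eq_64 h64 ha hdisc
    rwa [h64]
  · exact exists_isPrimitiveRoot_of_finsetAdmissible ha hdisc hU hEP hEPL
      (Finset.card_pos.1 hs) (Finset.card_pos.1 hr)
      (finsetAdmissible_of_div_lt_sqrt hs hL (m := θ e) (w := (W e : ℝ)) rfl
        (by simp [W]) hδε hq) h64
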